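/- Let k ≥ 1 and m = 2k, and let G ∈ ℝ[x₀,x₁,x₂,x₃] be a nonzero homogeneous polynomial of degree m whose image in the quotient ring ℂ[x₀,x₁,x₂,x₃]/(x₀²+x₁²+x₂²−x₃²) is a squarefree element (i.e., the curve C = {x₀²+x₁²+x₂²−x₃² = 0, G = 0} ⊂ ℙ³(ℂ), of bidegree (m,m) on the quadric ellipsoid, is reduced). If the set ℝC = {[x] ∈ ℙ³(ℝ) : x₀²+x₁²+x₂² = x₃² and G(x) = 0} is finite, then |ℝC| ≤ 3k² − 2k + 2. -/

import Mathlib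

section
open MvPolynomial

/-- The quadric `x₀² + x₁² + x₂² − x₃²` over `ℂ`. -/
noncomputable def Qc : MvPolynomial (Fin 4) ℂ :=
  X 0 ^ 2 + X 1 ^ 2 + X 2 ^ 2 - X 3 ^ 2

/-- The image of `G` in the coordinate ring `ℂ[x₀,…,x₃]/(Q)` of the quadric ellipsoid
is a squarefree element. -/
noncomputable def SquarefreeOnEllipsoid (G : MvPolynomial (Fin 4) ℝ) : Prop :=
  Squarefree (Ideal.Quotient.mk (Ideal.span {Qc})
    (MvPolynomial.map (algebraMap ℝ ℂ) G))

/-- The real point set of the curve cut out on the quadric ellipsoid by `G`: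
points of `ℙ³(ℝ)` lying on the sphere `x₀² + x₁² + x₂² = x₃²` at which `G` vanishes. -/
noncomputable def sphereRZ (G : MvPolynomial (Fin 4) ℝ) :
    Set (Projectivization ℝ (Fin 4 → ℝ)) :=
  {x | x.rep 0 ^ 2 + x.rep 1 ^ 2 + x.rep 2 ^ 2 = x.rep 3 ^ 2 ∧
    MvPolynomial.eval x.rep G = 0}

end

namespace EC
open Module
set_option linter.unusedSectionVars false

/-! ### Hermitian forms and their negative index -/
section herm
variable {V : Type*} [AddCommGroup V] [Module ℂ V] [FiniteDimensional ℂ V]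

/-- Sesquilinear forms. -/
abbrev Sesq (V : Type*) [AddCommGroup V] [Module ℂ V] := V →ₗ[ℂ] V →ₗ⋆[ℂ] ℂ

/-- Hermitian forms. -/
def IsHerm (B : Sesq V) : Prop := ∀ x y, B x y = (starRingEnd ℂ) (B y x)

/-- Negative definite subspaces. -/
def NegDef (B : Sesq V) (W : Submodule ℂ V) : Prop := ∀ w ∈ W, w ≠ 0 → (B w w).re < 0

/-- Nonnegative subspaces. -/
def NonnegOn (B : Sesq V) (W : Submodule ℂ V) : Prop := ∀ w ∈ W, 0 ≤ (B w w).re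

/-- The negative index. -/
noncomputable def nind (B : Sesq V) : ℕ :=
  sSup {n | ∃ W : Submodule ℂ V, finrank ℂ W = n ∧ NegDef B W}

lemma negDef_bot (B : Sesq V) : NegDef B ⊥ := by
  intro w hw h0
  exact absurd ((Submodule.mem_bot ℂ).1 hw) h0

lemma nind_bdd (B : Sesq V) :
    BddAbove {n | ∃ W : Submodule ℂ V, finrank ℂ W = n ∧ NegDef B W} := by
  refine ⟨finrank ℂ V, ?_⟩
  rintro n ⟨W, rfl, -⟩
  exact Submodule.finrank_le W

lemma NegDef.le_nind {B : Sesq V} {W : Submodule ℂ V} (h : NegDef B W) :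
    finrank ℂ W ≤ nind B := le_csSup (nind_bdd B) ⟨W, rfl, h⟩

lemma exists_nind (B : Sesq V) : ∃ W : Submodule ℂ V, finrank ℂ W = nind B ∧ NegDef B W := by
  have := Nat.sSup_mem (s := {n | ∃ W : Submodule ℂ V, finrank ℂ W = n ∧ NegDef B W})
    ⟨0, ⊥, by simp, negDef_bot B⟩ (nind_bdd B)
  exact this

lemma nind_add_nonneg {B : Sesq V} {P : Submodule ℂ V} (h : NonnegOn B P) :
    nind B + finrank ℂ P ≤ finrank ℂ V := by
  obtain ⟨W, hW, hn⟩ := exists_nind B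
  rw [← hW]
  have hd : Disjoint W P := by
    rw [Submodule.disjoint_def]
    intro x hx hx'
    by_contra h0
    exact absurd (hn x hx h0) (not_lt.2 (h x hx'))
  exact Submodule.finrank_add_finrank_le_of_disjoint hd

/-- The orthogonal of a subspace. -/
def orth (B : Sesq V) (N : Submodule ℂ V) : Submodule ℂ V where
  carrier := {x | ∀ n ∈ N, B x n = 0}
  add_mem' := by
    intro a b ha hb n hn
    simp [ha n hn, hb n hn]
  zero_mem' := by intro n hn; simp
  smul_mem' := by
    intro c x hx n hn
    simp [hx n hn]

lemma finrank_orth (B : Sesq V) (N : Submodule ℂ V) :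
    finrank ℂ V ≤ finrank ℂ N + finrank ℂ (orth B N) := by
  -- the map x ↦ (i ↦ B x (b i))
  let b := Module.finBasis ℂ N
  let L : V →ₗ[ℂ] (Fin (finrank ℂ N) → ℂ) :=
    { toFun := fun x i => B x (b i)
      map_add' := by intro x y; ext i; simp
      map_smul' := by intro c x; ext i; simp }
  have h1 := LinearMap.finrank_range_add_finrank_ker L
  have h2 : LinearMap.ker L ≤ orth B N := by
    intro x hx n hn
    have hx' : ∀ i, B x (b i) = 0 := fun i => congrFun (LinearMap.mem_ker.1 hx) i
    have : (⟨n, hn⟩ : N) = ∑ i, b.repr ⟨n, hn⟩ i • b i := (b.sum_repr _).symm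
    have h3 : n = ∑ i, b.repr ⟨n, hn⟩ i • (b i : V) := by
      have h4 := congrArg (N.subtype) this
      rw [map_sum] at h4
      exact h4
    rw [h3]
    simp [hx']
  have h3 := Submodule.finrank_mono h2
  have h4 : finrank ℂ (LinearMap.range L) ≤ finrank ℂ N := by
    have := Submodule.finrank_le (LinearMap.range L)
    simpa using this
  omega

lemma IsHerm.self_eq {B : Sesq V} (hB : IsHerm B) (x : V) : B x x = ((B x x).re : ℂ) := by
  have := hB x x
  rw [eq_comm, Complex.conj_eq_iff_real] at this
  obtain ⟨r, hr⟩ := this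
  rw [hr]; simp

/-- decomposition into a negative definite subspace and its nonnegative orthogonal -/
lemma exists_decomp {B : Sesq V} (hB : IsHerm B) :
    ∃ N P : Submodule ℂ V, finrank ℂ N = nind B ∧ NegDef B N ∧ NonnegOn B P ∧
      finrank ℂ N + finrank ℂ P = finrank ℂ V ∧ N ⊔ P = ⊤ ∧ ∀ p ∈ P, ∀ n ∈ N, B p n = 0 := by
  obtain ⟨N, hN, hneg⟩ := exists_nind B
  have hnn : NonnegOn B (orth B N) := by
    intro w hw
    by_contra hlt
    push Not at hlt
    have hwN : w ∉ N := by
      intro h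
      rw [hw w h] at hlt
      simp at hlt
    have hnd : NegDef B (N ⊔ Submodule.span ℂ {w}) := by
      intro x hx h0
      obtain ⟨n, hn, y, hy, rfl⟩ := Submodule.mem_sup.1 hx
      obtain ⟨c, rfl⟩ := Submodule.mem_span_singleton.1 hy
      have e1 : B w n = 0 := hw n hn
      have e2 : B n w = 0 := by rw [hB, e1]; simp
      have e3 : B (n + c • w) (n + c • w) = B n n + ((Complex.normSq c : ℝ) : ℂ) * B w w := by
        simp [e1, e2, Complex.normSq_eq_conj_mul_self]
        ring
      rw [e3, Complex.add_re, Complex.re_ofReal_mul]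
      by_cases hc : c = 0
      · subst hc
        have hn0 : n ≠ 0 := by simpa using h0
        simpa using hneg n hn hn0
      · have hc' : 0 < Complex.normSq c := Complex.normSq_pos.2 hc
        have : (B n n).re ≤ 0 := by
          by_cases hn0 : n = 0
          · subst hn0; simp
          · exact (hneg n hn hn0).le
        nlinarith
    have h1 := hnd.le_nind
    have hd : Disjoint N (Submodule.span ℂ {w}) := by
      rw [Submodule.disjoint_def]
      intro x hx hx'
      obtain ⟨c, rfl⟩ := Submodule.mem_span_singleton.1 hx'
      by_cases hc : c = 0
      · simp [hc]
      · exfalso; apply hwN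
        have := N.smul_mem c⁻¹ hx
        rwa [smul_smul, inv_mul_cancel₀ hc, one_smul] at this
    have h2 := Submodule.finrank_sup_add_finrank_inf_eq N (Submodule.span ℂ {w})
    rw [disjoint_iff.1 hd, finrank_bot, finrank_span_singleton] at h2
    · omega
    · intro h
      rw [h] at hwN
      exact hwN N.zero_mem
  refine ⟨N, orth B N, hN, hneg, hnn, ?_, ?_, fun p hp n hn => hp n hn⟩
  · have h1 := finrank_orth B N
    have h2 := nind_add_nonneg hnn
    omega
  · have hd : Disjoint N (orth B N) := by
      rw [Submodule.disjoint_def]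
      intro x hx hx'
      by_contra h0
      exact absurd (hneg x hx h0) (not_lt.2 (hnn x hx'))
    have h1 := finrank_orth B N
    have h2 := Submodule.finrank_sup_add_finrank_inf_eq N (orth B N)
    rw [disjoint_iff.1 hd, finrank_bot] at h2
    apply Submodule.eq_top_of_finrank_eq
    have := Submodule.finrank_le (N ⊔ orth B N)
    omega

/-- Cauchy–Schwarz on a nonnegative subspace, degenerate case -/
lemma cs_zero {B : Sesq V} (hB : IsHerm B) {P : Submodule ℂ V} (hP : NonnegOn B P)
    {w : V} (hw : w ∈ P) (h0 : (B w w).re = 0) {p : V} (hp : p ∈ P) : B w p = 0 := by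
  have hww : B w w = 0 := by rw [hB.self_eq, h0]; simp
  by_contra hne
  set c := B w p with hc
  have hpw : B p w = (starRingEnd ℂ) c := hB p w
  have key : ∀ t : ℝ, 0 ≤ (B p p).re - 2 * t * Complex.normSq c := by
    intro t
    have hm : p + (-(t : ℂ) * (starRingEnd ℂ) c) • w ∈ P := P.add_mem hp (P.smul_mem _ hw)
    have := hP _ hm
    have e : B (p + (-(t : ℂ) * (starRingEnd ℂ) c) • w) (p + (-(t : ℂ) * (starRingEnd ℂ) c) • w)
        = B p p + ((-(2 * t * Complex.normSq c) : ℝ) : ℂ) := by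
      simp [hww, hpw, ← hc, Complex.normSq_eq_conj_mul_self]
      ring
    rw [e, Complex.add_re, Complex.ofReal_re] at this
    linarith
  have hpos : 0 < Complex.normSq c := Complex.normSq_pos.2 hne
  have := key (((B p p).re + 1) / (2 * Complex.normSq c))
  have e : 2 * (((B p p).re + 1) / (2 * Complex.normSq c)) * Complex.normSq c = (B p p).re + 1 := by
    field_simp
  linarith

/-- Nondegeneracy. -/
def Nondeg (B : Sesq V) : Prop := ∀ x, (∀ y, B x y = 0) → x = 0

lemma isotropic_le {B : Sesq V} (hB : IsHerm B) (hnd : Nondeg B) {W : Submodule ℂ V}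
    (hW : ∀ w ∈ W, (B w w).re = 0) : finrank ℂ W ≤ nind B := by
  obtain ⟨N, P, hN, hneg, hP, hdim, hsup, horth⟩ := exists_decomp hB
  have hd : Disjoint W P := by
    rw [Submodule.disjoint_def]
    intro x hx hx'
    apply hnd
    intro y
    have : y ∈ N ⊔ P := hsup ▸ Submodule.mem_top
    obtain ⟨n, hn, p, hp, rfl⟩ := Submodule.mem_sup.1 this
    rw [map_add, horth x hx' n hn, cs_zero hB hP hx' (hW x hx) hp, add_zero]
  have := Submodule.finrank_add_finrank_le_of_disjoint hd
  omega

lemma nind_add_nind_neg {B : Sesq V} (hB : IsHerm B) (hnd : Nondeg B) :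
    finrank ℂ V ≤ nind B + nind (-B) := by
  obtain ⟨N, P, hN, hneg, hP, hdim, hsup, horth⟩ := exists_decomp hB
  have : NegDef (-B) P := by
    intro w hw h0
    have h1 := hP w hw
    rcases h1.lt_or_eq with h | h
    · simpa using h
    · exfalso; apply h0; apply hnd
      intro y
      have : y ∈ N ⊔ P := hsup ▸ Submodule.mem_top
      obtain ⟨n, hn, p, hp, rfl⟩ := Submodule.mem_sup.1 this
      rw [map_add, horth w hw n hn, cs_zero hB hP hw h.symm hp, add_zero]
  have := this.le_nind
  omega

lemma nind_add_nind_neg_le (B : Sesq V) : nind B + nind (-B) ≤ finrank ℂ V := by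
  obtain ⟨W, hW, hn⟩ := exists_nind (-B)
  rw [← hW]
  apply nind_add_nonneg
  intro w hw
  by_cases h0 : w = 0
  · simp [h0]
  · have := hn w hw h0
    simp at this
    exact this.le

lemma nind_add_le {B₁ B₂ : Sesq V} (h₁ : IsHerm B₁) (h₂ : IsHerm B₂) :
    nind (B₁ + B₂) ≤ nind B₁ + nind B₂ := by
  obtain ⟨N, P, hN, hneg, hP, hdim, hsup, horth⟩ := exists_decomp h₁
  obtain ⟨N', P', hN', hneg', hP', hdim', hsup', horth'⟩ := exists_decomp h₂
  have h : NonnegOn (B₁ + B₂) (P ⊓ P') := by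
    intro w hw
    have h1 := hP w hw.1
    have h2 := hP' w hw.2
    simp
    linarith
  have h3 := nind_add_nonneg h
  have h4 := Submodule.finrank_sup_add_finrank_inf_eq P P'
  have h5 := Submodule.finrank_le (P ⊔ P')
  omega

/-- pull back along a linear map -/
lemma nind_map_le {B₁ B : Sesq V} (T : V →ₗ[ℂ] V) (h : ∀ x, B₁ x x = B (T x) (T x)) :
    nind B₁ ≤ nind B := by
  obtain ⟨W, hW, hn⟩ := exists_nind B₁
  have hinj : Function.Injective (T.domRestrict W) := by
    rw [← LinearMap.ker_eq_bot, LinearMap.ker_eq_bot']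
    intro x hx
    by_contra h0
    have := hn x x.2 (by simpa using h0)
    rw [h] at this
    have hx' : T x = 0 := hx
    simp [hx'] at this
  have h1 : finrank ℂ (LinearMap.range (T.domRestrict W)) = finrank ℂ W :=
    LinearMap.finrank_range_of_inj hinj
  rw [← hW, ← h1]
  apply NegDef.le_nind
  rintro _ ⟨x, rfl⟩ h0
  rw [LinearMap.domRestrict_apply, ← h]
  apply hn x x.2
  rintro h
  apply h0
  have : x = 0 := by simpa using h
  simp [this]

/-- superadditivity along a direct sum -/
lemma nind_sum_le {B₁ B₂ B : Sesq V} (T₁ T₂ : V →ₗ[ℂ] V)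
    (h1 : ∀ x, B₁ x x = B (T₁ x) (T₁ x)) (h2 : ∀ x, B₂ x x = B (T₂ x) (T₂ x))
    (h12 : ∀ x y, B (T₁ x) (T₂ y) = 0) (h21 : ∀ x y, B (T₂ x) (T₁ y) = 0) :
    nind B₁ + nind B₂ ≤ nind B := by
  obtain ⟨W₁, hW₁, hn₁⟩ := exists_nind B₁
  obtain ⟨W₂, hW₂, hn₂⟩ := exists_nind B₂
  have key : ∀ x ∈ W₁, ∀ y ∈ W₂, ¬ (x = 0 ∧ y = 0) →
      (B (T₁ x + T₂ y) (T₁ x + T₂ y)).re < 0 := by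
    intro x hx y hy hne
    have e : B (T₁ x + T₂ y) (T₁ x + T₂ y) = B₁ x x + B₂ y y := by
      simp [h12, h21, h1, h2]
    rw [e, Complex.add_re]
    by_cases hx0 : x = 0
    · have := hn₂ y hy (fun h => hne ⟨hx0, h⟩)
      simpa [hx0] using this
    · have hx1 := hn₁ x hx hx0
      by_cases hy0 : y = 0
      · simpa [hy0] using hx1
      · have := hn₂ y hy hy0
        linarith
  let T : (W₁ × W₂) →ₗ[ℂ] V := (T₁.domRestrict W₁).coprod (T₂.domRestrict W₂)
  have hT : ∀ x : W₁ × W₂, T x = T₁ x.1 + T₂ x.2 := fun x => rfl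
  have hinj : Function.Injective T := by
    rw [← LinearMap.ker_eq_bot, LinearMap.ker_eq_bot']
    rintro ⟨x, y⟩ hx
    by_contra h0
    have := key x x.2 y y.2 (by
      rintro ⟨ha, hb⟩
      apply h0
      ext <;> simp [ha, hb])
    rw [hT] at hx
    simp only at hx
    rw [hx] at this
    simp at this
  have h1 : finrank ℂ (LinearMap.range T) = finrank ℂ (W₁ × W₂) :=
    LinearMap.finrank_range_of_inj hinj
  rw [finrank_prod, hW₁, hW₂] at h1
  rw [← h1]
  apply NegDef.le_nind
  rintro _ ⟨⟨x, y⟩, rfl⟩ h0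
  rw [hT]
  apply key _ x.2 _ y.2
  rintro ⟨ha, hb⟩
  apply h0
  rw [hT]; simp [ha, hb]

end herm
end EC

namespace EC
open Module
set_option linter.unusedSectionVars false

section alg
variable {M : Type*} [CommRing M] [Algebra ℂ M] [FiniteDimensional ℂ M]

/-- A conjugate-linear involution together with a compatible functional. -/
structure InvF (M : Type*) [CommRing M] [Algebra ℂ M] where
  /-- the involution -/
  σ : M →+* M
  inv : ∀ x, σ (σ x) = x
  hconj : ∀ c : ℂ, σ (algebraMap ℂ M c) = algebraMap ℂ M ((starRingEnd ℂ) c)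
  /-- the functional -/
  φ : M →ₗ[ℂ] ℂ
  hφ : ∀ x, φ (σ x) = (starRingEnd ℂ) (φ x)
  nd : ∀ g, (∀ h, φ (g * h) = 0) → g = 0

namespace InvF
variable (S : InvF M)

lemma σ_smul (c : ℂ) (x : M) : S.σ (c • x) = (starRingEnd ℂ) c • S.σ x := by
  rw [Algebra.smul_def, map_mul, S.hconj, Algebra.smul_def]

/-- the Hermitian form `φ (g h σ k)` -/
noncomputable def form (g : M) : Sesq M :=
  LinearMap.mk₂'ₛₗ (RingHom.id ℂ) (starRingEnd ℂ) (fun x y => S.φ (g * (x * S.σ y)))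
    (by intro a b c; rw [add_mul, mul_add, map_add])
    (by intro c a b
        rw [smul_mul_assoc, mul_smul_comm, map_smul]; rfl)
    (by intro a b c; rw [map_add, mul_add, mul_add, map_add])
    (by intro c a b
        rw [S.σ_smul, mul_smul_comm, mul_smul_comm, map_smul])

lemma form_apply (g x y : M) : S.form g x y = S.φ (g * (x * S.σ y)) := rfl

lemma form_herm {g : M} (hg : S.σ g = g) : IsHerm (S.form g) := by
  intro x y
  rw [form_apply, form_apply, ← S.hφ]
  congr 1
  simp only [map_mul, S.inv, hg]
  ring

lemma form_nondeg {g : M} (hg : IsUnit g) : Nondeg (S.form g) := by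
  intro x hx
  have h1 : g * x = 0 := by
    apply S.nd
    intro h
    have := hx (S.σ h)
    rw [form_apply, S.inv] at this
    rwa [mul_assoc]
  exact (hg.mul_right_eq_zero).1 h1

lemma form_add (g h : M) : S.form (g + h) = S.form g + S.form h := by
  ext x y
  simp [form_apply, add_mul]

lemma form_neg (g : M) : S.form (-g) = - S.form g := by
  ext x y
  simp [form_apply]

/-- the negative index of the form attached to `g` -/
noncomputable def nn (g : M) : ℕ := nind (S.form g)

lemma nn_mul_le (g b : M) : S.nn (b * S.σ b * g) ≤ S.nn g := by
  apply nind_map_le (LinearMap.mulLeft ℂ b)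
  intro x
  rw [form_apply, form_apply]
  congr 1
  simp only [LinearMap.mulLeft_apply, map_mul]
  ring

lemma nn_mul_unit (g : M) {b : M} (hb : IsUnit b) : S.nn (b * S.σ b * g) = S.nn g := by
  apply le_antisymm (S.nn_mul_le g b)
  obtain ⟨b, rfl⟩ := hb
  have := S.nn_mul_le ((b : M) * S.σ b * g) ((b⁻¹ : Mˣ) : M)
  have e : ((b⁻¹ : Mˣ) : M) * S.σ ((b⁻¹ : Mˣ) : M) * ((b : M) * S.σ b * g) = g := by
    have h1 : ((b⁻¹ : Mˣ) : M) * (b : M) = 1 := by simp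
    have h2 : S.σ ((b⁻¹ : Mˣ) : M) * S.σ (b : M) = 1 := by rw [← map_mul, h1, map_one]
    linear_combination (S.σ ((b⁻¹ : Mˣ) : M) * S.σ b * g) * h1 + g * h2
  rwa [e] at this

lemma nn_add_le {g h : M} (hg : S.σ g = g) (hh : S.σ h = h) : S.nn (g + h) ≤ S.nn g + S.nn h := by
  unfold nn
  rw [form_add]
  exact nind_add_le (S.form_herm hg) (S.form_herm hh)

lemma nn_idem {g e : M} (hg : S.σ g = g) (he : S.σ e = e) (hee : e * e = e) :
    S.nn g = S.nn (g * e) + S.nn (g * (1 - e)) := by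
  apply le_antisymm
  · have := S.nn_add_le (g := g * e) (h := g * (1 - e)) (by rw [map_mul, hg, he])
      (by rw [map_mul, hg, map_sub, he, map_one])
    rwa [← mul_add, add_sub_cancel, mul_one] at this
  · apply nind_sum_le (LinearMap.mulLeft ℂ e) (LinearMap.mulLeft ℂ (1 - e))
    · intro x
      simp only [form_apply, LinearMap.mulLeft_apply, map_mul, he]
      congr 1
      linear_combination (-(g * (x * S.σ x))) * hee
    · intro x
      simp only [form_apply, LinearMap.mulLeft_apply, map_mul, he, map_sub, map_one]
      congr 1
      linear_combination (-(g * (x * S.σ x))) * hee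
    · intro x y
      simp only [form_apply, LinearMap.mulLeft_apply, map_mul, he, map_sub, map_one]
      have : g * (e * x * ((1 - e) * S.σ y)) = 0 := by
        linear_combination (-(g * (x * S.σ y))) * hee
      rw [this, map_zero]
    · intro x y
      simp only [form_apply, LinearMap.mulLeft_apply, map_mul, he, map_sub, map_one]
      have : g * ((1 - e) * x * (e * S.σ y)) = 0 := by
        linear_combination (-(g * (x * S.σ y))) * hee
      rw [this, map_zero]

lemma nn_compl {g : M} (hg : S.σ g = g) (hu : IsUnit g) : S.nn g + S.nn (-g) = finrank ℂ M := by
  unfold nn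
  rw [form_neg]
  exact le_antisymm (nind_add_nind_neg_le _) (nind_add_nind_neg (S.form_herm hg) (S.form_nondeg hu))

lemma nn_compl_le (g : M) : S.nn g + S.nn (-g) ≤ finrank ℂ M := by
  unfold nn
  rw [form_neg]
  exact nind_add_nind_neg_le _

end InvF

/-! ### Characters -/

lemma exists_char_of_maximal (I : Ideal M) (hI : I.IsMaximal) :
    ∃ χ : M →ₐ[ℂ] ℂ, ∀ x, χ x = 0 ↔ x ∈ I := by
  letI := Ideal.Quotient.field I
  have hb : Function.Bijective (algebraMap ℂ (M ⧸ I)) :=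
    IsAlgClosed.algebraMap_bijective_of_isIntegral
  let e : ℂ ≃ₐ[ℂ] (M ⧸ I) := AlgEquiv.ofBijective (Algebra.ofId ℂ (M ⧸ I)) hb
  refine ⟨(e.symm : (M ⧸ I) →ₐ[ℂ] ℂ).comp (Ideal.Quotient.mkₐ ℂ I), ?_⟩
  intro x
  simp only [AlgHom.comp_apply, Ideal.Quotient.mkₐ_eq_mk]
  rw [← Ideal.Quotient.eq_zero_iff_mem]
  constructor
  · intro h
    have := congrArg e h
    simpa using this
  · intro h
    rw [h]; simp

lemma isUnit_of_char {x : M} (h : ∀ χ : M →ₐ[ℂ] ℂ, χ x ≠ 0) : IsUnit x := by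
  by_contra hx
  obtain ⟨I, hI, hxI⟩ := exists_max_ideal_of_mem_nonunits hx
  obtain ⟨χ, hχ⟩ := exists_char_of_maximal I hI
  exact h χ ((hχ x).2 hxI)

lemma isNilpotent_of_char {x : M} (h : ∀ χ : M →ₐ[ℂ] ℂ, χ x = 0) : IsNilpotent x := by
  rw [← mem_nilradical, nilradical_eq_sInf, Submodule.mem_sInf]
  intro I hI
  haveI : IsArtinianRing M := IsArtinianRing.of_finite ℂ M
  have hp : Ideal.IsPrime I := hI
  have hm : Ideal.IsMaximal I := IsArtinianRing.isMaximal_of_isPrime I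
  obtain ⟨χ, hχ⟩ := exists_char_of_maximal I hm
  exact (hχ x).1 (h χ)

instance finite_chars : Finite (M →ₐ[ℂ] ℂ) := by
  have h := linearIndependent_toLinearMap ℂ M ℂ
  exact h.finite

lemma char_interp (c : (M →ₐ[ℂ] ℂ) → ℂ) : ∃ b : M, ∀ χ : M →ₐ[ℂ] ℂ, χ b = c χ := by
  classical
  haveI := Fintype.ofFinite (M →ₐ[ℂ] ℂ)
  have h1 : ∀ χ χ' : M →ₐ[ℂ] ℂ, ∃ x : M, χ ≠ χ' → χ x = 1 ∧ χ' x = 0 := by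
    intro χ χ'
    by_cases h : χ = χ'
    · exact ⟨0, fun h' => absurd h h'⟩
    · obtain ⟨x, hx⟩ : ∃ x, χ x ≠ χ' x := by
        by_contra hc
        push Not at hc
        exact h (AlgHom.ext hc)
      refine ⟨(χ x - χ' x)⁻¹ • (x - algebraMap ℂ M (χ' x)), fun _ => ⟨?_, ?_⟩⟩
      · simp [inv_mul_cancel₀ (sub_ne_zero.2 hx)]
      · simp
  choose x hx using h1
  refine ⟨∑ χ, c χ • ∏ χ' ∈ Finset.univ.erase χ, x χ χ', ?_⟩
  intro χ
  rw [map_sum, Finset.sum_eq_single χ]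
  · rw [map_smul, map_prod, Finset.prod_eq_one, smul_eq_mul, mul_one]
    intro χ' h'
    exact (hx χ χ' (Finset.ne_of_mem_erase h').symm).1
  · intro χ' _ hne
    rw [map_smul, map_prod, Finset.prod_eq_zero (i := χ), smul_zero]
    · simp [hne.symm]
    · exact (hx χ' χ hne).2
  · intro h; exact absurd (Finset.mem_univ _) h

namespace InvF
variable (S : InvF M)

/-- the conjugate character -/
noncomputable def cstar (χ : M →ₐ[ℂ] ℂ) : M →ₐ[ℂ] ℂ :=
  { ((starRingEnd ℂ).comp (χ : M →+* ℂ)).comp S.σ with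
    commutes' := by
      intro r
      simp [S.hconj] }

lemma cstar_apply (χ : M →ₐ[ℂ] ℂ) (x : M) : S.cstar χ x = (starRingEnd ℂ) (χ (S.σ x)) := rfl

lemma cstar_cstar (χ : M →ₐ[ℂ] ℂ) : S.cstar (S.cstar χ) = χ := by
  ext x; simp [cstar_apply, S.inv]

lemma apply_σ (χ : M →ₐ[ℂ] ℂ) (x : M) : χ (S.σ x) = (starRingEnd ℂ) (S.cstar χ x) := by
  simp [cstar_apply]

/-- real characters -/
def IsRealC (χ : M →ₐ[ℂ] ℂ) : Prop := S.cstar χ = χ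

lemma exists_sq_nilp {n : M} (hn : IsNilpotent n) (hσ : S.σ n = n) :
    ∃ s, S.σ s = s ∧ s * s = 1 + n := by
  have h := Polynomial.existsUnique_nilpotent_sub_and_aeval_eq_zero
    (P := (Polynomial.X ^ 2 - Polynomial.C (1 + n) : Polynomial M)) (x := (1 : M)) (by
      simpa using hn) (by
      simp only [Polynomial.derivative_sub, Polynomial.derivative_X_pow, Polynomial.derivative_C]
      have : IsUnit (algebraMap ℂ M 2) := (isUnit_iff_ne_zero.2 two_ne_zero).map _
      rw [map_ofNat] at this
      simpa using this)
  obtain ⟨s, ⟨hs1, hs2⟩, huniq⟩ := h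
  have hs2' : s * s = 1 + n := by
    simp at hs2
    linear_combination hs2
  refine ⟨s, ?_, hs2'⟩
  apply huniq
  refine ⟨?_, ?_⟩
  · have := hs1.map S.σ
    simpa using this
  · have := congrArg S.σ hs2'
    simp only [map_mul, map_add, map_one, hσ] at this
    simp
    linear_combination this

/-- existence of Hermitian square roots -/
lemma exists_herm_sqrt {g : M} (hg : S.σ g = g) (hu : ∀ χ : M →ₐ[ℂ] ℂ, χ g ≠ 0)
    (hpos : ∀ χ, S.IsRealC χ → 0 < (χ g).re) : ∃ b, IsUnit b ∧ g = b * S.σ b := by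
  classical
  have hreal : ∀ χ, S.IsRealC χ → χ g = ((χ g).re : ℂ) := by
    intro χ hχ
    have : (starRingEnd ℂ) (χ g) = χ g := by
      conv_rhs => rw [← hg, apply_σ, hχ]
    obtain ⟨r, hr⟩ := Complex.conj_eq_iff_real.1 this
    rw [hr]; simp
  obtain ⟨i, hi⟩ : ∃ i : (M →ₐ[ℂ] ℂ) → ℕ, Function.Injective i :=
    Countable.exists_injective_nat _
  obtain ⟨b, hb⟩ := char_interp (fun χ : M →ₐ[ℂ] ℂ => if S.cstar χ = χ then ((Real.sqrt (χ g).re : ℝ) : ℂ)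
    else if i χ < i (S.cstar χ) then χ g else 1)
  have hbg : ∀ χ : M →ₐ[ℂ] ℂ, χ (b * S.σ b) = χ g := by
    intro χ
    rw [map_mul, apply_σ, hb, hb, cstar_cstar]
    by_cases h : S.cstar χ = χ
    · rw [if_pos h, if_pos (by rw [h]), h, Complex.conj_ofReal, ← Complex.ofReal_mul,
        Real.mul_self_sqrt (hpos χ h).le, ← hreal χ h]
    · rw [if_neg h, if_neg (c := χ = S.cstar χ) (fun h' => h h'.symm)]
      have hne : i χ ≠ i (S.cstar χ) := fun h' => h (hi h').symm
      by_cases hlt : i χ < i (S.cstar χ)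
      · rw [if_pos hlt, if_neg (by omega)]; simp
      · rw [if_neg hlt, if_pos (by omega)]
        rw [← apply_σ, hg, one_mul]
  have hbu : IsUnit (b * S.σ b) := isUnit_of_char (fun χ => by rw [hbg]; exact hu χ)
  have hb1 : IsUnit b := isUnit_of_mul_isUnit_left hbu
  obtain ⟨c, hc⟩ := hbu
  set d : M := ((c⁻¹ : Mˣ) : M) with hd
  have hcd : b * S.σ b * d = 1 := by rw [← hc]; simp [hd]
  have hσc : S.σ (b * S.σ b) = b * S.σ b := by rw [map_mul, S.inv, mul_comm]
  have hσd : S.σ d = d := by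
    have h1 := congrArg S.σ hcd
    rw [map_mul, hσc, map_one] at h1
    linear_combination (-S.σ d) * hcd + d * h1
  obtain ⟨s, hs, hss⟩ := S.exists_sq_nilp (n := g * d - 1) (isNilpotent_of_char (by
      intro χ
      have h1 := congrArg χ hcd
      rw [map_mul, hbg, map_one] at h1
      rw [map_sub, map_mul, h1, map_one, sub_self])) (by
      rw [map_sub, map_mul, hg, hσd, map_one])
  have hg' : g = (b * s) * S.σ (b * s) := by
    rw [map_mul, hs]
    linear_combination (-g) * hcd - (b * S.σ b) * hss
  refine ⟨b * s, ?_, hg'⟩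
  have : IsUnit g := isUnit_of_char hu
  rw [hg'] at this
  exact isUnit_of_mul_isUnit_left this

/-- the index depends only on the signs at the real characters -/
lemma nn_congr {g g' : M} (hg : S.σ g = g) (hg' : S.σ g' = g')
    (hu : ∀ χ : M →ₐ[ℂ] ℂ, χ g ≠ 0) (hu' : ∀ χ : M →ₐ[ℂ] ℂ, χ g' ≠ 0)
    (hs : ∀ χ, S.IsRealC χ → (0 < (χ g).re ↔ 0 < (χ g').re)) : S.nn g = S.nn g' := by
  have hreal : ∀ χ, S.IsRealC χ → ∀ x, S.σ x = x → χ x = ((χ x).re : ℂ) := by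
    intro χ hχ x hx
    have : (starRingEnd ℂ) (χ x) = χ x := by
      conv_rhs => rw [← hx, apply_σ, hχ]
    obtain ⟨r, hr⟩ := Complex.conj_eq_iff_real.1 this
    rw [hr]; simp
  obtain ⟨b, hb, hbe⟩ := S.exists_herm_sqrt (g := g * g') (by rw [map_mul, hg, hg'])
    (by intro χ; rw [map_mul]; exact mul_ne_zero (hu χ) (hu' χ)) (by
      intro χ hχ
      have h1 := hreal χ hχ g hg
      have h2 := hreal χ hχ g' hg'
      have h1' : (χ g).re ≠ 0 := fun h => hu χ (by rw [h1, h]; simp)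
      have h2' : (χ g').re ≠ 0 := fun h => hu' χ (by rw [h2, h]; simp)
      rw [map_mul, h1, h2, ← Complex.ofReal_mul, Complex.ofReal_re]
      rcases lt_or_gt_of_ne h1' with h | h
      · have : ¬ 0 < (χ g').re := by rw [← hs χ hχ]; exact not_lt.2 h.le
        exact mul_pos_of_neg_of_neg h (lt_of_le_of_ne (not_lt.1 this) h2')
      · exact mul_pos h ((hs χ hχ).1 h))
  have h1 := S.nn_mul_unit g hb
  have h2 : S.nn (g * S.σ g * g') = S.nn g' := S.nn_mul_unit g' (isUnit_of_char hu)
  rw [← hbe] at h1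
  rw [hg] at h2
  rw [← h1, ← h2]
  congr 1; ring

lemma exists_idem {p : M →ₐ[ℂ] ℂ} (hp : S.IsRealC p) :
    ∃ e : M, e * e = e ∧ S.σ e = e ∧ p e = 1 ∧ ∀ χ : M →ₐ[ℂ] ℂ, χ ≠ p → χ e = 0 := by
  classical
  obtain ⟨e0, he0⟩ := char_interp (fun χ : M →ₐ[ℂ] ℂ => if χ = p then 1 else 0)
  have h := Polynomial.existsUnique_nilpotent_sub_and_aeval_eq_zero
    (P := (Polynomial.X ^ 2 - Polynomial.X : Polynomial M)) (x := e0) (by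
      apply isNilpotent_of_char
      intro χ
      simp [he0]) (by
      apply isUnit_of_char
      intro χ
      simp [he0]
      split_ifs <;> norm_num)
  obtain ⟨e, ⟨h1, h2⟩, huniq⟩ := h
  have hee : e * e = e := by
    simp at h2
    linear_combination h2
  have hval : ∀ χ : M →ₐ[ℂ] ℂ, χ e = χ e0 := by
    intro χ
    have := h1.map χ
    rw [isNilpotent_iff_eq_zero, map_sub, sub_eq_zero] at this
    exact this.symm
  refine ⟨e, hee, ?_, ?_, ?_⟩
  · apply huniq
    refine ⟨?_, ?_⟩
    · apply isNilpotent_of_char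
      intro χ
      rw [map_sub, apply_σ, hval, he0, he0]
      have : S.cstar χ = p ↔ χ = p := by
        constructor
        · intro h
          rw [← S.cstar_cstar χ, h]; exact hp
        · intro h; rw [h]; exact hp
      simp only [this]
      split_ifs <;> simp
    · have := congrArg S.σ hee
      rw [map_mul] at this
      simp
      linear_combination this
  · rw [hval, he0, if_pos rfl]
  · intro χ hχ
    rw [hval, he0, if_neg hχ]

/-- globalization of the local index computation -/
lemma nn_global (T : Finset (M →ₐ[ℂ] ℂ)) (hT : ∀ p ∈ T, S.IsRealC p)
    (hloc : ∀ p ∈ T, ∃ s, S.σ s = s ∧ (∀ χ : M →ₐ[ℂ] ℂ, χ s ≠ 0) ∧ (p s).re < 0 ∧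
      (∀ χ, S.IsRealC χ → χ ≠ p → 0 < (χ s).re) ∧ S.nn 1 + 1 ≤ S.nn s)
    {g : M} (hg : S.σ g = g) (hu : ∀ χ : M →ₐ[ℂ] ℂ, χ g ≠ 0) (hneg : ∀ p ∈ T, (p g).re < 0)
    (hpos : ∀ χ, S.IsRealC χ → χ ∉ T → 0 < (χ g).re) : S.nn 1 + T.card ≤ S.nn g := by
  classical
  -- local inequality at each idempotent
  have hl : ∀ p ∈ T, ∀ e : M, e * e = e → S.σ e = e → p e = 1 → (∀ χ : M →ₐ[ℂ] ℂ, χ ≠ p → χ e = 0) →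
      S.nn e + 1 ≤ S.nn (-e) := by
    intro p hp e hee hσ hpe hχe
    obtain ⟨s, hs, hsu, hsp, hspos, hsn⟩ := hloc p hp
    have hσ' : S.σ (1 - 2 * e) = 1 - 2 * e := by simp [hσ, map_ofNat]
    have h1 : S.nn s = S.nn (1 - 2 * e) := by
      apply S.nn_congr hs hσ' hsu
      · intro χ
        by_cases h : χ = p
        · subst h; simp [hpe, map_ofNat]; norm_num
        · simp [hχe χ h, map_ofNat]
      · intro χ hχ
        by_cases h : χ = p
        · subst h; simp [hpe, map_ofNat]; exact hsp.le
        · simp [hχe χ h, map_ofNat, hspos χ hχ h]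
    have h2 := S.nn_idem (g := 1 - 2 * e) hσ' hσ hee
    have h3 := S.nn_idem (g := 1) (map_one _) hσ hee
    have e1 : (1 - 2 * e) * e = -e := by linear_combination (-2 : M) * hee
    have e2 : (1 - 2 * e) * (1 - e) = 1 * (1 - e) := by linear_combination (2 : M) * hee
    rw [e1, e2] at h2
    rw [one_mul] at h3
    omega
  have main : ∀ T' : Finset (M →ₐ[ℂ] ℂ), T' ⊆ T → ∃ u, S.σ u = u ∧
      (∀ χ ∈ T', χ u = -1) ∧ (∀ χ ∉ T', χ u = 1) ∧
      (∀ e : M, e * e = e → (∀ χ ∈ T', χ e = 0) → u * e = e) ∧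
      S.nn 1 + T'.card ≤ S.nn u := by
    intro T'
    induction T' using Finset.induction_on with
    | empty =>
      intro _
      exact ⟨1, map_one _, by simp, by simp, by simp, by simp⟩
    | insert p T' hpT ih =>
      intro hsub
      rw [Finset.insert_subset_iff] at hsub
      obtain ⟨u, hu1, hu2, hu3, hu4, hu5⟩ := ih hsub.2
      obtain ⟨e, hee, hσ, hpe, hχe⟩ := S.exists_idem (hT p hsub.1)
      have hue : u * e = e := hu4 e hee (fun χ hχ => hχe χ (by rintro rfl; exact hpT hχ))
      have hσ' : S.σ (u * (1 - 2 * e)) = u * (1 - 2 * e) := by simp [hσ, hu1, map_ofNat]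
      refine ⟨u * (1 - 2 * e), hσ', ?_, ?_, ?_, ?_⟩
      · intro χ hχ
        rw [Finset.mem_insert] at hχ
        rcases hχ with rfl | hχ
        · simp [hu3 χ hpT, hpe, map_ofNat]; norm_num
        · have : χ ≠ p := by rintro rfl; exact hpT hχ
          simp [hu2 χ hχ, hχe χ this, map_ofNat]
      · intro χ hχ
        rw [Finset.mem_insert, not_or] at hχ
        simp [hu3 χ hχ.2, hχe χ hχ.1]
      · intro f hf hf0
        have h1 := hu4 f hf (fun χ hχ => hf0 χ (Finset.mem_insert_of_mem hχ))
        have h2 : e * f = 0 := by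
          have hid : (e * f) * (e * f) = e * f := by
            linear_combination (f * f) * hee + e * hf
          have hnil : IsNilpotent (e * f) := by
            apply isNilpotent_of_char
            intro χ
            by_cases h : χ = p
            · subst h; rw [map_mul, hf0 χ (Finset.mem_insert_self _ _), mul_zero]
            · rw [map_mul, hχe χ h, zero_mul]
          obtain ⟨n, hn⟩ := hnil
          have : ∀ n, (e * f) ^ (n + 1) = e * f := by
            intro n
            induction n with
            | zero => simp
            | succ n ih => rw [pow_succ, ih, hid]
          rw [← this n, pow_succ, hn, zero_mul]
        linear_combination h1 - 2 * u * h2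
      · have h2 := S.nn_idem (g := u * (1 - 2 * e)) hσ' hσ hee
        have h3 := S.nn_idem (g := u) hu1 hσ hee
        have e1 : u * (1 - 2 * e) * e = -e := by linear_combination (-2 * u) * hee - hue
        have e2 : u * (1 - 2 * e) * (1 - e) = u * (1 - e) := by linear_combination (2 * u) * hee
        rw [e1, e2] at h2
        rw [hue] at h3
        have := hl p hsub.1 e hee hσ hpe hχe
        rw [Finset.card_insert_of_notMem hpT]
        omega
  obtain ⟨u, hu1, hu2, hu3, -, hu5⟩ := main T le_rfl
  refine hu5.trans (le_of_eq ?_)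
  apply S.nn_congr hu1 hg ?_ hu
  · intro χ hχ
    by_cases h : χ ∈ T
    · rw [hu2 χ h]
      have := hneg χ h
      constructor
      · intro h; norm_num at h
      · intro h; linarith
    · rw [hu3 χ h]
      simp [hpos χ hχ h]
  · intro χ
    by_cases h : χ ∈ T
    · rw [hu2 χ h]; norm_num
    · rw [hu3 χ h]; norm_num

/-- a simple real point with positive residue contributes `+1` -/
lemma nn_simple {p : M →ₐ[ℂ] ℂ} (hp : S.IsRealC p) {e : M} (he : ∀ h, h * e = p h • e)
    (hpe : p e = 1) (hφ : 0 < (S.φ e).re) {s : M} (hs : S.σ s = s)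
    (hsu : ∀ χ : M →ₐ[ℂ] ℂ, χ s ≠ 0) (hsp : (p s).re < 0)
    (hspos : ∀ χ, S.IsRealC χ → χ ≠ p → 0 < (χ s).re) : S.nn 1 + 1 ≤ S.nn s := by
  have hee : e * e = e := by rw [he, hpe, one_smul]
  have hσ : S.σ e = e := by
    have h1 : S.σ e * e = e := by rw [he, S.apply_σ, hp, hpe]; simp
    have h2 := congrArg S.σ h1
    rw [map_mul, S.inv] at h2
    rw [← h2, mul_comm, h1]
  have hχe : ∀ χ : M →ₐ[ℂ] ℂ, χ ≠ p → χ e = 0 := by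
    intro χ hχ
    by_contra h0
    apply hχ
    ext x
    have := congrArg χ (he x)
    rw [map_mul, map_smul, smul_eq_mul] at this
    exact mul_right_cancel₀ h0 this
  have hσ' : S.σ (1 - 2 * e) = 1 - 2 * e := by simp [hσ, map_ofNat]
  have h1 : S.nn s = S.nn (1 - 2 * e) := by
    apply S.nn_congr hs hσ' hsu
    · intro χ
      by_cases h : χ = p
      · subst h; simp [hpe, map_ofNat]; norm_num
      · simp [hχe χ h, map_ofNat]
    · intro χ hχ
      by_cases h : χ = p
      · subst h; simp [hpe, map_ofNat]; exact hsp.le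
      · simp [hχe χ h, map_ofNat, hspos χ hχ h]
  have h2 := S.nn_idem (g := 1 - 2 * e) hσ' hσ hee
  have h3 := S.nn_idem (g := 1) (map_one _) hσ hee
  have e1 : (1 - 2 * e) * e = -e := by linear_combination (-2 : M) * hee
  have e2 : (1 - 2 * e) * (1 - e) = 1 * (1 - e) := by linear_combination (2 : M) * hee
  rw [e1, e2] at h2
  rw [one_mul] at h3
  have hval : ∀ h : M, S.form e h h = ((Complex.normSq (p h) : ℝ) : ℂ) * S.φ e := by
    intro h
    rw [form_apply, mul_comm, he, map_smul, map_mul, S.apply_σ, hp, smul_eq_mul,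
      Complex.mul_conj]
  have h4 : S.nn e = 0 := by
    have : NonnegOn (S.form e) ⊤ := by
      intro w _
      rw [hval, Complex.re_ofReal_mul]
      exact mul_nonneg (Complex.normSq_nonneg _) hφ.le
    have := nind_add_nonneg this
    rw [finrank_top] at this
    unfold nn; omega
  have h5 : 1 ≤ S.nn (-e) := by
    have : NegDef (S.form (-e)) (Submodule.span ℂ {1}) := by
      intro w hw h0
      obtain ⟨c, rfl⟩ := Submodule.mem_span_singleton.1 hw
      have hc : c ≠ 0 := by rintro rfl; simp at h0
      rw [form_neg, LinearMap.neg_apply, LinearMap.neg_apply, hval, Complex.neg_re,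
        Complex.re_ofReal_mul, map_smul, map_one, smul_eq_mul, mul_one]
      have := Complex.normSq_pos.2 hc
      nlinarith
    have h6 := this.le_nind
    rw [finrank_span_singleton] at h6
    · exact h6
    · rintro h
      have := congrArg p h
      simp at this
  omega

end InvF
end alg
end EC

namespace EC
open Module Polynomial
open Polynomial.Bivariate (swap)
set_option linter.unusedSectionVars false

section biv
variable {S : Type*} [CommRing S]

/-- double coefficient -/
noncomputable def cf (p : S[X][X]) (i j : ℕ) : S := (p.coeff i).coeff j

lemma cf_add (p q : S[X][X]) (i j : ℕ) : cf (p + q) i j = cf p i j + cf q i j := by simp [cf]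
lemma cf_sub (p q : S[X][X]) (i j : ℕ) : cf (p - q) i j = cf p i j - cf q i j := by simp [cf]
lemma cf_neg (p : S[X][X]) (i j : ℕ) : cf (-p) i j = - cf p i j := by simp [cf]
lemma cf_zero (i j : ℕ) : cf (0 : S[X][X]) i j = 0 := by simp [cf]
lemma cf_smul (c : S) (p : S[X][X]) (i j : ℕ) : cf (c • p) i j = c * cf p i j := by simp [cf]

lemma cf_ext {p q : S[X][X]} (h : ∀ i j, cf p i j = cf q i j) : p = q := by
  ext i j; exact h i j

lemma cf_mul (p q : S[X][X]) (i j : ℕ) : cf (p * q) i j =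
    ∑ x ∈ Finset.HasAntidiagonal.antidiagonal i, ∑ y ∈ Finset.HasAntidiagonal.antidiagonal j, cf p x.1 y.1 * cf q x.2 y.2 := by
  unfold cf
  rw [coeff_mul, finsetSum_coeff]
  apply Finset.sum_congr rfl
  intro x _
  rw [coeff_mul]

/-- double monomials -/
noncomputable def mm (i j : ℕ) (c : S) : S[X][X] := monomial i (monomial j c)

lemma cf_mm (i j : ℕ) (c : S) (i' j' : ℕ) :
    cf (mm i j c) i' j' = if i = i' ∧ j = j' then c else 0 := by
  unfold cf mm
  rw [coeff_monomial]
  by_cases h : i = i'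
  · simp [h, coeff_monomial]
  · simp [h]

lemma mm_induction {P : S[X][X] → Prop} (hadd : ∀ p q, P p → P q → P (p + q))
    (hmm : ∀ i j c, P (mm i j c)) (p : S[X][X]) : P p := by
  induction p using Polynomial.induction_on' with
  | add p q hp hq => exact hadd p q hp hq
  | monomial i r =>
    induction r using Polynomial.induction_on' with
    | add p q hp hq => rw [map_add]; exact hadd _ _ hp hq
    | monomial j c => exact hmm i j c

lemma mm_mul (i j i' j' : ℕ) (c d : S) : mm i j c * mm i' j' d = mm (i + i') (j + j') (c * d) := by
  unfold mm
  rw [monomial_mul_monomial, monomial_mul_monomial]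

lemma cf_swap (p : S[X][X]) (i j : ℕ) : cf (swap p) i j = cf p j i := by
  induction p using mm_induction with
  | hadd p q hp hq => rw [map_add, cf_add, cf_add, hp, hq]
  | hmm i' j' c =>
    unfold mm
    rw [Bivariate.swap_monomial_monomial]
    change cf (mm j' i' c) i j = cf (mm i' j' c) j i
    rw [cf_mm, cf_mm]
    simp only [and_comm]

lemma cf_derivative (p : S[X][X]) (i j : ℕ) :
    cf (derivative p) i j = (i + 1) * cf p (i + 1) j := by
  unfold cf
  rw [coeff_derivative]
  have : ((i : S[X]) + 1) = C ((i : S) + 1) := by simp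
  rw [this, coeff_mul_C, mul_comm]

/-- derivative in the inner variable -/
noncomputable def dw (p : S[X][X]) : S[X][X] := swap (derivative (swap p))

lemma cf_dw (p : S[X][X]) (i j : ℕ) : cf (dw p) i j = (j + 1) * cf p i (j + 1) := by
  unfold dw
  rw [cf_swap, cf_derivative, cf_swap]

lemma swap_swap' (p : S[X][X]) : swap (swap p) = p := Bivariate.swap_swap_apply p

lemma swap_dw (p : S[X][X]) : swap (dw p) = derivative (swap p) := by
  unfold dw; rw [swap_swap']

lemma dw_swap (p : S[X][X]) : dw (swap p) = swap (derivative p) := by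
  unfold dw; rw [swap_swap']

lemma coeff_dw (p : S[X][X]) (i : ℕ) : (dw p).coeff i = derivative (p.coeff i) := by
  ext j
  change cf (dw p) i j = _
  rw [cf_dw, coeff_derivative, cf, mul_comm]

/-- the space of polynomials of bidegree `< (a,b)` -/
def L (S : Type*) [CommRing S] (a b : ℕ) : Submodule S S[X][X] where
  carrier := {p | ∀ i j, (a ≤ i ∨ b ≤ j) → cf p i j = 0}
  add_mem' := by
    intro p q hp hq i j h
    rw [cf_add, hp i j h, hq i j h, add_zero]
  zero_mem' := by intro i j _; exact cf_zero i j
  smul_mem' := by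
    intro c p hp i j h
    rw [cf_smul, hp i j h, mul_zero]

lemma mem_L {a b : ℕ} {p : S[X][X]} : p ∈ L S a b ↔ ∀ i j, (a ≤ i ∨ b ≤ j) → cf p i j = 0 :=
  Iff.rfl

lemma L_mono {a b a' b' : ℕ} (ha : a ≤ a') (hb : b ≤ b') {p : S[X][X]} (h : p ∈ L S a b) :
    p ∈ L S a' b' := by
  intro i j hij
  apply h
  omega

lemma L_mul {a b a' b' c d : ℕ} {p q : S[X][X]} (hp : p ∈ L S a b) (hq : q ∈ L S a' b')
    (hc : a + a' ≤ c + 1) (hd : b + b' ≤ d + 1) : p * q ∈ L S c d := by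
  intro i j hij
  rw [cf_mul]
  apply Finset.sum_eq_zero
  intro x hx
  apply Finset.sum_eq_zero
  intro y hy
  rw [Finset.HasAntidiagonal.mem_antidiagonal] at hx hy
  by_cases h : a ≤ x.1 ∨ b ≤ y.1
  · rw [hp _ _ h, zero_mul]
  · rw [hq, mul_zero]
    omega

lemma L_swap {a b : ℕ} {p : S[X][X]} (hp : p ∈ L S a b) : swap p ∈ L S b a := by
  intro i j hij
  rw [cf_swap]
  exact hp _ _ hij.symm

lemma L_mm {i j a b : ℕ} (c : S) (hi : i < a) (hj : j < b) : mm i j c ∈ L S a b := by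
  intro i' j' h
  rw [cf_mm, if_neg]
  omega

lemma L_derivative {a b : ℕ} {p : S[X][X]} (hp : p ∈ L S (a + 1) b) : derivative p ∈ L S a b := by
  intro i j hij
  rw [cf_derivative, hp, mul_zero]
  omega

lemma L_dw {a b : ℕ} {p : S[X][X]} (hp : p ∈ L S a (b + 1)) : dw p ∈ L S a b := by
  intro i j hij
  rw [cf_dw, hp, mul_zero]
  omega

lemma L_exists (p : S[X][X]) : ∃ n, p ∈ L S n n := by
  induction p using mm_induction with
  | hadd p q hp hq =>
    obtain ⟨n, hn⟩ := hp
    obtain ⟨n', hn'⟩ := hq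
    exact ⟨max n n', Submodule.add_mem _ (L_mono (le_max_left _ _) (le_max_left _ _) hn)
      (L_mono (le_max_right _ _) (le_max_right _ _) hn')⟩
  | hmm i j c => exact ⟨max i j + 1, L_mm c (by omega) (by omega)⟩

lemma L_natDegree {a b : ℕ} {p : S[X][X]} (hp : p ∈ L S (a + 1) b) : p.natDegree ≤ a := by
  rw [natDegree_le_iff_coeff_eq_zero]
  intro i hi
  ext j
  exact hp i j (Or.inl hi)

lemma L_coeff_degree {a b : ℕ} {p : S[X][X]} (hp : p ∈ L S a b) (i : ℕ) :
    (p.coeff i).degree < b := by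
  rw [degree_lt_iff_coeff_zero]
  intro j hj
  exact hp i j (Or.inr hj)

lemma mem_L_of_degree {a b : ℕ} {p : S[X][X]} (h : p.natDegree < a)
    (h' : ∀ i, (p.coeff i).degree < b) : p ∈ L S a b := by
  intro i j hij
  rcases hij with hi | hj
  · unfold cf
    rw [coeff_eq_zero_of_natDegree_lt (p := p) (by omega), coeff_zero]
  · exact (degree_lt_iff_coeff_zero _ _).1 (h' i) j hj

/-- outer-monomial times inner polynomial -/
lemma L_monomial {a b i : ℕ} {r : S[X]} (hi : i < a) (hr : r.degree < b) :
    monomial i r ∈ L S a b := by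
  intro i' j' h
  unfold cf
  rw [coeff_monomial]
  split_ifs with h'
  · apply (degree_lt_iff_coeff_zero _ _).1 hr
    omega
  · simp

/-- lowering of the outer degree -/
lemma L_pred {a b : ℕ} {p : S[X][X]} (hp : p ∈ L S (a + 1) b) (h : p.coeff a = 0) :
    p ∈ L S a b := by
  intro i j hij
  by_cases hi : i = a
  · subst hi; unfold cf; rw [h, coeff_zero]
  · apply hp; omega

/-- the standing hypotheses on `f` -/
structure Good (m : ℕ) (f : S[X][X]) : Prop where
  inL : f ∈ L S (m + 1) (m + 1)
  corner : cf f m m = 1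
  cop : IsCoprime (f.coeff m) (derivative (f.coeff m))
  cop' : IsCoprime ((swap f).coeff m) (derivative ((swap f).coeff m))

lemma Good.swap {m : ℕ} {f : S[X][X]} (h : Good m f) : Good m (swap f) where
  inL := L_swap h.inL
  corner := by rw [cf_swap, h.corner]
  cop := h.cop'
  cop' := by rw [swap_swap']; exact h.cop

lemma Good.monic {m : ℕ} {f : S[X][X]} (h : Good m f) : (f.coeff m).Monic := by
  refine monic_of_natDegree_le_of_coeff_eq_one m ?_ h.corner
  rw [natDegree_le_iff_coeff_eq_zero]
  intro j hj
  exact h.inL m j (Or.inr hj)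

lemma Good.natDegree [Nontrivial S] {m : ℕ} {f : S[X][X]} (h : Good m f) :
    (f.coeff m).natDegree = m := by
  apply le_antisymm
  · rw [natDegree_le_iff_coeff_eq_zero]
    intro j hj
    exact h.inL m j (Or.inr hj)
  · apply le_natDegree_of_ne_zero
    have := h.corner
    unfold cf at this
    rw [this]; exact one_ne_zero

lemma Good.degree_A [Nontrivial S] {m : ℕ} {f : S[X][X]} (h : Good m f) :
    (f.coeff m).degree = m := by
  rw [degree_eq_natDegree h.monic.ne_zero, h.natDegree]

lemma Good.degree_A' {m : ℕ} {f : S[X][X]} (h : Good m f) :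
    (derivative (f.coeff m)).degree < m := by
  rw [degree_lt_iff_coeff_zero]
  intro j hj
  rw [coeff_derivative]
  have := h.inL m (j + 1) (Or.inr (by omega))
  unfold cf at this
  rw [this, zero_mul]

lemma Good.derivative_coeff {m : ℕ} (hm : 1 ≤ m) {f : S[X][X]} :
    (derivative f).coeff (m - 1) = C (m : S) * f.coeff m := by
  rw [coeff_derivative]
  obtain ⟨n, rfl⟩ : ∃ n, m = n + 1 := ⟨m - 1, by omega⟩
  simp [mul_comm]

/-- representation of polynomials by `A` and its companion -/
lemma rep [Nontrivial S] {m : ℕ} {A V : S[X]} (hA : A.Monic) (hd : A.degree = m)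
    (hV : V.degree < m) (hc : IsCoprime A V) {b : ℕ} (hb : 2 * m - 1 ≤ b) (hm : 1 ≤ m)
    {r : S[X]} (hr : r.degree < b) :
    ∃ α β : S[X], r = α * A + β * V ∧ α.degree < ((b - m : ℕ) : WithBot ℕ) ∧ β.degree < m := by
  obtain ⟨p, q, hpq⟩ := hc
  refine ⟨r * p + (r * q /ₘ A) * V, r * q %ₘ A, ?_, ?_, ?_⟩
  · have := modByMonic_add_div (r * q) A
    linear_combination (-r) * hpq - V * this
  · have hα : (r * p + (r * q /ₘ A) * V) * A = r - (r * q %ₘ A) * V := by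
      have := modByMonic_add_div (r * q) A
      linear_combination r * hpq + V * this
    by_contra hcon
    push Not at hcon
    have h1 : (r - (r * q %ₘ A) * V).degree < b := by
      refine lt_of_le_of_lt (degree_sub_le _ _) (max_lt hr ?_)
      by_cases hz : (r * q %ₘ A) * V = 0
      · rw [hz, degree_zero]; exact WithBot.bot_lt_coe b
      · have h2 : (r * q %ₘ A).degree < m := hd ▸ degree_modByMonic_lt _ hA
        have n1 : (r * q %ₘ A).natDegree < m := by
          rcases eq_or_ne (r * q %ₘ A) 0 with h | h
          · rw [h]; simp; omega
          · exact (natDegree_lt_iff_degree_lt h).2 h2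
        have n2 : V.natDegree < m := by
          rcases eq_or_ne V 0 with h | h
          · rw [h]; simp; omega
          · exact (natDegree_lt_iff_degree_lt h).2 hV
        rw [← natDegree_lt_iff_degree_lt hz]
        have := natDegree_mul_le (p := r * q %ₘ A) (q := V)
        omega
    rw [← hα, hA.degree_mul, hd] at h1
    have h2 : ((b - m : ℕ) : WithBot ℕ) + (m : WithBot ℕ) ≤
      (r * p + (r * q /ₘ A) * V).degree + (m : WithBot ℕ) := add_le_add_left hcon _
    have h3 := lt_of_le_of_lt h2 h1
    rw [← Nat.cast_add, Nat.cast_lt] at h3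
    omega
  · rw [← hd]; exact degree_modByMonic_lt _ hA

/-- reduction of the outer degree -/
lemma reduce_outer [Nontrivial S] {m : ℕ} (hm : 1 ≤ m) (hmu : IsUnit (m : S)) {f : S[X][X]}
    (hf : Good m f) {a b : ℕ} (hb : 2 * m - 1 ≤ b) {g : S[X][X]} (hg : g ∈ L S a b) :
    ∃ g' ∈ L S (2 * m - 1) b, ∃ α β : S[X][X], g = g' + α * derivative f + β * dw f := by
  induction a generalizing g with
  | zero => exact ⟨g, L_mono (by omega) le_rfl hg, 0, 0, by simp⟩
  | succ a ih =>
    by_cases ha : a + 1 ≤ 2 * m - 1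
    · exact ⟨g, L_mono ha le_rfl hg, 0, 0, by simp⟩
    obtain ⟨m1, hm1⟩ := hmu.exists_left_inv
    obtain ⟨α, β, hr, hα, hβ⟩ := rep hf.monic hf.degree_A hf.degree_A' hf.cop hb hm
      (L_coeff_degree hg a)
    set P : S[X][X] := monomial (a - (m - 1)) (C m1 * α) with hP
    set Q : S[X][X] := monomial (a - m) β with hQ
    have hu : derivative f ∈ L S m (m + 1) := L_derivative hf.inL
    have hv : dw f ∈ L S (m + 1) m := L_dw hf.inL
    have hPL : P ∈ L S (a + 1 - (m - 1)) (b - m) := by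
      apply L_monomial (by omega)
      rw [degree_lt_iff_coeff_zero] at hα ⊢
      intro j hj
      rw [coeff_C_mul, hα j hj, mul_zero]
    have hQL : Q ∈ L S (a + 1 - m) m := L_monomial (by omega) hβ
    have h1 : P * derivative f ∈ L S (a + 1) b := L_mul hPL hu (by omega) (by omega)
    have h2 : Q * dw f ∈ L S (a + 1) b := L_mul hQL hv (by omega) (by omega)
    have h3 : g - P * derivative f - Q * dw f ∈ L S (a + 1) b :=
      Submodule.sub_mem _ (Submodule.sub_mem _ hg h1) h2
    have c1 : (P * derivative f).coeff a = α * f.coeff m := by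
      have : a = (m - 1) + (a - (m - 1)) := by omega
      rw [hP, mul_comm]
      generalize a - (m - 1) = c at this ⊢
      subst this
      rw [coeff_mul_monomial, Good.derivative_coeff hm]
      have : C (m : S) * C m1 = 1 := by rw [← C_mul, mul_comm, hm1, C_1]
      linear_combination (f.coeff m * α) * this
    have c2 : (Q * dw f).coeff a = β * derivative (f.coeff m) := by
      have : a = m + (a - m) := by omega
      rw [hQ, mul_comm]
      generalize a - m = c at this ⊢
      subst this
      rw [coeff_mul_monomial, coeff_dw, mul_comm]
    obtain ⟨g', hg', α', β', e⟩ := ih (L_pred h3 (by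
      rw [coeff_sub, coeff_sub, c1, c2, hr]; ring))
    exact ⟨g', hg', α' + P, β' + Q, by linear_combination e⟩

lemma dw_eq (f : S[X][X]) : dw f = swap (derivative (swap f)) := rfl

/-- the full reduction -/
lemma reduce [Nontrivial S] {m : ℕ} (hm : 1 ≤ m) (hmu : IsUnit (m : S)) {f : S[X][X]}
    (hf : Good m f) (g : S[X][X]) :
    ∃ g' ∈ L S (2 * m - 1) (2 * m - 1), ∃ α β : S[X][X],
      g = g' + α * derivative f + β * dw f := by
  obtain ⟨n, hn⟩ := L_exists g
  obtain ⟨g1, hg1, α, β, e⟩ := reduce_outer hm hmu hf (b := max n (2 * m - 1)) (le_max_right _ _)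
    (L_mono le_rfl (le_max_left _ _) hn)
  obtain ⟨g2, hg2, α', β', e'⟩ := reduce_outer hm hmu hf.swap (b := 2 * m - 1) le_rfl (L_swap hg1)
  refine ⟨swap g2, L_swap hg2, α + swap β', β + swap α', ?_⟩
  have := congrArg swap e'
  simp only [swap_swap', map_add, map_mul, dw_swap] at this
  rw [← dw_eq] at this
  linear_combination e + this

end biv
end EC

namespace EC
open Module Polynomial
open Polynomial.Bivariate (swap)
set_option linter.unusedSectionVars false

section koszul
variable {m : ℕ} {f : ℂ[X][X]}

lemma deg_of_mul {A δ : ℂ[X]} (hA : A.Monic) (hd : A.degree = m) {n : ℕ}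
    (h : (A * δ).degree < ((n + m : ℕ) : WithBot ℕ)) : δ.degree < n := by
  rw [mul_comm, hA.degree_mul, hd] at h
  by_contra hcon
  push Not at hcon
  have h2 : (n : WithBot ℕ) + (m : WithBot ℕ) ≤ δ.degree + (m : WithBot ℕ) := add_le_add_left hcon _
  have h3 := lt_of_le_of_lt h2 h
  rw [← Nat.cast_add] at h3
  exact lt_irrefl _ h3

/-- the relation between top coefficients -/
lemma top_rel (hf : Good m f) {a b : ℂ[X]}
    (h : a * (C (m : ℂ) * f.coeff m) + b * derivative (f.coeff m) = 0) (hm : 1 ≤ m) :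
    ∃ γ, a = derivative (f.coeff m) * γ ∧ b = f.coeff m * (- C (m : ℂ) * γ) := by
  have hm0 : (m : ℂ) ≠ 0 := by exact_mod_cast (by omega : m ≠ 0)
  have h1 : f.coeff m ∣ b := by
    apply hf.cop.dvd_of_dvd_mul_right
    exact ⟨-(a * C (m : ℂ)), by linear_combination h⟩
  obtain ⟨δ, rfl⟩ := h1
  have hC : C (m : ℂ) * C ((m : ℂ)⁻¹) = 1 := by rw [← C_mul, mul_inv_cancel₀ hm0, C_1]
  have h2 : a * C (m : ℂ) + δ * derivative (f.coeff m) = 0 := by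
    have : f.coeff m * (a * C (m : ℂ) + δ * derivative (f.coeff m)) = 0 := by
      linear_combination h
    exact (mul_eq_zero.1 this).resolve_left hf.monic.ne_zero
  refine ⟨- C ((m : ℂ)⁻¹) * δ, ?_, ?_⟩
  · linear_combination (-a) * hC + C ((m : ℂ)⁻¹) * h2
  · linear_combination (-(f.coeff m * δ)) * hC

lemma top_coeff (hf : Good m f) (hm : 1 ≤ m) {c d : ℕ} (hc : 1 ≤ c) {α β : ℂ[X][X]}
    (hα : α ∈ L ℂ (c + 1) d) (hβ : β ∈ L ℂ c (d + 1)) :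
    (α * derivative f + β * dw f).coeff (c + (m - 1)) =
      α.coeff c * (C (m : ℂ) * f.coeff m) + β.coeff (c - 1) * derivative (f.coeff m) := by
  have hu : derivative f ∈ L ℂ m (m + 1) := L_derivative hf.inL
  have hv : dw f ∈ L ℂ (m + 1) m := L_dw hf.inL
  rw [coeff_add]
  congr 1
  · rw [coeff_mul_add_eq_of_natDegree_le (L_natDegree hα)
      (L_natDegree (a := m - 1) (by rwa [Nat.sub_add_cancel hm])), Good.derivative_coeff hm]
  · have : c + (m - 1) = (c - 1) + m := by omega
    rw [this, coeff_mul_add_eq_of_natDegree_le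
      (L_natDegree (a := c - 1) (b := d + 1) (by rwa [Nat.sub_add_cancel hc])) (L_natDegree hv),
      coeff_dw]

lemma kos_outer (hf : Good m f) (hm : 1 ≤ m) {d : ℕ} (hd : m ≤ d + 1) (n : ℕ) :
    ∀ {α β : ℂ[X][X]}, α ∈ L ℂ (m - 1 + n + 1) d → β ∈ L ℂ (m - 1 + n) (d + 1) →
    (∀ i, 2 * m - 1 ≤ i → (α * derivative f + β * dw f).coeff i = 0) →
    ∃ α' ∈ L ℂ m d, ∃ β' ∈ L ℂ (m - 1) (d + 1),
      α' * derivative f + β' * dw f = α * derivative f + β * dw f := by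
  induction n with
  | zero =>
    intro α β hα hβ _
    exact ⟨α, L_mono (by omega) le_rfl hα, β, hβ, rfl⟩
  | succ n ih =>
    intro α β hα hβ h0
    set c := m - 1 + (n + 1) with hc
    have hu : derivative f ∈ L ℂ m (m + 1) := L_derivative hf.inL
    have hv : dw f ∈ L ℂ (m + 1) m := L_dw hf.inL
    have ht := top_coeff hf hm (by omega) hα hβ
    rw [h0 _ (by omega)] at ht
    obtain ⟨γ, h1, h2⟩ := top_rel hf ht.symm hm
    have hm0 : (m : ℂ) ≠ 0 := by exact_mod_cast (by omega : m ≠ 0)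
    have hγ : γ.degree < ((d + 1 - m : ℕ) : WithBot ℕ) := by
      have h3 : (- C (m : ℂ) * γ).degree < ((d + 1 - m : ℕ) : WithBot ℕ) := by
        apply deg_of_mul hf.monic hf.degree_A
        rw [← h2, Nat.sub_add_cancel hd]
        exact L_coeff_degree hβ _
      have e : - C (m : ℂ) * γ = C (-(m : ℂ)) * γ := by simp
      rwa [e, degree_C_mul (neg_ne_zero.2 hm0)] at h3
    have hG : monomial (c - m) γ ∈ L ℂ (c - m + 1) (d + 1 - m) := L_monomial (by omega) hγ
    have cm : c - 1 = (m - 1) + (c - m) := by omega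
    have cm' : c = m + (c - m) := by omega
    have hα' : α - monomial (c - m) γ * dw f ∈ L ℂ (m - 1 + n + 1) d := by
      have : α - monomial (c - m) γ * dw f ∈ L ℂ (c + 1) d :=
        Submodule.sub_mem _ hα (L_mul hG hv (by omega) (by omega))
      have h' := L_pred this (by
        rw [coeff_sub, h1]
        have : (monomial (c - m) γ * dw f).coeff c = (dw f).coeff m * γ := by
          rw [mul_comm]
          conv_lhs => rw [show (dw f * monomial (c - m) γ).coeff c
            = (dw f * monomial (c - m) γ).coeff (m + (c - m)) from congrArg _ cm']
          rw [coeff_mul_monomial]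
        rw [this, coeff_dw, sub_self])
      exact h'
    have hβ' : β + monomial (c - m) γ * derivative f ∈ L ℂ (m - 1 + n) (d + 1) := by
      have : β + monomial (c - m) γ * derivative f ∈ L ℂ (m - 1 + n + 1) (d + 1) :=
        Submodule.add_mem _ hβ (L_mul hG hu (by omega) (by omega))
      apply L_pred this
      have e1 : m - 1 + n = c - 1 := by omega
      rw [e1, coeff_add, h2]
      have : (monomial (c - m) γ * derivative f).coeff (c - 1) = (derivative f).coeff (m - 1) * γ := by
        rw [mul_comm]
        conv_lhs => rw [show (derivative f * monomial (c - m) γ).coeff (c - 1)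
            = (derivative f * monomial (c - m) γ).coeff (m - 1 + (c - m)) from congrArg _ cm]
        rw [coeff_mul_monomial]
      rw [this, Good.derivative_coeff hm]
      ring
    have e : (α - monomial (c - m) γ * dw f) * derivative f
      + (β + monomial (c - m) γ * derivative f) * dw f = α * derivative f + β * dw f := by ring
    obtain ⟨α', ha, β', hb, e'⟩ := ih hα' hβ' (by rw [e]; exact h0)
    exact ⟨α', ha, β', hb, by rw [e', e]⟩

/-- the ideal in the box -/
lemma ideal_box (hf : Good m f) (hm : 1 ≤ m) {α β : ℂ[X][X]}
    (h : α * derivative f + β * dw f ∈ L ℂ (2 * m - 1) (2 * m - 1)) :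
    ∃ α' ∈ L ℂ m (m - 1), ∃ β' ∈ L ℂ (m - 1) m,
      α' * derivative f + β' * dw f = α * derivative f + β * dw f := by
  obtain ⟨a, ha⟩ := L_exists α
  obtain ⟨b, hb⟩ := L_exists β
  obtain ⟨α1, ha1, β1, hb1, e1⟩ := kos_outer hf hm (d := m + a + b) (by omega) (n := a + b)
    (L_mono (by omega) (by omega) ha) (L_mono (by omega) (by omega) hb) (by
      intro i hi
      ext j
      exact h i j (Or.inl hi))
  obtain ⟨α2, ha2, β2, hb2, e2⟩ := kos_outer hf.swap hm (d := m - 1) (by omega) (n := a + b + 1)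
    (α := swap β1) (β := swap α1)
    (L_mono (by omega) le_rfl (L_swap hb1)) (L_mono (by omega) (by omega) (L_swap ha1)) (by
      intro i hi
      ext j
      have : swap β1 * derivative (swap f) + swap α1 * dw (swap f)
          = swap (α1 * derivative f + β1 * dw f) := by
        simp only [map_add, map_mul, dw_swap, swap_dw]; ring
      rw [this, e1]
      exact L_swap h i j (Or.inl hi))
  refine ⟨swap β2, L_mono (by omega) le_rfl (L_swap hb2), swap α2, L_swap ha2, ?_⟩
  have := congrArg swap e2
  simp only [map_add, map_mul, dw_swap, swap_swap'] at this
  rw [← dw_eq] at this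
  linear_combination this + e1

lemma box_inj_aux (hf : Good m f) (hm : 1 ≤ m) (c : ℕ) : ∀ {α β : ℂ[X][X]}, c ≤ m - 1 →
    α ∈ L ℂ (c + 1) (m - 1) → β ∈ L ℂ c m →
    α * derivative f + β * dw f ∈ L ℂ m (m - 1) → α = 0 ∧ β = 0 := by
  induction c with
  | zero =>
    intro α β _ hα hβ h
    have hb : β = 0 := cf_ext (fun i j => by rw [hβ i j (Or.inl (by omega)), cf_zero])
    subst hb
    have h1 := L_coeff_degree h (m - 1)
    rw [zero_mul, add_zero] at h1
    have h2 : (α * derivative f).coeff (m - 1) = α.coeff 0 * (C (m : ℂ) * f.coeff m) := by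
      have hu : derivative f ∈ L ℂ m (m + 1) := L_derivative hf.inL
      have := coeff_mul_add_eq_of_natDegree_le (L_natDegree hα)
        (L_natDegree (p := derivative f) (a := m - 1) (b := m + 1) (by rwa [Nat.sub_add_cancel hm]))
      rwa [zero_add, Good.derivative_coeff hm] at this
    rw [h2, ← mul_assoc, hf.monic.degree_mul, hf.degree_A] at h1
    have h3 : α.coeff 0 * C (m : ℂ) = 0 := by
      by_contra hne
      rw [degree_eq_natDegree hne, ← Nat.cast_add, Nat.cast_lt] at h1
      omega
    have h4 : α.coeff 0 = 0 := by
      refine (mul_eq_zero.1 h3).resolve_right ?_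
      rw [C_eq_zero]
      exact_mod_cast (by omega : m ≠ 0)
    refine ⟨cf_ext (fun i j => ?_), rfl⟩
    exact L_pred hα h4 i j (Or.inl (by omega))
  | succ c ih =>
    intro α β hc hα hβ h
    have ht := top_coeff hf hm (c := c + 1) (d := m - 1) (by omega) hα
      (L_mono le_rfl (by omega) hβ)
    have h0 : (α * derivative f + β * dw f).coeff (c + 1 + (m - 1)) = 0 := by
      ext j
      exact h _ j (Or.inl (by omega))
    rw [h0, Nat.add_sub_cancel] at ht
    obtain ⟨γ, h1, h2⟩ := top_rel hf ht.symm hm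
    have h3 : (- C (m : ℂ) * γ).degree < ((0 : ℕ) : WithBot ℕ) := by
      apply deg_of_mul hf.monic hf.degree_A
      rw [← h2, zero_add]
      exact L_coeff_degree hβ _
    have h4 : - C (m : ℂ) * γ = 0 := by
      rw [degree_lt_iff_coeff_zero] at h3
      ext j
      rw [h3 j (Nat.zero_le _), coeff_zero]
    have h5 : γ = 0 := by
      refine (mul_eq_zero.1 h4).resolve_left ?_
      rw [neg_eq_zero, C_eq_zero]
      exact_mod_cast (by omega : m ≠ 0)
    subst h5
    rw [mul_zero] at h1
    rw [mul_zero, mul_zero] at h2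
    exact ih (by omega) (L_pred hα h1) (L_pred hβ h2) h

lemma box_inj (hf : Good m f) (hm : 1 ≤ m) {α β : ℂ[X][X]}
    (hα : α ∈ L ℂ m (m - 1)) (hβ : β ∈ L ℂ (m - 1) m)
    (h : α * derivative f + β * dw f ∈ L ℂ m (m - 1)) : α = 0 ∧ β = 0 :=
  box_inj_aux hf hm (m - 1) le_rfl (L_mono (by omega) le_rfl hα) hβ h

end koszul

/-! ### Dimension of the boxes -/

/-- coordinates on the box -/
noncomputable def Lequiv (a b : ℕ) : L ℂ a b ≃ₗ[ℂ] (Fin a × Fin b → ℂ) where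
  toFun p := fun x => cf (p : ℂ[X][X]) x.1 x.2
  map_add' := by intro p q; ext x; simp [cf_add]
  map_smul' := by intro c p; ext x; simp [cf_smul]
  invFun c := ⟨∑ x, mm x.1 x.2 (c x), Submodule.sum_mem _ (fun x _ => L_mm _ x.1.2 x.2.2)⟩
  left_inv := by
    intro p
    apply Subtype.ext
    apply cf_ext
    intro i j
    have hs : ∀ (s : Finset (Fin a × Fin b)) (g : Fin a × Fin b → ℂ[X][X]),
        cf (∑ x ∈ s, g x) i j = ∑ x ∈ s, cf (g x) i j := by
      intro s g; simp [cf, finsetSum_coeff]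
    simp only [hs, cf_mm]
    by_cases h : i < a ∧ j < b
    · rw [Finset.sum_eq_single (⟨i, h.1⟩, ⟨j, h.2⟩)]
      · simp
      · rintro ⟨x, y⟩ _ hne
        rw [if_neg]
        rintro ⟨h1, h2⟩
        apply hne
        ext <;> simp [← h1, ← h2]
      · intro h; simp at h
    · rw [p.2 i j (by omega), Finset.sum_eq_zero]
      rintro ⟨x, y⟩ _
      rw [if_neg]
      rintro ⟨h1, h2⟩
      simp only at h1 h2
      omega
  right_inv := by
    intro c
    ext ⟨i, j⟩
    have hs : ∀ (s : Finset (Fin a × Fin b)) (g : Fin a × Fin b → ℂ[X][X]),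
        cf (∑ x ∈ s, g x) i j = ∑ x ∈ s, cf (g x) i j := by
      intro s g; simp [cf, finsetSum_coeff]
    simp only [hs, cf_mm]
    rw [Finset.sum_eq_single (i, j)]
    · simp
    · rintro ⟨x, y⟩ _ hne
      rw [if_neg]
      rintro ⟨h1, h2⟩
      apply hne
      ext
      · exact h1
      · exact h2
    · intro h; simp at h

instance (a b : ℕ) : FiniteDimensional ℂ (L ℂ a b) :=
  FiniteDimensional.of_injective (Lequiv a b).toLinearMap (Lequiv a b).injective

instance (a b : ℕ) : Module.Free ℂ (L ℂ a b) := Module.Free.of_equiv (Lequiv a b).symm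

lemma finrank_L (a b : ℕ) : finrank ℂ (L ℂ a b) = a * b := by
  rw [(Lequiv a b).finrank_eq]
  simp

/-! ### The algebra of critical points -/

/-- the critical ideal -/
noncomputable def crit (f : ℂ[X][X]) : Ideal ℂ[X][X] := Ideal.span {derivative f, dw f}

/-- the algebra of critical points -/
def MA (f : ℂ[X][X]) : Type := ℂ[X][X] ⧸ crit f

noncomputable instance (f : ℂ[X][X]) : CommRing (MA f) :=
  inferInstanceAs (CommRing (ℂ[X][X] ⧸ crit f))

noncomputable instance (f : ℂ[X][X]) : Algebra ℂ (MA f) :=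
  inferInstanceAs (Algebra ℂ (ℂ[X][X] ⧸ crit f))

/-- quotient map -/
noncomputable def qm (f : ℂ[X][X]) : ℂ[X][X] →ₐ[ℂ] MA f := Ideal.Quotient.mkₐ ℂ (crit f)

lemma qm_surj (f : ℂ[X][X]) : Function.Surjective (qm f) :=
  Ideal.Quotient.mkₐ_surjective ℂ (crit f)

section dims
variable {m : ℕ} {f : ℂ[X][X]}

lemma mem_crit {p : ℂ[X][X]} : p ∈ crit f ↔ ∃ α β, α * derivative f + β * dw f = p :=
  Ideal.mem_span_pair

lemma qm_eq_zero {p : ℂ[X][X]} : qm f p = 0 ↔ ∃ α β, α * derivative f + β * dw f = p := by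
  rw [← mem_crit]
  exact Ideal.Quotient.eq_zero_iff_mem

lemma qm_box_surj (hf : Good m f) (hm : 1 ≤ m) :
    Function.Surjective ((qm f).toLinearMap.domRestrict (L ℂ (2 * m - 1) (2 * m - 1))) := by
  intro x
  obtain ⟨g, rfl⟩ := qm_surj f x
  obtain ⟨g', hg', α, β, e⟩ := reduce hm
    (isUnit_iff_ne_zero.2 (by exact_mod_cast (by omega : m ≠ 0))) hf g
  refine ⟨⟨g', hg'⟩, ?_⟩
  change qm f g' = qm f g
  rw [← sub_eq_zero, ← map_sub, qm_eq_zero]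
  exact ⟨-α, -β, by rw [e]; ring⟩

lemma finite_MA (hf : Good m f) (hm : 1 ≤ m) : FiniteDimensional ℂ (MA f) :=
  Module.Finite.of_surjective _ (qm_box_surj hf hm)

/-- the relation map -/
noncomputable def relMap (f : ℂ[X][X]) (m : ℕ) : (L ℂ m (m - 1) × L ℂ (m - 1) m) →ₗ[ℂ] ℂ[X][X] where
  toFun x := (x.1 : ℂ[X][X]) * derivative f + (x.2 : ℂ[X][X]) * dw f
  map_add' := by intro x y; simp; ring
  map_smul' := by intro c x; simp

lemma relMap_inj (hf : Good m f) (hm : 1 ≤ m) : Function.Injective (relMap f m) := by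
  rw [injective_iff_map_eq_zero]
  rintro ⟨x, y⟩ h
  have h' : (x : ℂ[X][X]) * derivative f + (y : ℂ[X][X]) * dw f = 0 := h
  obtain ⟨h1, h2⟩ := box_inj hf hm x.2 y.2 (by rw [h']; exact Submodule.zero_mem _)
  ext1
  · exact Subtype.ext h1
  · exact Subtype.ext h2

lemma relMap_mem (hf : Good m f) (hm : 1 ≤ m) (x) : relMap f m x ∈ L ℂ (2 * m - 1) (2 * m - 1) := by
  have hu : derivative f ∈ L ℂ m (m + 1) := L_derivative hf.inL
  have hv : dw f ∈ L ℂ (m + 1) m := L_dw hf.inL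
  exact Submodule.add_mem _ (L_mul x.1.2 hu (by omega) (by omega))
    (L_mul x.2.2 hv (by omega) (by omega))

lemma finrank_MA (hf : Good m f) (hm : 1 ≤ m) :
    finrank ℂ (MA f) + 2 * (m * (m - 1)) = (2 * m - 1) * (2 * m - 1) := by
  set T := (qm f).toLinearMap.domRestrict (L ℂ (2 * m - 1) (2 * m - 1)) with hT
  have h1 := LinearMap.finrank_range_add_finrank_ker (K := ℂ) (V := L ℂ (2 * m - 1) (2 * m - 1))
    (V₂ := MA f) T
  rw [LinearMap.range_eq_top.2 (qm_box_surj hf hm), finrank_top, finrank_L] at h1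
  have h2 : finrank ℂ (LinearMap.ker T) = 2 * (m * (m - 1)) := by
    have e1 : (LinearMap.ker T).map (L ℂ (2 * m - 1) (2 * m - 1)).subtype
        = LinearMap.range (relMap f m) := by
      ext p
      simp only [Submodule.mem_map, LinearMap.mem_ker, Submodule.coe_subtype, LinearMap.mem_range]
      constructor
      · rintro ⟨q, hq, rfl⟩
        have hq' : qm f (q : ℂ[X][X]) = 0 := hq
        obtain ⟨α, β, e⟩ := qm_eq_zero.1 hq'
        obtain ⟨α', ha, β', hb, e'⟩ := ideal_box hf hm (α := α) (β := β) (by rw [e]; exact q.2)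
        exact ⟨(⟨α', ha⟩, ⟨β', hb⟩), e'.trans e⟩
      · rintro ⟨x, rfl⟩
        refine ⟨⟨relMap f m x, relMap_mem hf hm x⟩, ?_, rfl⟩
        exact qm_eq_zero.2 ⟨_, _, rfl⟩
    have e2 := LinearMap.finrank_range_of_inj (relMap_inj hf hm)
    rw [← e1, finrank_prod, finrank_L, finrank_L] at e2
    rw [(Submodule.equivMapOfInjective (L ℂ (2 * m - 1) (2 * m - 1)).subtype
      (Submodule.injective_subtype _) (LinearMap.ker T)).finrank_eq, e2, mul_comm (m - 1) m, two_mul]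
  omega

lemma qm_inj_W (hf : Good m f) (hm : 1 ≤ m) {p : ℂ[X][X]} (hp : p ∈ L ℂ m (m - 1))
    (h : qm f p = 0) : p = 0 := by
  obtain ⟨α, β, e⟩ := qm_eq_zero.1 h
  obtain ⟨α', ha, β', hb, e'⟩ := ideal_box hf hm (α := α) (β := β)
    (by rw [e]; exact L_mono (by omega) (by omega) hp)
  obtain ⟨h1, h2⟩ := box_inj hf hm ha hb (by rw [e', e]; exact hp)
  rw [← e, ← e', h1, h2]; simp

end dims
end EC

namespace EC
open Module Polynomial
open Polynomial.Bivariate (swap)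
set_option linter.unusedSectionVars false

section tau
variable {R : Type*} [CommRing R] [Algebra ℂ R]

/-- the functional with coefficients `x` -/
noncomputable def tau (R : Type*) [CommRing R] [Algebra ℂ R] (n : ℕ) (x : ℕ → ℂ) : R[X] →ₗ[R] R :=
  ∑ i ∈ Finset.range n, algebraMap ℂ R (x i) • lcoeff R i

lemma tau_apply (n : ℕ) (x : ℕ → ℂ) (r : R[X]) :
    tau R n x r = ∑ i ∈ Finset.range n, algebraMap ℂ R (x i) * r.coeff i := by
  simp [tau, Algebra.smul_def]

lemma tau_applyC (n : ℕ) (x : ℕ → ℂ) (r : ℂ[X]) :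
    tau ℂ n x r = ∑ i ∈ Finset.range n, x i * r.coeff i := by
  simp [tau]

lemma tau_map {R' : Type*} [CommRing R'] [Algebra ℂ R'] (φ : R →ₐ[ℂ] R') (n : ℕ) (x : ℕ → ℂ)
    (r : R[X]) : tau R' n x (r.map φ.toRingHom) = φ (tau R n x r) := by
  simp [tau_apply, map_sum]

lemma tau_mapC (n : ℕ) (x : ℕ → ℂ)
    (r : ℂ[X]) : tau R n x (r.map (algebraMap ℂ R)) = algebraMap ℂ R (tau ℂ n x r) := by
  simp [tau_apply, map_sum]

/-- border data -/
structure Bord (m : ℕ) (B : ℂ[X]) (x : ℕ → ℂ) : Prop where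
  real : (starRingEnd ℂ) (x (2 * m - 2)) = x (2 * m - 2)
  h1 : ∀ j, j + 3 ≤ m → tau ℂ (2 * m - 1) x (X ^ j * B) = 0
  h2 : ∀ j, j + 2 ≤ m → tau ℂ (2 * m - 1) x (X ^ j * derivative B) = 0
  h3 : m * (starRingEnd ℂ) (tau ℂ (2 * m - 1) x (X ^ (m - 2) * B))
    + tau ℂ (2 * m - 1) x (X ^ (m - 1) * derivative B) = m * x (2 * m - 2)
  hc : m * tau ℂ (2 * m - 1) x (X ^ (m - 2) * B)
    - tau ℂ (2 * m - 1) x (X ^ (m - 1) * derivative B) ≠ 0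
  hre : (m * tau ℂ (2 * m - 1) x (X ^ (m - 2) * B)
    - tau ℂ (2 * m - 1) x (X ^ (m - 1) * derivative B)).re ≤ 0

/-- extension by zero -/
def ext0 {n : ℕ} (y : Fin n → ℂ) (i : ℕ) : ℂ := if h : i < n then y ⟨i, h⟩ else 0

/-- real linear map used for counting -/
noncomputable def psi (m : ℕ) (B : ℂ[X]) : (Fin (2 * m - 2) → ℂ) →ₗ[ℝ]
    ((Fin (m - 2) → ℂ) × (Fin (m - 1) → ℂ) × ℝ) where
  toFun y := (fun j => tau ℂ (2 * m - 2) (ext0 y) (X ^ (j : ℕ) * B),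
    fun j => tau ℂ (2 * m - 2) (ext0 y) (X ^ (j : ℕ) * derivative B),
    (m * (starRingEnd ℂ) (tau ℂ (2 * m - 2) (ext0 y) (X ^ (m - 2) * B))
      + tau ℂ (2 * m - 2) (ext0 y) (X ^ (m - 1) * derivative B)).im)
  map_add' := by
    intro y y'
    have h : ∀ r : ℂ[X], tau ℂ (2 * m - 2) (ext0 (y + y')) r
        = tau ℂ (2 * m - 2) (ext0 y) r + tau ℂ (2 * m - 2) (ext0 y') r := by
      intro r
      rw [tau_applyC, tau_applyC, tau_applyC, ← Finset.sum_add_distrib]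
      refine Finset.sum_congr rfl (fun i hi => ?_)
      rw [Finset.mem_range] at hi
      simp [ext0, hi, add_mul]
    ext
    · simp [h]
    · simp [h]
    · simp only [h, map_add, Prod.snd_add, ← Complex.add_im]
      congr 1; ring
  map_smul' := by
    intro c y
    have h : ∀ r : ℂ[X], tau ℂ (2 * m - 2) (ext0 (c • y)) r
        = c * tau ℂ (2 * m - 2) (ext0 y) r := by
      intro r
      rw [tau_applyC, tau_applyC, Finset.mul_sum]
      refine Finset.sum_congr rfl (fun i hi => ?_)
      rw [Finset.mem_range] at hi
      simp [ext0, hi, mul_assoc]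
    ext
    · simp [h]
    · simp [h]
    · simp only [h, map_mul, Complex.conj_ofReal, Prod.smul_snd, RingHom.id_apply, smul_eq_mul]
      rw [← Complex.im_ofReal_mul]
      congr 1; ring


lemma tau_mul_sum (n : ℕ) (x : ℕ → ℂ) {d : ℕ} {α : R[X]} (hα : α.degree < d) (P : R[X]) :
    tau R n x (α * P) = ∑ i ∈ Finset.range d, α.coeff i * tau R n x (X ^ i * P) := by
  have h : α * P = ∑ i ∈ Finset.range d, α.coeff i • (X ^ i * P) := by
    have hs : α = ∑ i ∈ Finset.range d, monomial i (α.coeff i) := by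
      ext n
      rw [finsetSum_coeff]
      simp only [coeff_monomial, Finset.sum_ite_eq', Finset.mem_range]
      split_ifs with hn
      · rfl
      · rw [degree_lt_iff_coeff_zero] at hα
        exact hα n (by omega)
    conv_lhs => rw [hs]
    rw [Finset.sum_mul]
    refine Finset.sum_congr rfl (fun i _ => ?_)
    rw [← C_mul_X_pow_eq_monomial, smul_eq_C_mul, mul_assoc]
  rw [h, map_sum]
  simp

lemma coeff_top_mul {d : ℕ} {α P : ℂ[X]} {e : ℕ} (hα : α.degree < (d + 1 : ℕ)) (hP : P.natDegree ≤ e) :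
    (α * P).coeff (d + e) = α.coeff d * P.coeff e := by
  refine coeff_mul_add_eq_of_natDegree_le ?_ hP
  rw [natDegree_le_iff_degree_le]
  rw [degree_lt_iff_coeff_zero] at hα
  rw [degree_le_iff_coeff_zero]
  intro n hn
  exact hα n (by exact_mod_cast hn)

lemma tau_zero {m : ℕ} (hm : 2 ≤ m) {B : ℂ[X]} (hB : B.Monic) (hd : B.natDegree = m)
    (hcop : IsCoprime B (derivative B)) {y : ℕ → ℂ}
    (h1 : ∀ j, j + 3 ≤ m → tau ℂ (2 * m - 2) y (X ^ j * B) = 0)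
    (h2 : ∀ j, j + 2 ≤ m → tau ℂ (2 * m - 2) y (X ^ j * derivative B) = 0)
    (h3 : m * tau ℂ (2 * m - 2) y (X ^ (m - 2) * B)
      - tau ℂ (2 * m - 2) y (X ^ (m - 1) * derivative B) = 0) {r : ℂ[X]}
    (hr : r.degree < ((2 * m - 2 : ℕ) : WithBot ℕ)) : tau ℂ (2 * m - 2) y r = 0 := by
  have hdB : B.degree = m := by rw [degree_eq_natDegree hB.ne_zero, hd]
  have hdB' : (derivative B).degree < m := hdB ▸ degree_derivative_lt hB.ne_zero
  obtain ⟨α, β, e, ha, hb⟩ := rep hB hdB hdB' hcop (b := 2 * m - 1) le_rfl (by omega) (r := r)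
    (lt_of_lt_of_le hr (by exact_mod_cast (by omega)))
  obtain ⟨n, rfl⟩ : ∃ n, m = n + 2 := ⟨m - 2, by omega⟩
  have ha' : α.degree < (n + 1 : ℕ) := by
    convert ha using 2; omega
  have c1 := coeff_top_mul ha' hd.le
  have c2 := coeff_top_mul (d := n + 1) (P := derivative B) (e := n + 1) hb
    ((natDegree_derivative_le B).trans (by omega))
  have c3 : r.coeff (n + (n + 2)) = 0 := by
    rw [degree_lt_iff_coeff_zero] at hr
    exact hr _ (by omega)
  have c4 : B.coeff (n + 2) = 1 := by rw [← hd]; exact hB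
  have c5 : (derivative B).coeff (n + 1) = n + 2 := by
    rw [coeff_derivative, c4]; push_cast; ring
  rw [e, coeff_add, c1, show n + (n + 2) = n + 1 + (n + 1) by omega, c2, c4, c5] at c3
  rw [e, map_add, tau_mul_sum _ _ ha', tau_mul_sum _ _ hb, Finset.sum_range_succ,
    Finset.sum_range_succ, Finset.sum_eq_zero, Finset.sum_eq_zero]
  · simp only [Nat.add_sub_cancel] at h3
    rw [show n + 2 - 1 = n + 1 by omega] at h3
    push_cast at h3
    linear_combination tau ℂ (2 * (n + 2) - 2) y (X ^ n * B) * c3 - β.coeff (n+1) * h3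
  · intro j hj
    rw [Finset.mem_range] at hj
    rw [h2 j (by omega), mul_zero]
  · intro j hj
    rw [Finset.mem_range] at hj
    rw [h1 j (by omega), mul_zero]

lemma exists_bord {m : ℕ} (hm : 2 ≤ m) {B : ℂ[X]} (hB : B.Monic) (hd : B.natDegree = m)
    (hcop : IsCoprime B (derivative B)) : ∃ x, Bord m B x := by
  have hker : LinearMap.ker (psi m B) ≠ ⊥ := by
    apply LinearMap.ker_ne_bot_of_finrank_lt
    simp [finrank_prod, finrank_pi_fintype, Complex.finrank_real_complex]
    omega
  obtain ⟨y, hy, hy0⟩ := Submodule.exists_mem_ne_zero_of_ne_bot hker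
  -- build border data from `y` in the kernel with right sign
  have main : ∀ y ∈ LinearMap.ker (psi m B), (m * tau ℂ (2 * m - 2) (ext0 y) (X ^ (m - 2) * B)
      - tau ℂ (2 * m - 2) (ext0 y) (X ^ (m - 1) * derivative B) ≠ 0) →
      ((m * tau ℂ (2 * m - 2) (ext0 y) (X ^ (m - 2) * B)
      - tau ℂ (2 * m - 2) (ext0 y) (X ^ (m - 1) * derivative B)).re ≤ 0) → ∃ x, Bord m B x := by
    intro y hy hne hre
    have hm0 : (m : ℂ) ≠ 0 := by exact_mod_cast (by omega : m ≠ 0)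
    rw [LinearMap.mem_ker] at hy
    have hy1 : ∀ j, j + 3 ≤ m → tau ℂ (2 * m - 2) (ext0 y) (X ^ j * B) = 0 := by
      intro j hj
      exact congrFun (congrArg Prod.fst hy) ⟨j, by omega⟩
    have hy2 : ∀ j, j + 2 ≤ m → tau ℂ (2 * m - 2) (ext0 y) (X ^ j * derivative B) = 0 := by
      intro j hj
      exact congrFun (congrArg (fun z => z.2.1) hy) ⟨j, by omega⟩
    have hy3 : (m * (starRingEnd ℂ) (tau ℂ (2 * m - 2) (ext0 y) (X ^ (m - 2) * B))
      + tau ℂ (2 * m - 2) (ext0 y) (X ^ (m - 1) * derivative B)).im = 0 :=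
      congrArg (fun z => z.2.2) hy
    set E := m * (starRingEnd ℂ) (tau ℂ (2 * m - 2) (ext0 y) (X ^ (m - 2) * B))
      + tau ℂ (2 * m - 2) (ext0 y) (X ^ (m - 1) * derivative B) with hE
    obtain ⟨tc, htc⟩ : ∃ tc : ℝ, (tc : ℂ) = - E / m := by
      refine ⟨- E.re / m, ?_⟩
      have : E = (E.re : ℂ) := Complex.ext (by simp) (by simp [hy3])
      rw [this]; push_cast; simp
    set x : ℕ → ℂ := fun i => if i < 2 * m - 2 then ext0 y i else tc with hx
    have hxl : x (2 * m - 2) = tc := by simp [hx]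
    have ht : ∀ r : ℂ[X], tau ℂ (2 * m - 1) x r
        = tau ℂ (2 * m - 2) (ext0 y) r + tc * r.coeff (2 * m - 2) := by
      intro r
      rw [tau_applyC, tau_applyC, show 2 * m - 1 = 2 * m - 2 + 1 by omega, Finset.sum_range_succ, hxl]
      congr 1
      refine Finset.sum_congr rfl (fun i hi => ?_)
      rw [Finset.mem_range] at hi
      simp [hx, hi]
    have hBm : B.coeff m = 1 := by
      have := hB.coeff_natDegree
      rwa [hd] at this
    have k1 : ∀ j, j + 3 ≤ m → (X ^ j * B).coeff (2 * m - 2) = 0 := by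
      intro j hj
      rw [coeff_X_pow_mul', if_pos (by omega)]
      apply coeff_eq_zero_of_natDegree_lt; omega
    have k1' : (X ^ (m - 2) * B).coeff (2 * m - 2) = 1 := by
      rw [coeff_X_pow_mul', if_pos (by omega), show 2 * m - 2 - (m - 2) = m by omega, hBm]
    have k2 : ∀ j, j + 2 ≤ m → (X ^ j * derivative B).coeff (2 * m - 2) = 0 := by
      intro j hj
      rw [coeff_X_pow_mul', if_pos (by omega), coeff_derivative, coeff_eq_zero_of_natDegree_lt, zero_mul]
      omega
    have k2' : (X ^ (m - 1) * derivative B).coeff (2 * m - 2) = (m : ℂ) := by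
      rw [coeff_X_pow_mul', if_pos (by omega), coeff_derivative,
        show 2 * m - 2 - (m - 1) + 1 = m by omega, hBm, one_mul,
        show 2 * m - 2 - (m - 1) = m - 1 by omega]
      norm_cast
      omega
    refine ⟨x, ?_, ?_, ?_, ?_, ?_, ?_⟩
    · rw [hxl, Complex.conj_ofReal]
    · intro j hj; rw [ht, hy1 j hj, k1 j hj]; simp
    · intro j hj; rw [ht, hy2 j hj, k2 j hj]; simp
    · rw [ht, ht, k1', k2', hxl, map_add, mul_one, Complex.conj_ofReal, htc]
      field_simp
      rw [hE]; ring
    · rw [ht, ht, k1', k2']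
      intro h; apply hne; rw [← h]; ring
    · rw [ht, ht, k1', k2']
      convert hre using 2; ring
  have hne : ∀ y ∈ LinearMap.ker (psi m B), y ≠ 0 →
      (m * tau ℂ (2 * m - 2) (ext0 y) (X ^ (m - 2) * B)
      - tau ℂ (2 * m - 2) (ext0 y) (X ^ (m - 1) * derivative B) ≠ 0) := by
    intro y hy hy0 h
    apply hy0
    rw [LinearMap.mem_ker] at hy
    have hy1 : ∀ j, j + 3 ≤ m → tau ℂ (2 * m - 2) (ext0 y) (X ^ j * B) = 0 := by
      intro j hj
      exact congrFun (congrArg Prod.fst hy) ⟨j, by omega⟩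
    have hy2 : ∀ j, j + 2 ≤ m → tau ℂ (2 * m - 2) (ext0 y) (X ^ j * derivative B) = 0 := by
      intro j hj
      exact congrFun (congrArg (fun z => z.2.1) hy) ⟨j, by omega⟩
    ext i
    have := tau_zero hm hB hd hcop hy1 hy2 h (r := X ^ (i : ℕ)) (by
      rw [degree_X_pow]; exact_mod_cast i.2)
    rw [tau_applyC] at this
    simpa [coeff_X_pow, ext0] using this
  by_cases hs : (m * tau ℂ (2 * m - 2) (ext0 y) (X ^ (m - 2) * B)
      - tau ℂ (2 * m - 2) (ext0 y) (X ^ (m - 1) * derivative B)).re ≤ 0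
  · exact main y hy (hne y hy hy0) hs
  · have hn : ∀ r : ℂ[X], tau ℂ (2 * m - 2) (ext0 (-y)) r = - tau ℂ (2 * m - 2) (ext0 y) r := by
      intro r
      rw [tau_applyC, tau_applyC, ← Finset.sum_neg_distrib]
      refine Finset.sum_congr rfl (fun i hi => ?_)
      rw [Finset.mem_range] at hi
      simp [ext0, hi]
    refine main (-y) (Submodule.neg_mem _ hy) (hne _ (Submodule.neg_mem _ hy) (neg_ne_zero.2 hy0)) ?_
    rw [hn, hn]
    push Not at hs
    have : (m * -tau ℂ (2 * m - 2) (ext0 y) (X ^ (m - 2) * B)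
      - -tau ℂ (2 * m - 2) (ext0 y) (X ^ (m - 1) * derivative B)) = -(m * tau ℂ (2 * m - 2) (ext0 y) (X ^ (m - 2) * B)
      - tau ℂ (2 * m - 2) (ext0 y) (X ^ (m - 1) * derivative B)) := by ring
    rw [this, Complex.neg_re]
    linarith

end tau
end EC

namespace EC
open Module Polynomial
open Polynomial.Bivariate (swap)
set_option linter.unusedSectionVars false

/-! ### Conjugation -/

/-- `(z,w) ↦ conj (p (conj w, conj z))` -/
noncomputable def st : ℂ[X][X] →+* ℂ[X][X] :=
  (mapRingHom (mapRingHom (starRingEnd ℂ))).comp (swap (R := ℂ)).toRingEquiv.toRingHom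

lemma st_apply (p : ℂ[X][X]) : st p = (swap p).map (mapRingHom (starRingEnd ℂ)) := rfl

lemma cf_st (p : ℂ[X][X]) (i j : ℕ) : cf (st p) i j = (starRingEnd ℂ) (cf p j i) := by
  rw [← cf_swap p i j, st_apply]
  simp [cf]

lemma st_st (p : ℂ[X][X]) : st (st p) = p := by
  apply cf_ext; intro i j; simp [cf_st]

lemma st_derivative (p : ℂ[X][X]) : st (derivative p) = dw (st p) := by
  apply cf_ext; intro i j; simp [cf_st, cf_derivative, cf_dw]

lemma st_dw (p : ℂ[X][X]) : st (dw p) = derivative (st p) := by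
  apply cf_ext; intro i j; simp [cf_st, cf_derivative, cf_dw]

lemma L_st {a b : ℕ} {p : ℂ[X][X]} (h : p ∈ L ℂ a b) : st p ∈ L ℂ b a := by
  intro i j hij
  rw [cf_st, h _ _ hij.symm, map_zero]

/-! ### The border functional -/
section tf
variable {R : Type*} [CommRing R] [Algebra ℂ R]

/-- border functional -/
noncomputable def tf (R : Type*) [CommRing R] [Algebra ℂ R] (m : ℕ) (x : ℕ → ℂ) : R[X][X] →ₗ[R] R where
  toFun p := tau R (2 * m - 1) x ((swap p).coeff (2 * m - 2))
    + tau R (2 * m - 1) (fun i => (starRingEnd ℂ) (x i)) (p.coeff (2 * m - 2))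
    - algebraMap ℂ R (x (2 * m - 2)) * cf p (2 * m - 2) (2 * m - 2)
  map_add' := by
    intro p q
    simp only [map_add, coeff_add, cf_add]
    ring
  map_smul' := by
    intro c p
    rw [map_smul, coeff_smul, coeff_smul, map_smul, map_smul, cf_smul, RingHom.id_apply]
    simp only [smul_eq_mul]
    ring

lemma tf_apply (m : ℕ) (x : ℕ → ℂ) (p : R[X][X]) :
    tf R m x p = tau R (2 * m - 1) x ((swap p).coeff (2 * m - 2))
    + tau R (2 * m - 1) (fun i => (starRingEnd ℂ) (x i)) (p.coeff (2 * m - 2))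
    - algebraMap ℂ R (x (2 * m - 2)) * cf p (2 * m - 2) (2 * m - 2) := rfl

lemma coeff_eq_zero_of_L {R : Type*} [CommRing R] {a b n : ℕ} {p : R[X][X]} (hp : p ∈ L R a b) (h : a ≤ n) :
    p.coeff n = 0 := by
  ext j; exact hp n j (Or.inl h)

lemma tf_of_L {m : ℕ} {x : ℕ → ℂ} {b : ℕ} {p : R[X][X]} (hp : p ∈ L R (2 * m - 2) b) :
    tf R m x p = tau R (2 * m - 1) x ((swap p).coeff (2 * m - 2)) := by
  rw [tf_apply, coeff_eq_zero_of_L hp le_rfl, hp _ _ (Or.inl le_rfl)]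
  simp

lemma tf_box0 {m : ℕ} {x : ℕ → ℂ} {p : R[X][X]} (hp : p ∈ L R (2 * m - 2) (2 * m - 2)) :
    tf R m x p = 0 := by
  rw [tf_of_L hp, coeff_eq_zero_of_L (L_swap hp) le_rfl, map_zero]

lemma tf_st {m : ℕ} {x : ℕ → ℂ} (hx : (starRingEnd ℂ) (x (2 * m - 2)) = x (2 * m - 2))
    (p : ℂ[X][X]) : tf ℂ m x (st p) = (starRingEnd ℂ) (tf ℂ m x p) := by
  have e : ∀ q i, (st p).coeff q = ((swap p).coeff q).map (starRingEnd ℂ) ∧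
      ((st p).coeff i).coeff q = (starRingEnd ℂ) ((p.coeff q).coeff i) := by
    intro q i
    exact ⟨by rw [st_apply, coeff_map]; rfl, cf_st p i q⟩
  have e1 : ∀ i j, ((st p).coeff i).coeff j = (starRingEnd ℂ) ((p.coeff j).coeff i) :=
    fun i j => cf_st p i j
  have e2 : ∀ (q : ℂ[X][X]) i j, ((swap q).coeff i).coeff j = (q.coeff j).coeff i :=
    fun q i j => cf_swap q i j
  simp only [tf_apply, tau_applyC, map_sub, map_add, map_sum, map_mul, e1, e2, Complex.conj_conj, cf,
    Algebra.algebraMap_self, RingHom.id_apply, hx]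
  ring

/-- compatible data -/
structure Dat (m : ℕ) (f : ℂ[X][X]) (x : ℕ → ℂ) : Prop where
  hm : 2 ≤ m
  good : Good m f
  star : st f = f
  bord : Bord m ((swap f).coeff m) x

variable {m : ℕ} {f : ℂ[X][X]} {x : ℕ → ℂ}

lemma Dat.coeff_eq (h : Dat m f x) : f.coeff m = ((swap f).coeff m).map (starRingEnd ℂ) := by
  conv_lhs => rw [← h.star, st_apply, coeff_map]
  rfl

lemma tau_conj (n : ℕ) (x : ℕ → ℂ) (r : ℂ[X]) : tau ℂ n (fun i => (starRingEnd ℂ) (x i))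
    (r.map (starRingEnd ℂ)) = (starRingEnd ℂ) (tau ℂ n x r) := by
  simp [tau_applyC]

lemma swap_derivative_coeff {R : Type*} [CommRing R] (f : R[X][X]) (n : ℕ) :
    (swap (derivative f)).coeff n = derivative ((swap f).coeff n) := by
  rw [← dw_swap, coeff_dw]

lemma swap_mm {R : Type*} [CommRing R] (i j : ℕ) (c : R) : swap (mm i j c) = mm j i c := by
  apply cf_ext; intro a b; rw [cf_swap, cf_mm, cf_mm]; simp only [and_comm]

lemma mm_eq {R : Type*} [CommRing R] (i j : ℕ) (c : R) : mm i j c = C (C c * X ^ j) * X ^ i := by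
  rw [mm, ← C_mul_X_pow_eq_monomial, ← C_mul_X_pow_eq_monomial]

lemma coeff_mm_mul {R : Type*} [CommRing R] (i j : ℕ) (c : R) (p : R[X][X]) (n : ℕ) :
    (mm i j c * p).coeff n = if i ≤ n then c • (X ^ j * p.coeff (n - i)) else 0 := by
  rw [mm_eq, mul_assoc, coeff_C_mul, coeff_X_pow_mul']
  split_ifs
  · rw [smul_eq_C_mul, mul_assoc]
  · simp

lemma tf_u_mm (h : Dat m f x) {i j : ℕ} (hi : i < m) (hj : j + 1 < m) (c : ℂ) :
    tf ℂ m x (mm i j c * derivative f) = 0 := by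
  have hm := h.hm
  have hu : derivative f ∈ L ℂ m (m + 1) := L_derivative h.good.inL
  have e1 : (swap (mm i j c * derivative f)).coeff (2 * m - 2) =
      if j = m - 2 then c • (X ^ i * derivative ((swap f).coeff m)) else 0 := by
    rw [map_mul, swap_mm, coeff_mm_mul, if_pos (by omega), swap_derivative_coeff]
    split_ifs with hjm
    · rw [show 2 * m - 2 - j = m by omega]
    · rw [coeff_eq_zero_of_L (L_swap h.good.inL) (by omega)]; simp
  have e2 : (mm i j c * derivative f).coeff (2 * m - 2) =
      if i = m - 1 then c • (X ^ j * (C (m : ℂ) * f.coeff m)) else 0 := by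
    rw [coeff_mm_mul, if_pos (by omega)]
    split_ifs with him
    · rw [show 2 * m - 2 - i = m - 1 by omega, Good.derivative_coeff (by omega)]
    · rw [coeff_eq_zero_of_L hu (by omega)]; simp
  have e3 : cf (mm i j c * derivative f) (2 * m - 2) (2 * m - 2) =
      if i = m - 1 ∧ j = m - 2 then c * m else 0 := by
    rw [cf, e2]
    by_cases him : i = m - 1
    · rw [if_pos him, coeff_smul, coeff_X_pow_mul', if_pos (by omega), coeff_C_mul]
      by_cases hjm : j = m - 2
      · rw [if_pos ⟨him, hjm⟩, show 2 * m - 2 - j = m by omega]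
        have := h.good.corner
        rw [cf] at this
        rw [this]; simp
      · rw [if_neg (by tauto)]
        have := h.good.inL m (2 * m - 2 - j) (Or.inr (by omega))
        rw [cf] at this
        rw [this]; simp
    · rw [if_neg him, if_neg (by tauto), coeff_zero]
  have e4 : tau ℂ (2 * m - 1) (fun i => (starRingEnd ℂ) (x i)) (c • (X ^ j * (C (m : ℂ) * f.coeff m)))
      = c * (m * (starRingEnd ℂ) (tau ℂ (2 * m - 1) x (X ^ j * (swap f).coeff m))) := by
    rw [map_smul, h.coeff_eq, ← tau_conj, ← mul_assoc, mul_comm (X ^ j), mul_assoc, ← smul_eq_C_mul,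
      map_smul, Polynomial.map_mul, Polynomial.map_pow, map_X]
    simp
  rw [tf_apply, e1, e2, e3]
  by_cases hjm : j = m - 2
  · by_cases him : i = m - 1
    · rw [if_pos hjm, if_pos him, if_pos ⟨him, hjm⟩, e4, map_smul, hjm, him]
      have := h.bord.h3
      simp only [smul_eq_mul, Algebra.algebraMap_self, RingHom.id_apply]
      linear_combination c * this
    · rw [if_pos hjm, if_neg him, if_neg (by tauto), map_smul, h.bord.h2 i (by omega)]
      simp
  · by_cases him : i = m - 1
    · rw [if_neg hjm, if_pos him, if_neg (by tauto), e4, h.bord.h1 j (by omega)]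
      simp
    · rw [if_neg hjm, if_neg him, if_neg (by tauto)]
      simp

lemma L_sum {a b : ℕ} {p : ℂ[X][X]} (hp : p ∈ L ℂ a b) :
    p = ∑ y : Fin a × Fin b, mm y.1 y.2 (cf p y.1 y.2) := by
  have := (Lequiv a b).symm_apply_apply ⟨p, hp⟩
  exact (congrArg Subtype.val this).symm

lemma tf_u (h : Dat m f x) {α : ℂ[X][X]} (hα : α ∈ L ℂ m (m - 1)) :
    tf ℂ m x (α * derivative f) = 0 := by
  rw [L_sum hα, Finset.sum_mul, map_sum]
  apply Finset.sum_eq_zero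
  rintro ⟨i, j⟩ _
  exact tf_u_mm h i.2 (by have := j.2; simp only; omega) _

lemma tf_v (h : Dat m f x) {β : ℂ[X][X]} (hβ : β ∈ L ℂ (m - 1) m) :
    tf ℂ m x (β * dw f) = 0 := by
  have := tf_u h (L_st hβ)
  have e : st β * derivative f = st (β * dw f) := by
    rw [map_mul, st_dw, h.star]
  rw [e, tf_st h.bord.real] at this
  exact (map_eq_zero _).1 this

/-- the functional on the algebra of critical points -/
lemma exists_phi (h : Dat m f x) : ∃ φ : MA f →ₗ[ℂ] ℂ, ∀ p ∈ L ℂ (2 * m - 1) (2 * m - 1),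
    φ (qm f p) = tf ℂ m x p := by
  have hm := h.hm
  obtain ⟨g, hg⟩ := LinearMap.exists_rightInverse_of_surjective (R := ℂ) (P := MA f)
    ((qm f).toLinearMap.domRestrict (L ℂ (2 * m - 1) (2 * m - 1)))
    (LinearMap.range_eq_top.2 (qm_box_surj h.good (by omega)))
  refine ⟨(tf ℂ m x).comp ((Submodule.subtype _).comp g), ?_⟩
  intro p hp
  have h1 : qm f (g (qm f p) : ℂ[X][X]) = qm f p := LinearMap.congr_fun hg (qm f p)
  rw [← sub_eq_zero, ← map_sub] at h1
  obtain ⟨α, β, e⟩ := qm_eq_zero.1 h1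
  obtain ⟨α', ha, β', hb, e'⟩ := ideal_box h.good (by omega) (α := α) (β := β)
    (by rw [e]; exact Submodule.sub_mem _ (g (qm f p)).2 hp)
  have h2 : tf ℂ m x (g (qm f p) : ℂ[X][X]) - tf ℂ m x p = 0 := by
    rw [← map_sub, ← e, ← e', map_add, tf_u h ha, tf_v h hb, add_zero]
  exact sub_eq_zero.1 h2

/-- the functional -/
noncomputable def phi (h : Dat m f x) : MA f →ₗ[ℂ] ℂ := (exists_phi h).choose

lemma phi_qm (h : Dat m f x) {p : ℂ[X][X]} (hp : p ∈ L ℂ (2 * m - 1) (2 * m - 1)) :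
    phi h (qm f p) = tf ℂ m x p := (exists_phi h).choose_spec p hp

lemma st_crit (h : st f = f) {p : ℂ[X][X]} (hp : qm f p = 0) : qm f (st p) = 0 := by
  obtain ⟨α, β, e⟩ := qm_eq_zero.1 hp
  refine qm_eq_zero.2 ⟨st β, st α, ?_⟩
  rw [← e, map_add, map_mul, map_mul, st_derivative, st_dw, h, add_comm]

/-- the involution -/
noncomputable def sg (h : st f = f) : MA f →+* MA f :=
  Ideal.Quotient.lift (crit f) ((qm f : ℂ[X][X] →+* MA f).comp st)
    (fun p hp => st_crit h (Ideal.Quotient.eq_zero_iff_mem.2 hp))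

lemma sg_qm (h : st f = f) (p : ℂ[X][X]) : sg h (qm f p) = qm f (st p) :=
  Ideal.Quotient.lift_mk _ _ _

end tf
end EC

namespace EC
open Module Polynomial
open Polynomial.Bivariate (swap)
set_option linter.unusedSectionVars false

section dq
variable {R : Type*} [CommRing R]

/-- divided difference -/
noncomputable def dq (r : R[X]) (a : R) : R[X] := r /ₘ (X - C a)

lemma dq_eq (r : R[X]) (a : R) : (X - C a) * dq r a + C (r.eval a) = r := by
  have := modByMonic_add_div r (X - C a)
  rw [modByMonic_X_sub_C_eq_C_eval] at this
  rw [dq, add_comm]; exact this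

lemma dq_unique [Nontrivial R] {r : R[X]} {a : R} {q : R[X]} {c : R}
    (h : (X - C a) * q + C c = r) : dq r a = q := by
  refine (div_modByMonic_unique q (C c) (monic_X_sub_C a) ⟨by rw [add_comm]; exact h, ?_⟩).1
  rw [degree_X_sub_C]
  exact lt_of_le_of_lt degree_C_le (by norm_num)

lemma dq_natDegree (r : R[X]) (a : R) : (dq r a).natDegree ≤ r.natDegree - 1 := by
  nontriviality R
  rw [dq, natDegree_divByMonic _ (monic_X_sub_C a), natDegree_X_sub_C]

lemma dq_coeff {r : R[X]} (a : R) {n : ℕ} (h : r.natDegree ≤ n + 1) :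
    (dq r a).coeff n = r.coeff (n + 1) := by
  have h1 := dq_natDegree r a
  have h2 : (dq r a).coeff (n + 1) = 0 := coeff_eq_zero_of_natDegree_lt (by omega)
  conv_rhs => rw [← dq_eq r a]
  rw [coeff_add, coeff_C, if_neg (by omega), sub_mul, coeff_sub, coeff_X_mul, coeff_C_mul, h2]
  simp

lemma dq_map {R' : Type*} [CommRing R'] (φ : R →+* R') (r : R[X]) (a : R) :
    (dq r a).map φ = dq (r.map φ) (φ a) := by
  rw [dq, map_divByMonic _ (monic_X_sub_C a)]
  simp [dq]

lemma dq_C_mul (c : R) (r : R[X]) (a : R) : dq (C c * r) a = C c * dq r a := by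
  nontriviality R
  apply dq_unique (c := c * r.eval a)
  conv_rhs => rw [← dq_eq r a]
  rw [C_mul]; ring

lemma dq_zero (a : R) : dq (0 : R[X]) a = 0 := by simp [dq]

lemma dq_eval (r : R[X]) (a : R) : (dq r a).eval a = (derivative r).eval a := by
  conv_rhs => rw [← dq_eq r a]
  simp

end dq

/-! ### The univariate Bezoutian -/
section bez
variable {R : Type*} [CommRing R] [Algebra ℂ R]

/-- Bezoutian of two polynomials -/
noncomputable def bezK (B : ℂ[X]) (a : R) : R[X] :=
  C (aeval a B) * dq ((derivative B).map (algebraMap ℂ R)) a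
    - C (aeval a (derivative B)) * dq (B.map (algebraMap ℂ R)) a

lemma bezK_map {R' : Type*} [CommRing R'] [Algebra ℂ R'] (φ : R →ₐ[ℂ] R') (B : ℂ[X]) (a : R) :
    (bezK B a).map φ.toRingHom = bezK B (φ a) := by
  have e : ∀ r : ℂ[X], (r.map (algebraMap ℂ R)).map φ.toRingHom = r.map (algebraMap ℂ R') := by
    intro r
    rw [Polynomial.map_map]
    congr 1
    exact φ.comp_algebraMap
  rw [bezK, Polynomial.map_sub, Polynomial.map_mul, Polynomial.map_mul, dq_map, dq_map, e, e, map_C,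
    map_C, bezK]
  simp [aeval_algHom_apply]

lemma bezK_mul (B : ℂ[X]) (a : R) : (X - C a) * bezK B a =
    C (aeval a B) * (derivative B).map (algebraMap ℂ R)
    - C (aeval a (derivative B)) * B.map (algebraMap ℂ R) := by
  have h1 := dq_eq (B.map (algebraMap ℂ R)) a
  have h2 := dq_eq ((derivative B).map (algebraMap ℂ R)) a
  rw [eval_map_algebraMap] at h1 h2
  rw [bezK]
  linear_combination C (aeval a B) * h2 - C (aeval a (derivative B)) * h1

lemma algMap_eq : algebraMap ℂ ℂ[X] = (C : ℂ →+* ℂ[X]) := rfl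

lemma aevalX (r : ℂ[X]) : aeval (X : ℂ[X]) r = r := aeval_X_left_apply r

lemma bezK_swap (B : ℂ[X]) : swap (bezK B (X : ℂ[X])) = bezK B (X : ℂ[X]) := by
  have h1 := bezK_mul B (X : ℂ[X])
  rw [aevalX, aevalX, algMap_eq] at h1
  have h2 := congrArg swap h1
  simp only [map_mul, map_sub, Bivariate.swap_C, Bivariate.swap_map_C, Bivariate.swap_Y, map_X] at h2
  have h3 : (X - C X : ℂ[X][X]) ≠ 0 := X_sub_C_ne_zero _
  apply mul_left_cancel₀ h3
  linear_combination (-1) * h2 - h1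

variable {m : ℕ} {B : ℂ[X]} {x : ℕ → ℂ}

lemma bezK_natDegree (hm : 2 ≤ m) (hd : B.natDegree = m) (a : R) :
    (bezK B a).natDegree ≤ m - 1 := by
  have h1 : (B.map (algebraMap ℂ R)).natDegree ≤ m := hd ▸ natDegree_map_le
  have h2 : ((derivative B).map (algebraMap ℂ R)).natDegree ≤ m - 1 :=
    natDegree_map_le.trans (hd ▸ natDegree_derivative_le B)
  have h3 := dq_natDegree (B.map (algebraMap ℂ R)) a
  have h4 := dq_natDegree ((derivative B).map (algebraMap ℂ R)) a
  refine (natDegree_sub_le _ _).trans (max_le ?_ ?_)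
  · refine (natDegree_C_mul_le _ _).trans (by omega)
  · refine (natDegree_C_mul_le _ _).trans (by omega)

lemma bezK_coeff (hm : 2 ≤ m) (hB : B.Monic) (hd : B.natDegree = m) (a : R) :
    (bezK B a).coeff (m - 1) = - aeval a (derivative B) := by
  have h1 : (B.map (algebraMap ℂ R)).natDegree ≤ m := hd ▸ natDegree_map_le
  have h2 : ((derivative B).map (algebraMap ℂ R)).natDegree ≤ m - 1 :=
    natDegree_map_le.trans (hd ▸ natDegree_derivative_le B)
  have h4 := dq_natDegree ((derivative B).map (algebraMap ℂ R)) a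
  rw [bezK, coeff_sub, coeff_C_mul, coeff_C_mul, coeff_eq_zero_of_natDegree_lt
    (p := dq ((derivative B).map (algebraMap ℂ R)) a) (by omega), dq_coeff a (by omega),
    show m - 1 + 1 = m by omega, coeff_map, ← hd, hB.coeff_natDegree]
  simp

lemma tau_bezK_poly (hm : 2 ≤ m) (hB : B.Monic) (hd : B.natDegree = m) (hb : Bord m B x) :
    tau ℂ[X] (2 * m - 1) x (bezK B (X : ℂ[X])) =
      C (m * tau ℂ (2 * m - 1) x (X ^ (m - 2) * B)
        - tau ℂ (2 * m - 1) x (X ^ (m - 1) * derivative B)) := by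
  set K := bezK B (X : ℂ[X]) with hK
  set τ := tau ℂ[X] (2 * m - 1) x with hτ
  have hL : K ∈ L ℂ m m := by
    have hdeg : K.natDegree < m := by
      have h : K.natDegree ≤ m - 1 := bezK_natDegree (R := ℂ[X]) hm hd X
      omega
    intro i j hij
    rcases hij with h | h
    · have : K.coeff i = 0 := coeff_eq_zero_of_natDegree_lt (by omega)
      rw [cf, this, coeff_zero]
    · have : K.coeff j = 0 := coeff_eq_zero_of_natDegree_lt (by omega)
      rw [hK, ← bezK_swap, cf_swap, cf, ← hK, this, coeff_zero]
  have hrec : ∀ j, τ (X ^ (j + 1) * K) = X * τ (X ^ j * K)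
      + B * C (tau ℂ (2 * m - 1) x (X ^ j * derivative B))
      - derivative B * C (tau ℂ (2 * m - 1) x (X ^ j * B)) := by
    intro j
    have e : X ^ (j + 1) * K = (X : ℂ[X]) • (X ^ j * K) + B • ((X ^ j * derivative B).map C)
        - (derivative B) • ((X ^ j * B).map C) := by
      have h1 := bezK_mul B (X : ℂ[X])
      rw [aevalX, aevalX, algMap_eq, ← hK] at h1
      simp only [smul_eq_C_mul, Polynomial.map_mul, Polynomial.map_pow, map_X]
      linear_combination X ^ j * h1
    rw [e, map_sub, map_add, map_smul, map_smul, map_smul, ← algMap_eq, tau_mapC, tau_mapC]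
    simp only [smul_eq_mul]
  have hpow : ∀ j, j + 2 ≤ m → τ (X ^ j * K) = X ^ j * τ K := by
    intro j
    induction j with
    | zero => intro _; simp
    | succ j ih =>
      intro hj
      rw [hrec, ih (by omega), hb.h1 j (by omega), hb.h2 j (by omega)]
      simp only [map_zero, mul_zero]
      ring
  have hlast := hrec (m - 2)
  rw [hpow (m - 2) (by omega), hb.h2 (m - 2) (by omega), ← mul_assoc, ← pow_succ',
    show m - 2 + 1 = m - 1 by omega, map_zero, mul_zero, add_zero] at hlast
  have hco : ∀ n, (τ (X ^ (m - 1) * K)).coeff n = ∑ i ∈ Finset.range (2 * m - 1),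
      x i * cf (X ^ (m - 1) * K) i n := by
    intro n
    rw [hτ, tau_apply, finsetSum_coeff]
    refine Finset.sum_congr rfl (fun i _ => ?_)
    rw [algMap_eq, coeff_C_mul]; rfl
  have hc2 : ∀ i n, cf (X ^ (m - 1) * K) i n = if m - 1 ≤ i then cf K (i - (m - 1)) n else 0 := by
    intro i n
    rw [cf, coeff_X_pow_mul']
    split_ifs <;> simp [cf]
  have hB' : (derivative B).natDegree ≤ m - 1 := hd ▸ natDegree_derivative_le B
  have hBc : (derivative B).coeff (m - 1) = m := by
    rw [coeff_derivative, show m - 1 + 1 = m by omega]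
    have := hB.coeff_natDegree
    rw [hd] at this
    rw [this, one_mul]
    norm_cast; omega
  have hmain : ∀ n, (τ K).coeff n = (τ (X ^ (m - 1) * K)).coeff (n + (m - 1))
      + (derivative B).coeff (n + (m - 1)) * tau ℂ (2 * m - 1) x (X ^ (m - 2) * B) := by
    intro n
    rw [hlast, coeff_sub, coeff_X_pow_mul, coeff_mul_C]
    ring
  ext n
  rw [hmain, coeff_C, hco]
  by_cases hn : n = 0
  · subst hn
    rw [if_pos rfl, zero_add, hBc, tau_applyC (r := X ^ (m - 1) * derivative B)]
    rw [sub_eq_add_neg, add_comm, ← Finset.sum_neg_distrib]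
    congr 1
    refine Finset.sum_congr rfl (fun i _ => ?_)
    rw [hc2, coeff_X_pow_mul']
    split_ifs
    · rw [hK, ← bezK_swap, cf_swap, cf, bezK_coeff hm hB hd, aevalX, coeff_neg]
      ring
    · simp
  · rw [if_neg hn, coeff_eq_zero_of_natDegree_lt (p := derivative B) (by omega), zero_mul, add_zero]
    apply Finset.sum_eq_zero
    intro i _
    rw [hc2]
    split_ifs
    · rw [hL _ _ (Or.inr (by omega)), mul_zero]
    · simp

lemma tau_bezK (hm : 2 ≤ m) (hB : B.Monic) (hd : B.natDegree = m) (hb : Bord m B x) (a : R) :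
    tau R (2 * m - 1) x (bezK B a) = algebraMap ℂ R
      (m * tau ℂ (2 * m - 1) x (X ^ (m - 2) * B)
        - tau ℂ (2 * m - 1) x (X ^ (m - 1) * derivative B)) := by
  have h := bezK_map (aeval a : ℂ[X] →ₐ[ℂ] R) B X
  rw [aeval_X] at h
  rw [← h, tau_map, tau_bezK_poly hm hB hd hb, aeval_C]

end bez

/-! ### The bivariate Bezoutian -/
section biv
variable {R : Type*} [CommRing R] (z0 w0 : R)

lemma coeff_eval_C (p : R[X][X]) (n : ℕ) : (p.eval (C z0)).coeff n = ((swap p).coeff n).eval z0 := by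
  induction p using mm_induction with
  | hadd p q hp hq => simp [hp, hq]
  | hmm i j c =>
    rw [swap_mm, mm_eq, mm_eq]
    simp only [eval_mul, eval_pow, eval_C, eval_X, coeff_C_mul, ← C_pow, coeff_mul_C, coeff_X_pow]
    split_ifs <;> simp

/-- outer quotient -/
noncomputable def dqo (U : R[X][X]) : R[X][X] := dq U (C z0)

/-- inner quotient -/
noncomputable def dqi (U : R[X][X]) : R[X] := dq (U.eval (C z0)) w0

lemma div_biv (U : R[X][X]) :
    (X - C (C z0)) * dqo z0 U + C ((X - C w0) * dqi z0 w0 U) + C (C (U.evalEval w0 z0)) = U := by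
  have h1 := dq_eq U (C z0)
  have h2 := dq_eq (U.eval (C z0)) w0
  have h3 : U.evalEval w0 z0 = (U.eval (C z0)).eval w0 := rfl
  rw [h3, dqo, dqi, add_assoc, ← C_add, h2, h1]

lemma swap_dqo (U : R[X][X]) (n : ℕ) :
    (swap (dqo z0 U)).coeff n = dq ((swap U).coeff n) z0 := by
  nontriviality R
  symm
  apply dq_unique (c := (U.eval (C z0)).coeff n)
  have h1 := congrArg (fun p => (swap p).coeff n) (dq_eq U (C z0))
  simp only [map_add, map_mul, map_sub, Bivariate.swap_C, Bivariate.swap_Y, map_C, coeff_add,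
    coeff_map] at h1
  rw [← h1, ← C_sub, coeff_C_mul, dqo]

lemma L_coeff_natDegree {a b : ℕ} {p : R[X][X]} (hp : p ∈ L R a (b + 1)) (i : ℕ) :
    (p.coeff i).natDegree ≤ b := by
  rw [natDegree_le_iff_coeff_eq_zero]
  intro j hj
  exact hp i j (Or.inr hj)

lemma L_dqo {a b : ℕ} (ha : 1 ≤ a) {U : R[X][X]} (hU : U ∈ L R (a + 1) b) : dqo z0 U ∈ L R a b := by
  intro i j hij
  rw [← cf_swap, cf, swap_dqo]
  rcases hij with h | h
  · apply coeff_eq_zero_of_natDegree_lt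
    have h1 := L_coeff_natDegree (L_swap hU) j
    have h2 := dq_natDegree ((swap U).coeff j) z0
    omega
  · have h1 : (swap U).coeff j = 0 := by
      ext k; exact (cf_swap U j k).trans (hU k j (Or.inr h))
    rw [h1, dq_zero, coeff_zero]

lemma eval_natDegree {a b : ℕ} {U : R[X][X]} (hU : U ∈ L R a (b + 1)) :
    (U.eval (C z0)).natDegree ≤ b := by
  rw [natDegree_le_iff_coeff_eq_zero]
  intro j hj
  have h1 : (swap U).coeff j = 0 := by
    ext k; exact (cf_swap U j k).trans (hU k j (Or.inr hj))
  rw [coeff_eval_C, h1, eval_zero]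

lemma dqi_natDegree {a b : ℕ} {U : R[X][X]} (hU : U ∈ L R a (b + 2)) :
    (dqi z0 w0 U).natDegree ≤ b := by
  have h1 := eval_natDegree z0 hU
  have h2 := dq_natDegree (U.eval (C z0)) w0
  rw [dqi]; omega

lemma dqi_coeff {a b : ℕ} {U : R[X][X]} (hU : U ∈ L R a (b + 2)) :
    (dqi z0 w0 U).coeff b = ((swap U).coeff (b + 1)).eval z0 := by
  rw [dqi, dq_coeff _ (eval_natDegree z0 hU), coeff_eval_C]

/-- the Bezoutian -/
noncomputable def Del (U V : R[X][X]) : R[X][X] :=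
  dqo z0 U * C (dqi z0 w0 V) - C (dqi z0 w0 U) * dqo z0 V

variable {z0 w0}

lemma Del_z {U V : R[X][X]} (hU : U.evalEval w0 z0 = 0) (hV : V.evalEval w0 z0 = 0) :
    (X - C (C z0)) * Del z0 w0 U V = U * C (dqi z0 w0 V) - V * C (dqi z0 w0 U) := by
  have h1 := div_biv z0 w0 U
  have h2 := div_biv z0 w0 V
  rw [hU, C_0, C_0, add_zero, C_mul] at h1
  rw [hV, C_0, C_0, add_zero, C_mul] at h2
  rw [Del]
  linear_combination C (dqi z0 w0 V) * h1 - C (dqi z0 w0 U) * h2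

lemma Del_w {U V : R[X][X]} (hU : U.evalEval w0 z0 = 0) (hV : V.evalEval w0 z0 = 0) :
    C (X - C w0) * Del z0 w0 U V = V * dqo z0 U - U * dqo z0 V := by
  have h1 := div_biv z0 w0 U
  have h2 := div_biv z0 w0 V
  rw [hU, C_0, C_0, add_zero, C_mul] at h1
  rw [hV, C_0, C_0, add_zero, C_mul] at h2
  rw [Del]
  linear_combination dqo z0 U * h2 - dqo z0 V * h1

lemma Del_L {m : ℕ} (hm : 2 ≤ m) {U V : R[X][X]} (hU : U ∈ L R m (m + 1)) (hV : V ∈ L R (m + 1) m) :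
    Del z0 w0 U V ∈ L R m (2 * m - 1) := by
  have hC : ∀ (r : R[X]) (n : ℕ), r.natDegree ≤ n → C r ∈ L R 1 (n + 1) := by
    intro r n hr i j hij
    rw [cf, coeff_C]
    split_ifs with h
    · exact coeff_eq_zero_of_natDegree_lt (by omega)
    · simp
  obtain ⟨n, rfl⟩ : ∃ n, m = n + 2 := ⟨m - 2, by omega⟩
  refine Submodule.sub_mem _ ?_ ?_
  · have hq := L_dqo z0 (a := n + 1) (by omega) hU
    exact L_mul hq (hC _ n (dqi_natDegree z0 w0 hV)) (by omega) (by omega)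
  · have hq := L_dqo z0 (a := n + 2) (by omega) hV
    exact L_mul (hC _ (n + 1) (dqi_natDegree z0 w0 hU)) hq (by omega) (by omega)

lemma Del_top {m : ℕ} (hm : 2 ≤ m) {U V : R[X][X]} (hU : U ∈ L R m (m + 1)) (hV : V ∈ L R (m + 1) m) :
    (swap (Del z0 w0 U V)).coeff (2 * m - 2) =
      dq ((swap U).coeff m) z0 * C (((swap V).coeff (m - 1)).eval z0)
      - C (((swap U).coeff m).eval z0) * dq ((swap V).coeff (m - 1)) z0 := by
  obtain ⟨n, rfl⟩ : ∃ n, m = n + 2 := ⟨m - 2, by omega⟩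
  have d1 := L_natDegree (L_swap (L_dqo z0 (by omega) hU))
  have d2 := L_natDegree (L_swap (L_dqo z0 (by omega) hV))
  have d3 : ((dqi z0 w0 V).map (C : R →+* R[X])).natDegree ≤ n :=
    natDegree_map_le.trans (dqi_natDegree z0 w0 hV)
  have d4 : ((dqi z0 w0 U).map (C : R →+* R[X])).natDegree ≤ n + 1 :=
    natDegree_map_le.trans (dqi_natDegree z0 w0 hU)
  rw [Del, map_sub, map_mul, map_mul, Bivariate.swap_C, Bivariate.swap_C, coeff_sub]
  have e1 := coeff_mul_add_eq_of_natDegree_le d1 d3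
  have e2 := coeff_mul_add_eq_of_natDegree_le d4 d2
  rw [show 2 * (n + 2) - 2 = n + 2 + n by omega, e1, show n + 2 + n = n + 1 + (n + 1) by omega, e2,
    coeff_map, coeff_map, dqi_coeff z0 w0 hU, dqi_coeff z0 w0 hV, swap_dqo, swap_dqo]
  rfl

lemma Del_eval (U V : R[X][X]) : (Del z0 w0 U V).evalEval w0 z0 =
    (derivative U).evalEval w0 z0 * (dw V).evalEval w0 z0
    - (dw U).evalEval w0 z0 * (derivative V).evalEval w0 z0 := by
  have h1 : ∀ U : R[X][X], (dqo z0 U).evalEval w0 z0 = (derivative U).evalEval w0 z0 := by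
    intro U
    have := dq_eval U (C z0)
    rw [evalEval, dqo, this]
  have h2 : ∀ U : R[X][X], (dqi z0 w0 U).eval w0 = (dw U).evalEval w0 z0 := by
    intro U
    rw [dqi, dq_eval, evalEval]
    congr 1
    ext n
    rw [coeff_derivative, coeff_eval_C, coeff_eval_C, swap_dw, coeff_derivative]
    simp
  rw [Del, evalEval_sub, evalEval_mul, evalEval_mul, evalEval_C, evalEval_C, h1, h1, h2, h2]

end biv
end EC

namespace EC
open Module Polynomial
open Polynomial.Bivariate (swap)
set_option linter.unusedSectionVars false

section Phi
variable (R : Type*) [CommRing R] [Algebra ℂ R]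

/-- base change -/
noncomputable def bc : ℂ[X][X] →+* R[X][X] := mapRingHom (mapRingHom (algebraMap ℂ R))

variable {R}

lemma cf_bc (p : ℂ[X][X]) (i j : ℕ) : cf (bc R p) i j = algebraMap ℂ R (cf p i j) := by
  simp [bc, cf]

lemma swap_bc (p : ℂ[X][X]) : swap (bc R p) = bc R (swap p) := by
  apply cf_ext; intro i j; rw [cf_swap, cf_bc, cf_bc, cf_swap]

lemma bc_coeff (p : ℂ[X][X]) (i : ℕ) : (bc R p).coeff i = (p.coeff i).map (algebraMap ℂ R) := by
  simp [bc]

lemma bc_L {a b : ℕ} {p : ℂ[X][X]} (hp : p ∈ L ℂ a b) : bc R p ∈ L R a b := by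
  intro i j hij; rw [cf_bc, hp i j hij, map_zero]

lemma bc_mm (i j : ℕ) (c : ℂ) : bc R (mm i j c) = mm i j (algebraMap ℂ R c) := by
  apply cf_ext; intro a b; rw [cf_bc, cf_mm, cf_mm]; split_ifs <;> simp

lemma mm_smul (i j : ℕ) (c : R) : mm i j c = c • bc R (mm i j 1) := by
  apply cf_ext; intro a b; rw [cf_smul, cf_bc, cf_mm, cf_mm]; split_ifs <;> simp

lemma tf_bc (m : ℕ) (x : ℕ → ℂ) (p : ℂ[X][X]) : tf R m x (bc R p) = algebraMap ℂ R (tf ℂ m x p) := by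
  rw [tf_apply, tf_apply, swap_bc, bc_coeff, bc_coeff, tau_mapC, tau_mapC, cf_bc]
  simp

lemma L_sumR {a b : ℕ} {p : R[X][X]} (hp : p ∈ L R a b) :
    p = ∑ i ∈ Finset.range a, ∑ j ∈ Finset.range b, mm i j (cf p i j) := by
  have hs : ∀ (s : Finset ℕ) (g : ℕ → R[X][X]) i j,
      cf (∑ y ∈ s, g y) i j = ∑ y ∈ s, cf (g y) i j := by
    intro s g i j; simp [cf, finsetSum_coeff]
  apply cf_ext
  intro i j
  simp only [hs, cf_mm]
  by_cases h : i < a ∧ j < b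
  · rw [Finset.sum_eq_single i, Finset.sum_eq_single j]
    · simp
    · intro y _ hy; rw [if_neg (by tauto)]
    · intro hj; simp at hj; omega
    · intro y _ hy
      apply Finset.sum_eq_zero
      intro z _
      rw [if_neg (by tauto)]
    · intro hj; simp at hj; omega
  · rw [hp i j (by omega), Finset.sum_eq_zero]
    intro y hy
    apply Finset.sum_eq_zero
    intro z hz
    rw [Finset.mem_range] at hy hz
    rw [if_neg]
    rintro ⟨rfl, rfl⟩
    omega

variable {m : ℕ} {f : ℂ[X][X]} {x : ℕ → ℂ}

/-- the extension of the functional -/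
noncomputable def Phi (R : Type*) [CommRing R] [Algebra ℂ R] (φ : MA f →ₗ[ℂ] ℂ) : R[X][X] →ₗ[R] R :=
  Polynomial.lsum (fun i => Polynomial.lsum
    (fun j => (LinearMap.mulRight R (algebraMap ℂ R (φ (qm f (mm i j 1)))))))

lemma Phi_mm (φ : MA f →ₗ[ℂ] ℂ) (i j : ℕ) (c : R) :
    Phi R φ (mm i j c) = c * algebraMap ℂ R (φ (qm f (mm i j 1))) := by
  rw [Phi, mm, Polynomial.lsum_apply, sum_monomial_index, Polynomial.lsum_apply, sum_monomial_index]
  · rfl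
  · simp
  · simp

lemma Phi_bc (φ : MA f →ₗ[ℂ] ℂ) (p : ℂ[X][X]) : Phi R φ (bc R p) = algebraMap ℂ R (φ (qm f p)) := by
  induction p using mm_induction with
  | hadd p q hp hq => simp only [map_add, hp, hq]
  | hmm i j c =>
    rw [bc_mm, Phi_mm]
    have : mm i j c = c • mm i j (1 : ℂ) := by
      apply cf_ext; intro a b; rw [cf_smul, cf_mm, cf_mm]; split_ifs <;> simp
    rw [this, map_smul, map_smul, smul_eq_mul, map_mul]

lemma Phi_mul_crit (φ : MA f →ₗ[ℂ] ℂ) {p : ℂ[X][X]} (hp : qm f p = 0) (P : R[X][X]) :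
    Phi R φ (bc R p * P) = 0 := by
  induction P using mm_induction with
  | hadd p q hp hq => rw [mul_add, map_add, hp, hq, add_zero]
  | hmm i j c =>
    rw [mm_smul, mul_smul_comm, map_smul, ← map_mul, Phi_bc, map_mul, hp, zero_mul]
    simp

lemma Phi_mul_zero (φ : MA f →ₗ[ℂ] ℂ) {g : ℂ[X][X]} (hg : ∀ h, φ (qm f g * h) = 0) (P : R[X][X]) :
    Phi R φ (P * bc R g) = 0 := by
  induction P using mm_induction with
  | hadd p q hp hq => rw [add_mul, map_add, hp, hq, add_zero]
  | hmm i j c =>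
    rw [mm_smul, smul_mul_assoc, map_smul, ← map_mul, Phi_bc, map_mul, mul_comm, hg]
    simp

lemma Phi_box (h : Dat m f x) {P : R[X][X]} (hP : P ∈ L R (2 * m - 1) (2 * m - 1)) :
    Phi R (phi h) P = tf R m x P := by
  rw [L_sumR hP, map_sum, map_sum]
  refine Finset.sum_congr rfl (fun i hi => ?_)
  rw [map_sum, map_sum]
  refine Finset.sum_congr rfl (fun j hj => ?_)
  rw [Finset.mem_range] at hi hj
  rw [mm_smul, map_smul, map_smul, Phi_bc, tf_bc, phi_qm h (L_mm _ hi hj)]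

/-- the residue constant -/
noncomputable def rc (m : ℕ) (B : ℂ[X]) (x : ℕ → ℂ) : ℂ :=
  m * (m * tau ℂ (2 * m - 1) x (X ^ (m - 2) * B)
        - tau ℂ (2 * m - 1) x (X ^ (m - 1) * derivative B))

variable {z0 w0 : R}

lemma tf_Del (h : Dat m f x) :
    tf R m x (Del z0 w0 (bc R (derivative f)) (bc R (dw f))) =
      algebraMap ℂ R (rc m ((swap f).coeff m) x) := by
  have hm := h.hm
  have hu : bc R (derivative f) ∈ L R m (m + 1) := bc_L (L_derivative h.good.inL)
  have hv : bc R (dw f) ∈ L R (m + 1) m := bc_L (L_dw h.good.inL)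
  have hD := Del_L (z0 := z0) (w0 := w0) hm hu hv
  rw [tf_of_L (L_mono (by omega) le_rfl hD), Del_top hm hu hv]
  have e1 : (swap (bc R (derivative f))).coeff m
      = (derivative ((swap f).coeff m)).map (algebraMap ℂ R) := by
    rw [swap_bc, bc_coeff, swap_derivative_coeff]
  have e2 : (swap (bc R (dw f))).coeff (m - 1)
      = C (algebraMap ℂ R m) * ((swap f).coeff m).map (algebraMap ℂ R) := by
    rw [swap_bc, bc_coeff, swap_dw, Good.derivative_coeff (by omega), Polynomial.map_mul, map_C]
  have e3 : dq ((swap (bc R (derivative f))).coeff m) z0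
        * C (((swap (bc R (dw f))).coeff (m - 1)).eval z0)
      - C (((swap (bc R (derivative f))).coeff m).eval z0) * dq ((swap (bc R (dw f))).coeff (m - 1)) z0
      = (algebraMap ℂ R m) • bezK ((swap f).coeff m) z0 := by
    rw [e1, e2, dq_C_mul, bezK, eval_mul, eval_C, eval_map_algebraMap, eval_map_algebraMap,
      smul_eq_C_mul, C_mul]
    ring
  rw [e3, map_smul, tau_bezK hm h.good.swap.monic h.good.swap.natDegree h.bord, rc, smul_eq_mul, ← (algebraMap ℂ R).map_mul]

lemma Phi_Del (h : Dat m f x) (hu : (bc R (derivative f)).evalEval w0 z0 = 0)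
    (hv : (bc R (dw f)).evalEval w0 z0 = 0) (H : R[X][X]) :
    Phi R (phi h) (Del z0 w0 (bc R (derivative f)) (bc R (dw f)) * H)
      = H.evalEval w0 z0 * algebraMap ℂ R (rc m ((swap f).coeff m) x) := by
  have hm := h.hm
  have q1 : qm f (derivative f) = 0 := qm_eq_zero.2 ⟨1, 0, by ring⟩
  have q2 : qm f (dw f) = 0 := qm_eq_zero.2 ⟨0, 1, by ring⟩
  set D := Del z0 w0 (bc R (derivative f)) (bc R (dw f)) with hD
  have hDL : D ∈ L R m (2 * m - 1) := Del_L hm (bc_L (L_derivative h.good.inL)) (bc_L (L_dw h.good.inL))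
  have e1 := Del_z hu hv
  have e2 := Del_w hu hv
  rw [← hD] at e1 e2
  have e3 := div_biv z0 w0 H
  have e : D * H = bc R (derivative f) * (C (dqi z0 w0 (bc R (dw f))) * dqo z0 H
        - dqo z0 (bc R (dw f)) * C (dqi z0 w0 H))
      + bc R (dw f) * (dqo z0 (bc R (derivative f)) * C (dqi z0 w0 H)
        - C (dqi z0 w0 (bc R (derivative f))) * dqo z0 H)
      + (H.evalEval w0 z0) • D := by
    have e4 : (H.evalEval w0 z0) • D = C (C (H.evalEval w0 z0)) * D := by
      apply cf_ext; intro i j; rw [cf_smul, cf, cf, coeff_C_mul, coeff_C_mul]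
    rw [e4]
    rw [C_mul] at e3
    linear_combination (-D) * e3 + dqo z0 H * e1 + C (dqi z0 w0 H) * e2
  rw [e, map_add, map_add, Phi_mul_crit _ q1, Phi_mul_crit _ q2, map_smul,
    Phi_box h (L_mono (by omega) le_rfl hDL), hD, tf_Del h]
  simp

lemma rc_ne (h : Dat m f x) : rc m ((swap f).coeff m) x ≠ 0 := by
  have hm := h.hm
  exact mul_ne_zero (by exact_mod_cast (by omega : m ≠ 0)) h.bord.hc

lemma rc_re (h : Dat m f x) : (rc m ((swap f).coeff m) x).re ≤ 0 := by
  have h1 := h.bord.hre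
  rw [rc]
  have : ((m : ℂ)) = ((m : ℝ) : ℂ) := by simp
  set t := (m * tau ℂ (2 * m - 1) x (X ^ (m - 2) * (swap f).coeff m)
        - tau ℂ (2 * m - 1) x (X ^ (m - 1) * derivative ((swap f).coeff m))) with ht
  rw [this, Complex.re_ofReal_mul]
  exact mul_nonpos_of_nonneg_of_nonpos (by positivity) h1

lemma evalEval_bc (p : ℂ[X][X]) : (bc (MA f) p).evalEval (qm f (C X)) (qm f X) = qm f p := by
  induction p using mm_induction with
  | hadd p q hp hq => simp only [map_add, evalEval_add, hp, hq]
  | hmm i j c =>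
    rw [bc_mm, mm_eq, mm_eq, evalEval_mul, evalEval_pow, evalEval_X, evalEval_C]
    simp only [eval_mul, eval_C, eval_pow, eval_X, C_mul, C_pow, map_mul, map_pow]
    congr 2

lemma phi_nd (h : Dat m f x) (g : MA f) (hg : ∀ k, phi h (g * k) = 0) : g = 0 := by
  obtain ⟨p, rfl⟩ := qm_surj f g
  have q1 : qm f (derivative f) = 0 := qm_eq_zero.2 ⟨1, 0, by ring⟩
  have q2 : qm f (dw f) = 0 := qm_eq_zero.2 ⟨0, 1, by ring⟩
  have := Phi_Del (R := MA f) (z0 := qm f X) (w0 := qm f (C X)) h (by rw [evalEval_bc, q1])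
    (by rw [evalEval_bc, q2]) (bc _ p)
  rw [Phi_mul_zero _ hg, evalEval_bc] at this
  have hu : IsUnit (algebraMap ℂ (MA f) (rc m ((swap f).coeff m) x)) :=
    (isUnit_iff_ne_zero.2 (rc_ne h)).map _
  exact (hu.mul_left_eq_zero).1 this.symm

/-- the involutive Frobenius structure -/
noncomputable def inF (h : Dat m f x) : InvF (MA f) where
  σ := sg h.star
  inv := by
    intro y
    obtain ⟨p, rfl⟩ := qm_surj f y
    rw [sg_qm, sg_qm, st_st]
  hconj := by
    intro c
    have e1 : ∀ c, algebraMap ℂ (MA f) c = qm f (mm 0 0 c) := by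
      intro c
      rw [← (qm f).commutes c]; rfl
    rw [e1, e1, sg_qm]
    congr 1
    apply cf_ext; intro i j
    rw [cf_st, cf_mm, cf_mm]
    split_ifs with h1 h2 h2
    · rfl
    · tauto
    · tauto
    · simp
  φ := phi h
  hφ := by
    intro y
    obtain ⟨p, rfl⟩ := qm_box_surj h.good (by have := h.hm; omega) y
    change phi h (sg h.star (qm f p)) = (starRingEnd ℂ) (phi h (qm f p))
    rw [sg_qm, phi_qm h p.2, phi_qm h (L_st p.2), tf_st h.bord.real]
  nd := phi_nd h

/-- characters from points -/
lemma exists_char {z0 w0 : ℂ} (hu : (derivative f).evalEval w0 z0 = 0)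
    (hv : (dw f).evalEval w0 z0 = 0) : ∃ χ : MA f →ₐ[ℂ] ℂ, ∀ p, χ (qm f p) = p.evalEval w0 z0 := by
  refine ⟨Ideal.Quotient.liftₐ (crit f) (aevalAeval w0 z0 : ℂ[X][X] →ₐ[ℂ] ℂ) ?_, ?_⟩
  · intro p hp
    obtain ⟨α, β, e⟩ := mem_crit.1 hp
    rw [coe_aevalAeval_eq_evalEval, ← e, evalEval_add, evalEval_mul, evalEval_mul, hu, hv]
    simp
  · intro p
    exact congrFun (coe_aevalAeval_eq_evalEval w0 z0) p

lemma char_eval (χ : MA f →ₐ[ℂ] ℂ) (p : ℂ[X][X]) :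
    χ (qm f p) = p.evalEval (χ (qm f (C X))) (χ (qm f X)) := by
  induction p using mm_induction with
  | hadd p q hp hq => simp only [map_add, evalEval_add, hp, hq]
  | hmm i j c =>
    rw [mm_eq, evalEval_mul, evalEval_pow, evalEval_X, evalEval_C]
    simp only [eval_mul, eval_C, eval_pow, eval_X, C_mul, C_pow, map_mul, map_pow]
    congr 2
    have := (qm f).commutes c
    have e : (algebraMap ℂ ℂ[X][X]) c = C (C c) := rfl
    rw [e] at this
    rw [this]
    exact χ.commutes c

/-- the simple-point element -/
lemma exists_simple (h : Dat m f x) (p : MA f →ₐ[ℂ] ℂ) (hJ : p (qm f (derivative (derivative f)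
      * dw (dw f) - dw (derivative f) * derivative (dw f))) ≠ 0) :
    ∃ e : MA f, (∀ k, k * e = p k • e) ∧ p e = 1 ∧ phi h e * p (qm f (derivative (derivative f)
      * dw (dw f) - dw (derivative f) * derivative (dw f))) = rc m ((swap f).coeff m) x := by
  set z0 := p (qm f X)
  set w0 := p (qm f (C X))
  have hev : ∀ q, p (qm f q) = q.evalEval w0 z0 := char_eval p
  have q1 : qm f (derivative f) = 0 := qm_eq_zero.2 ⟨1, 0, by ring⟩
  have q2 : qm f (dw f) = 0 := qm_eq_zero.2 ⟨0, 1, by ring⟩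
  have hu : (derivative f).evalEval w0 z0 = 0 := by rw [← hev, q1, map_zero]
  have hv : (dw f).evalEval w0 z0 = 0 := by rw [← hev, q2, map_zero]
  set J := p (qm f (derivative (derivative f)
      * dw (dw f) - dw (derivative f) * derivative (dw f))) with hJdef
  set D := Del z0 w0 (derivative f) (dw f) with hD
  have e1 := Del_z hu hv
  have e2 := Del_w hu hv
  rw [← hD] at e1 e2
  have bcid : ∀ q, bc ℂ q = q := by
    intro q; apply cf_ext; intro i j; rw [cf_bc]; rfl
  have hk : ∀ k, qm f k * qm f D = (k.evalEval w0 z0) • qm f D := by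
    intro k
    rw [← map_mul, ← map_smul, ← sub_eq_zero, ← map_sub, qm_eq_zero]
    have e3 := div_biv z0 w0 k
    have e4 : (k.evalEval w0 z0) • D = C (C (k.evalEval w0 z0)) * D := by
      apply cf_ext; intro i j; rw [cf_smul, cf, cf, coeff_C_mul, coeff_C_mul]
    refine ⟨C (dqi z0 w0 (dw f)) * dqo z0 k - dqo z0 (dw f) * C (dqi z0 w0 k),
      dqo z0 (derivative f) * C (dqi z0 w0 k) - C (dqi z0 w0 (derivative f)) * dqo z0 k, ?_⟩
    rw [e4]
    rw [C_mul] at e3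
    linear_combination D * e3 - dqo z0 k * e1 - C (dqi z0 w0 k) * e2
  have hpD : p (qm f D) = J := by
    rw [hJdef, hev, hev, hD, Del_eval, evalEval_sub, evalEval_mul, evalEval_mul]
  have hφ : phi h (qm f D) = rc m ((swap f).coeff m) x := by
    have := tf_Del (R := ℂ) (z0 := z0) (w0 := w0) h
    rw [bcid, bcid, ← hD] at this
    have hm := h.hm
    rw [phi_qm h (L_mono (by omega) le_rfl (Del_L hm (L_derivative h.good.inL) (L_dw h.good.inL)))]
    exact this
  refine ⟨J⁻¹ • qm f D, ?_, ?_, ?_⟩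
  · intro k
    obtain ⟨k, rfl⟩ := qm_surj f k
    rw [mul_smul_comm, hk, hev, smul_comm]
  · rw [map_smul, hpD, smul_eq_mul, inv_mul_cancel₀ hJ]
  · rw [map_smul, hφ, smul_eq_mul]
    field_simp

end Phi
end EC

namespace EC
open Module Polynomial
open Polynomial.Bivariate (swap)
set_option linter.unusedSectionVars false

section fam
open Topology Filter
variable {T : Type*} [TopologicalSpace T] [Nonempty T]

/-- evaluation at a parameter -/
noncomputable def evT (θ : T) : C(T, ℂ) →+* ℂ where
  toFun a := a θ
  map_one' := rfl
  map_mul' _ _ := rfl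
  map_zero' := rfl
  map_add' _ _ := rfl

lemma evT_apply (θ : T) (a : C(T, ℂ)) : evT θ a = a θ := rfl

/-- specialisation at a parameter -/
noncomputable def spe (θ : T) : C(T, ℂ)[X][X] →+* ℂ[X][X] := mapRingHom (mapRingHom (evT θ))

lemma cf_spe (θ : T) (p : C(T, ℂ)[X][X]) (i j : ℕ) : cf (spe θ p) i j = cf p i j θ := by
  simp [spe, cf, evT_apply]

lemma spe_bc (θ : T) (p : ℂ[X][X]) : spe θ (bc C(T, ℂ) p) = p := by
  apply cf_ext; intro i j; rw [cf_spe, cf_bc]; rfl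

lemma spe_derivative (θ : T) (p : C(T, ℂ)[X][X]) : spe θ (derivative p) = derivative (spe θ p) := by
  apply cf_ext; intro i j; simp [cf_spe, cf_derivative]

lemma spe_dw (θ : T) (p : C(T, ℂ)[X][X]) : spe θ (dw p) = dw (spe θ p) := by
  apply cf_ext; intro i j; simp [cf_spe, cf_dw]

lemma L_spe (θ : T) {a b : ℕ} {p : C(T, ℂ)[X][X]} (hp : p ∈ L _ a b) : spe θ p ∈ L ℂ a b := by
  intro i j hij; rw [cf_spe, hp i j hij]; rfl

lemma tf_spe (θ : T) (m : ℕ) (x : ℕ → ℂ) (p : C(T, ℂ)[X][X]) :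
    tf ℂ m x (spe θ p) = tf C(T, ℂ) m x p θ := by
  have e : ∀ (q : C(T, ℂ)[X][X]) i j, ((spe θ q).coeff i).coeff j = ((q.coeff i).coeff j) θ := cf_spe θ
  have e1 : swap (spe θ p) = spe θ (swap p) := by
    apply cf_ext; intro i j; rw [cf_swap, cf_spe, cf_spe, cf_swap]
  rw [tf_apply, tf_apply, e1, cf_spe, tau_apply, tau_apply, tau_apply, tau_apply]
  simp [e, ContinuousMap.sum_apply]

variable {m : ℕ} {F : C(T, ℂ)[X][X]} {x : ℕ → ℂ}

lemma phi_cont (hF : Good m F) (h : ∀ θ, Dat m (spe θ F) x) (P : C(T, ℂ)[X][X]) :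
    ∃ c : C(T, ℂ), ∀ θ, phi (h θ) (qm _ (spe θ P)) = c θ := by
  obtain ⟨θ0⟩ := (inferInstance : Nonempty T)
  have hm := (h θ0).hm
  have hmu : IsUnit (m : C(T, ℂ)) := by
    have : IsUnit (m : ℂ) := isUnit_iff_ne_zero.2 (by exact_mod_cast (by omega : m ≠ 0))
    have := this.map (algebraMap ℂ C(T, ℂ))
    rwa [map_natCast] at this
  obtain ⟨g, hg, α, β, e⟩ := reduce (by omega) hmu hF P
  refine ⟨tf _ m x g, fun θ => ?_⟩
  have : qm (spe θ F) (spe θ P) = qm _ (spe θ g) := by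
    rw [← sub_eq_zero, ← map_sub, qm_eq_zero]
    refine ⟨spe θ α, spe θ β, ?_⟩
    rw [e]
    simp only [map_add, map_mul, spe_derivative, spe_dw]
    ring
  rw [this, phi_qm (h θ) (L_spe θ hg), tf_spe]

lemma Dat.fd {f : ℂ[X][X]} (h : Dat m f x) : FiniteDimensional ℂ (MA f) :=
  finite_MA h.good (by have := h.hm; omega)

set_option maxHeartbeats 1000000 in
lemma nn_lsc [∀ θ, FiniteDimensional ℂ (MA (spe θ F))] (hF : Good m F) (h : ∀ θ, Dat m (spe θ F) x) (g : C(T, ℂ)[X][X]) (θ0 : T) :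
    ∀ᶠ θ in 𝓝 θ0, (inF (h θ0)).nn (qm _ (spe θ0 g)) ≤ (inF (h θ)).nn (qm _ (spe θ g)) := by
  obtain ⟨W, hW, hneg⟩ := exists_nind ((inF (h θ0)).form (qm _ (spe θ0 g)))
  obtain ⟨d, hd⟩ : ∃ d, finrank ℂ W = d := ⟨_, rfl⟩
  let b : Basis (Fin d) ℂ W := finBasisOfFinrankEq ℂ W hd
  choose v hv using fun i => qm_surj (spe θ0 F) (b i : MA (spe θ0 F))
  choose a ha using fun i j => phi_cont hF h (g * bc _ (v i * st (v j)))
  let ℓ : ∀ θ, (Fin d → ℂ) →ₗ[ℂ] MA (spe θ F) := fun θ =>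
    Fintype.linearCombination ℂ (fun i => qm (spe θ F) (v i))
  have hℓ : ∀ θ c, ℓ θ c = ∑ i, c i • qm (spe θ F) (v i) := fun θ c => Fintype.linearCombination_apply ..
  have hform : ∀ θ c, (inF (h θ)).form (qm _ (spe θ g)) (ℓ θ c) (ℓ θ c)
      = ∑ i, ∑ j, c i * (starRingEnd ℂ) (c j) * a i j θ := by
    intro θ c
    rw [hℓ, LinearMap.map_sum₂]
    refine Finset.sum_congr rfl (fun i _ => ?_)
    rw [map_sum]
    refine Finset.sum_congr rfl (fun j _ => ?_)
    rw [LinearMap.map_smulₛₗ, LinearMap.map_smulₛₗ₂]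
    simp only [RingHom.id_apply, smul_eq_mul]
    rw [InvF.form_apply, ← ha i j θ]
    have e : (inF (h θ)).σ (qm (spe θ F) (v j)) = qm _ (st (v j)) := sg_qm (h θ).star _
    have e2 : (inF (h θ)).φ = phi (h θ) := rfl
    have e3 : qm (spe θ F) (spe θ (g * bc _ (v i * st (v j))))
        = qm _ (spe θ g) * (qm _ (v i) * qm _ (st (v j))) := by
      rw [(spe θ).map_mul, spe_bc, map_mul (qm _), map_mul (qm _)]
    rw [e, e2, e3]
    ring
  have h0 : ∀ c, c ≠ 0 → ((inF (h θ0)).form (qm _ (spe θ0 g)) (ℓ θ0 c) (ℓ θ0 c)).re < 0 := by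
    intro c hc
    have e : ℓ θ0 c = ((∑ i, c i • b i : W) : MA (spe θ0 F)) := by
      rw [hℓ]; push_cast
      simp only [hv, Submodule.coe_smul]
    apply hneg
    · rw [e]; exact Submodule.coe_mem _
    · rw [e]
      intro h1
      have h2 : ∑ i, c i • b i = 0 := Subtype.ext h1
      apply hc
      funext i
      exact Fintype.linearIndependent_iff.1 b.linearIndependent c h2 i
  have hcont : Continuous (fun y : (Fin d → ℂ) × T =>
      (∑ i, ∑ j, y.1 i * (starRingEnd ℂ) (y.1 j) * a i j y.2).re) := by
    apply Complex.continuous_re.comp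
    refine continuous_finset_sum _ (fun i _ => continuous_finset_sum _ (fun j _ => ?_))
    have h3 := Complex.continuous_conj
    have : Continuous fun y : (Fin d → ℂ) × T => (starRingEnd ℂ) (y.1 j) := h3.comp (by fun_prop)
    fun_prop
  have hev : ∀ᶠ θ in 𝓝 θ0, ∀ c ∈ Metric.sphere (0 : Fin d → ℂ) 1,
      (∑ i, ∑ j, c i * (starRingEnd ℂ) (c j) * a i j θ).re < 0 := by
    apply (isCompact_sphere (0 : Fin d → ℂ) 1).eventually_forall_of_forall_eventually
    intro c hc
    have h4 := h0 c (by rintro rfl; simp at hc)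
    rw [hform] at h4
    have := hcont.continuousAt (x := (c, θ0))
    have h5 := this.eventually (gt_mem_nhds h4)
    exact (continuous_swap.tendsto (θ0, c)).eventually h5
  filter_upwards [hev] with θ hθ
  have hn : ∀ c, c ≠ 0 → ((inF (h θ)).form (qm _ (spe θ g)) (ℓ θ c) (ℓ θ c)).re < 0 := by
    intro c hc
    have hpos : 0 < ‖c‖ := norm_pos_iff.2 hc
    have h1 := hθ ((‖c‖⁻¹ : ℝ) • c) (by
      rw [mem_sphere_zero_iff_norm, norm_smul, norm_inv, norm_norm, inv_mul_cancel₀ hpos.ne'])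
    have e : (∑ i, ∑ j, ((‖c‖⁻¹ : ℝ) • c) i * (starRingEnd ℂ) (((‖c‖⁻¹ : ℝ) • c) j) * a i j θ)
        = ((‖c‖⁻¹ ^ 2 : ℝ) : ℂ) * ∑ i, ∑ j, c i * (starRingEnd ℂ) (c j) * a i j θ := by
      simp only [Finset.mul_sum]
      refine Finset.sum_congr rfl (fun i _ => Finset.sum_congr rfl (fun j _ => ?_))
      simp only [Pi.smul_apply, Complex.real_smul, map_mul, Complex.conj_ofReal]
      push_cast; ring
    rw [e, Complex.re_ofReal_mul] at h1
    rw [hform]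
    by_contra hcon
    push Not at hcon
    have : 0 ≤ ‖c‖⁻¹ ^ 2 := by positivity
    nlinarith [mul_nonneg this hcon]
  have hinj : Function.Injective (ℓ θ) := by
    rw [← LinearMap.ker_eq_bot, LinearMap.ker_eq_bot']
    intro c hc
    by_contra h1
    have := hn c h1
    rw [hc] at this
    simp at this
  have hr : finrank ℂ (LinearMap.range (ℓ θ)) = d := by
    rw [LinearMap.finrank_range_of_inj hinj]; simp
  have hnd : NegDef ((inF (h θ)).form (qm _ (spe θ g))) (LinearMap.range (ℓ θ)) := by
    rintro _ ⟨c, rfl⟩ h1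
    apply hn
    rintro rfl
    simp at h1
  have := hnd.le_nind
  rw [hr, ← hd, hW] at this
  exact this

end fam
end EC

namespace EC
open Module Polynomial
open Polynomial.Bivariate (swap)
set_option linter.unusedSectionVars false

section loc
open Topology Filter

lemma good_add {S : Type*} [CommRing S] {m : ℕ} {f q : S[X][X]} (hf : Good m f) (hq : q ∈ L S m m) :
    Good m (f + q) := by
  have e1 : (f + q).coeff m = f.coeff m := by
    rw [coeff_add, coeff_eq_zero_of_L hq le_rfl, add_zero]
  have e2 : (swap (f + q)).coeff m = (swap f).coeff m := by
    rw [map_add, coeff_add, coeff_eq_zero_of_L (L_swap hq) le_rfl, add_zero]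
  constructor
  · exact Submodule.add_mem _ hf.inL (L_mono (by omega) (by omega) hq)
  · rw [cf, e1]; exact hf.corner
  · rw [e1]; exact hf.cop
  · rw [e2]; exact hf.cop'

lemma good_bc {R : Type*} [CommRing R] [Algebra ℂ R] {m : ℕ} {f : ℂ[X][X]} (hf : Good m f) :
    Good m (bc R f) := by
  constructor
  · exact bc_L hf.inL
  · rw [cf_bc, hf.corner, map_one]
  · rw [bc_coeff, derivative_map]; exact (by simpa only [coe_mapRingHom] using hf.cop.map (mapRingHom (algebraMap ℂ R)))
  · rw [swap_bc, bc_coeff, derivative_map]; exact (by simpa only [coe_mapRingHom] using hf.cop'.map (mapRingHom (algebraMap ℂ R)))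

lemma dat_add {m : ℕ} {f q : ℂ[X][X]} {x : ℕ → ℂ} (h : Dat m f x) (hq : q ∈ L ℂ m m) (hs : st q = q) :
    Dat m (f + q) x := by
  have e2 : (swap (f + q)).coeff m = (swap f).coeff m := by
    rw [map_add, coeff_add, coeff_eq_zero_of_L (L_swap hq) le_rfl, add_zero]
  exact ⟨h.hm, good_add h.good hq, by rw [map_add, h.star, hs], by rw [e2]; exact h.bord⟩

variable {m : ℕ} {f : ℂ[X][X]} {x : ℕ → ℂ}

lemma char_ext {χ ψ : MA f →ₐ[ℂ] ℂ} (h1 : χ (qm f X) = ψ (qm f X)) (h2 : χ (qm f (C X)) = ψ (qm f (C X))) :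
    χ = ψ := by
  ext y
  obtain ⟨p, rfl⟩ := qm_surj f y
  rw [char_eval χ p, char_eval ψ p, h1, h2]

lemma st_X : st X = C X := by
  have e1 : (X : ℂ[X][X]) = mm 1 0 1 := by rw [mm_eq]; simp
  have e2 : (C X : ℂ[X][X]) = mm 0 1 1 := by rw [mm_eq]; simp
  rw [e2, e1]
  apply cf_ext; intro i j; rw [cf_st, cf_mm, cf_mm]
  split_ifs with h1 h2 h2 <;> first | rfl | (exfalso; omega) | simp

lemma st_CX : st (C X) = X := by
  rw [← st_X, st_st]

lemma real_iff [FiniteDimensional ℂ (MA f)] (h : Dat m f x) (χ : MA f →ₐ[ℂ] ℂ) :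
    (inF h).IsRealC χ ↔ χ (qm f (C X)) = (starRingEnd ℂ) (χ (qm f X)) := by
  have e1 : (inF h).σ (qm f X) = qm f (C X) := by
    have := sg_qm h.star X
    rw [st_X] at this; exact this
  have e2 : (inF h).σ (qm f (C X)) = qm f X := by
    have := sg_qm h.star (C X)
    rw [st_CX] at this; exact this
  constructor
  · intro hr
    have := congrArg (fun ψ => ψ (qm f (C X))) hr
    simp only [InvF.cstar_apply] at this
    rw [← this, e2]
  · intro hr
    apply char_ext
    · rw [InvF.cstar_apply, e1, hr]; simp
    · rw [InvF.cstar_apply, e2, hr]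

lemma st_CC (c : ℂ) : st (C (C c)) = C (C ((starRingEnd ℂ) c)) := by
  have e : ∀ c : ℂ, C (C c) = mm 0 0 c := by intro c; rw [mm_eq]; simp
  rw [e, e]
  apply cf_ext; intro i j; rw [cf_st, cf_mm, cf_mm]
  split_ifs with h1 h2 h2 <;> first | rfl | (exfalso; omega) | simp

/-- the distance polynomial -/
noncomputable def dN (p : ℂ) : ℂ[X][X] := (X - C (C p)) * (C X - C (C ((starRingEnd ℂ) p)))

lemma st_dN (p : ℂ) : st (dN p) = dN p := by
  rw [dN]; simp only [map_mul, map_sub, st_X, st_CX, st_CC, Complex.conj_conj]; ring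

lemma dN_eval (p z w : ℂ) : (dN p).evalEval w z = (z - p) * (w - (starRingEnd ℂ) p) := by
  rw [dN, evalEval_mul, evalEval_sub, evalEval_sub, evalEval_X, evalEval_C, evalEval_C, evalEval_C]
  simp

lemma dN_eval_real (p z : ℂ) : (dN p).evalEval ((starRingEnd ℂ) z) z = ((‖z - p‖ ^ 2 : ℝ) : ℂ) := by
  rw [dN_eval, ← map_sub, Complex.mul_conj, Complex.normSq_eq_norm_sq]

/-- the Jacobian -/
noncomputable def Jac (f : ℂ[X][X]) : ℂ[X][X] := derivative (derivative f)
      * dw (dw f) - dw (derivative f) * derivative (dw f)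

/-- simple case -/
lemma simple_case [FiniteDimensional ℂ (MA f)] (h : Dat m f x) {p : ℂ} {χp : MA f →ₐ[ℂ] ℂ}
    (h1 : χp (qm f X) = p) (h2 : χp (qm f (C X)) = (starRingEnd ℂ) p)
    {j : ℝ} (hj : j < 0) (hJ : (Jac f).evalEval ((starRingEnd ℂ) p) p = j) {s : MA f}
    (hs : (inF h).σ s = s)
    (hsu : ∀ χ : MA f →ₐ[ℂ] ℂ, χ s ≠ 0) (hsp : (χp s).re < 0)
    (hspos : ∀ χ, (inF h).IsRealC χ → χ ≠ χp → 0 < (χ s).re) :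
    (inF h).nn 1 + 1 ≤ (inF h).nn s := by
  have hp : (inF h).IsRealC χp := by rw [real_iff, h1, h2]
  have hJ' : χp (qm f (derivative (derivative f)
      * dw (dw f) - dw (derivative f) * derivative (dw f))) = j := by
    rw [char_eval, h1, h2]; exact hJ
  obtain ⟨e, he, hpe, hφ⟩ := exists_simple h χp (by rw [hJ']; exact_mod_cast hj.ne)
  rw [hJ'] at hφ
  refine (inF h).nn_simple hp he hpe ?_ hs hsu hsp hspos
  have hσ : (inF h).σ e = e := by
    have h1 : (inF h).σ e * e = e := by rw [he, (inF h).apply_σ, hp, hpe]; simp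
    have h2 := congrArg (inF h).σ h1
    rw [map_mul, (inF h).inv] at h2
    rw [← h2, mul_comm, h1]
  have hreal := (inF h).hφ e
  rw [hσ, eq_comm, Complex.conj_eq_iff_im] at hreal
  change 0 < (phi h e).re
  change (phi h e).im = 0 at hreal
  have hr1 := rc_re h
  have hr2 := rc_ne h
  rw [← hφ] at hr1 hr2
  simp only [Complex.mul_re, Complex.ofReal_re, Complex.ofReal_im, mul_zero, sub_zero] at hr1
  have h3 : (phi h e).re ≠ 0 := by
    intro h0
    apply hr2
    have : phi h e = 0 := Complex.ext h0 hreal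
    rw [this, zero_mul]
  have h4 : 0 ≤ (phi h e).re := by
    by_contra hc
    push Not at hc
    nlinarith [mul_pos_of_neg_of_neg hc hj]
  exact lt_of_le_of_ne h4 (Ne.symm h3)

/-- perturbed polynomial -/
noncomputable def pert (f q1 q2 : ℂ[X][X]) (t s : ℝ) : ℂ[X][X] :=
  f + (C (C (t : ℂ)) * q1 + C (C (s : ℂ)) * q2)

/-- The local perturbation property -/
def Loc (f q1 q2 : ℂ[X][X]) (p : ℂ) : Prop :=
  ∃ r > 0, ∀ ε > 0, ∃ t s : ℝ, |t| < ε ∧ |s| < ε ∧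
    (derivative (pert f q1 q2 t s)).evalEval ((starRingEnd ℂ) p) p = 0 ∧
    (dw (pert f q1 q2 t s)).evalEval ((starRingEnd ℂ) p) p = 0 ∧
    (∃ j : ℝ, j < 0 ∧ (Jac (pert f q1 q2 t s)).evalEval ((starRingEnd ℂ) p) p = j) ∧
    ∀ z : ℂ, (derivative (pert f q1 q2 t s)).evalEval ((starRingEnd ℂ) z) z = 0 →
      (dw (pert f q1 q2 t s)).evalEval ((starRingEnd ℂ) z) z = 0 → ‖z - p‖ < r → z = p

lemma L_CC {a b : ℕ} {q : ℂ[X][X]} (c : ℂ) (hq : q ∈ L ℂ a b) : C (C c) * q ∈ L ℂ a b := by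
  intro i j hij
  rw [cf, coeff_C_mul, coeff_C_mul]
  have := hq i j hij
  rw [cf] at this
  rw [this, mul_zero]

set_option maxHeartbeats 1000000 in
lemma local_claim [FiniteDimensional ℂ (MA f)] (h : Dat m f x) {q1 q2 : ℂ[X][X]}
    (hq1 : q1 ∈ L ℂ m m) (hq2 : q2 ∈ L ℂ m m) (hs1 : st q1 = q1) (hs2 : st q2 = q2)
    {p : ℂ} {χp : MA f →ₐ[ℂ] ℂ}
    (h1 : χp (qm f X) = p) (h2 : χp (qm f (C X)) = (starRingEnd ℂ) p) (hloc : Loc f q1 q2 p) :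
    ∃ s, (inF h).σ s = s ∧ (∀ χ : MA f →ₐ[ℂ] ℂ, χ s ≠ 0) ∧ (χp s).re < 0 ∧
      (∀ χ, (inF h).IsRealC χ → χ ≠ χp → 0 < (χ s).re) ∧ (inF h).nn 1 + 1 ≤ (inF h).nn s := by
  obtain ⟨r, hr, hloc⟩ := hloc
  have hρ : ∀ᶠ ρ : ℝ in 𝓝[>] 0, (0 < ρ ∧ ρ < r ^ 2) ∧ ∀ χ : MA f →ₐ[ℂ] ℂ, χ (qm f (dN p)) ≠ 0 → ρ < ‖χ (qm f (dN p))‖ := by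
    refine Filter.Eventually.and (Ioo_mem_nhdsGT (by positivity : (0:ℝ) < r ^ 2)) ?_
    rw [eventually_all]
    intro χ
    by_cases h0 : χ (qm f (dN p)) = 0
    · exact Eventually.of_forall (fun _ h => absurd h0 h)
    · filter_upwards [Ioo_mem_nhdsGT (norm_pos_iff.2 h0)] with ρ hρ _ using hρ.2
  obtain ⟨ρ, ⟨hρ0, hρr⟩, hρχ⟩ := hρ.exists
  -- the weight
  have wt : ∀ u : ℝ, ∀ (f' : ℂ[X][X]) (h' : Dat m f' x) [FiniteDimensional ℂ (MA f')],
      (inF h').σ (qm f' (dN p - C (C (u : ℂ)))) = qm f' (dN p - C (C (u : ℂ))) := by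
    intro u f' h' _
    have := sg_qm h'.star (dN p - C (C (u : ℂ)))
    rw [map_sub st, st_dN, st_CC, Complex.conj_ofReal] at this
    exact this
  have wv : ∀ u : ℝ, ∀ (f' : ℂ[X][X]) (χ : MA f' →ₐ[ℂ] ℂ),
      χ (qm f' (dN p - C (C (u : ℂ)))) = χ (qm f' (dN p)) - u := by
    intro u f' χ
    rw [map_sub (qm f'), map_sub]
    congr 1
    rw [char_eval, evalEval_C]; simp
  have wr : ∀ (f' : ℂ[X][X]) (h' : Dat m f' x) [FiniteDimensional ℂ (MA f')] (χ : MA f' →ₐ[ℂ] ℂ),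
      (inF h').IsRealC χ → χ (qm f' (dN p)) = ((‖χ (qm f' X) - p‖ ^ 2 : ℝ) : ℂ) := by
    intro f' h' _ χ hχ
    rw [real_iff] at hχ
    rw [char_eval, hχ, dN_eval_real]
  have hsu : ∀ χ : MA f →ₐ[ℂ] ℂ, χ (qm f (dN p - C (C (ρ : ℂ)))) ≠ 0 := by
    intro χ h0
    rw [wv, sub_eq_zero] at h0
    have := hρχ χ (by rw [h0]; exact_mod_cast hρ0.ne')
    rw [h0, Complex.norm_real, Real.norm_eq_abs, abs_of_pos hρ0] at this
    exact lt_irrefl _ this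
  have hpN : ∀ (f' : ℂ[X][X]) (χ : MA f' →ₐ[ℂ] ℂ), χ (qm f' X) = p → χ (qm f' (dN p)) = 0 := by
    intro f' χ hχ
    rw [char_eval, dN_eval, hχ, sub_self, zero_mul]
  refine ⟨qm f (dN p - C (C (ρ : ℂ))), wt ρ f h, hsu, ?_, ?_, ?_⟩
  · rw [wv, hpN f χp h1]; simpa using hρ0
  · intro χ hχ hne
    have hv := wr f h χ hχ
    have hz : χ (qm f X) ≠ p := by
      intro hz
      apply hne
      apply char_ext
      · rw [hz, h1]
      · rw [real_iff] at hχ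
        rw [hχ, h2, hz]
    have hpos : 0 < ‖χ (qm f X) - p‖ ^ 2 := by
      have := norm_pos_iff.2 (sub_ne_zero.2 hz); positivity
    have := hρχ χ (by rw [hv]; exact_mod_cast hpos.ne')
    rw [hv, Complex.norm_real, Real.norm_eq_abs, abs_of_pos hpos] at this
    rw [wv, hv, Complex.sub_re, Complex.ofReal_re, Complex.ofReal_re]
    linarith
  · -- the family
    let tt : C(ℝ × ℝ × ℝ, ℂ) := ⟨fun θ => (θ.1 : ℂ), by fun_prop⟩
    let ss : C(ℝ × ℝ × ℝ, ℂ) := ⟨fun θ => (θ.2.1 : ℂ), by fun_prop⟩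
    let uu : C(ℝ × ℝ × ℝ, ℂ) := ⟨fun θ => ((ρ + θ.2.2 : ℝ) : ℂ), by fun_prop⟩
    let F : C(ℝ × ℝ × ℝ, ℂ)[X][X] := bc _ f + (C (C tt) * bc _ q1 + C (C ss) * bc _ q2)
    have speC : ∀ (θ : ℝ × ℝ × ℝ) (a : C(ℝ × ℝ × ℝ, ℂ)), spe θ (C (C a)) = C (C (a θ)) := by
      intro θ a; simp [spe, evT_apply]
    have hFθ : ∀ θ : ℝ × ℝ × ℝ, spe θ F = pert f q1 q2 θ.1 θ.2.1 := by
      intro θ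
      simp only [F, map_add, map_mul, spe_bc, speC, pert]
      rfl
    have hLL : ∀ {q : ℂ[X][X]} (a : C(ℝ × ℝ × ℝ, ℂ)), q ∈ L ℂ m m → C (C a) * bc _ q ∈ L C(ℝ × ℝ × ℝ, ℂ) m m := by
      intro q a hq i j hij
      rw [cf, coeff_C_mul, coeff_C_mul]
      have := bc_L (R := C(ℝ × ℝ × ℝ, ℂ)) hq i j hij
      rw [cf] at this
      rw [this, mul_zero]
    have hF : Good m F := good_add (good_bc h.good) (Submodule.add_mem _ (hLL _ hq1) (hLL _ hq2))
    have hD : ∀ t s : ℝ, Dat m (pert f q1 q2 t s) x := by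
      intro t s
      refine dat_add h (Submodule.add_mem _ (L_CC _ hq1) (L_CC _ hq2)) ?_
      simp only [map_add, map_mul, st_CC, Complex.conj_ofReal, hs1, hs2]
    have hθ : ∀ θ : ℝ × ℝ × ℝ, Dat m (spe θ F) x := fun θ => by rw [hFθ]; exact hD _ _
    haveI : ∀ θ : ℝ × ℝ × ℝ, FiniteDimensional ℂ (MA (spe θ F)) := fun θ => (hθ θ).fd
    have n1 := nn_lsc hF hθ 1 (0 : ℝ × ℝ × ℝ)
    have n2 := nn_lsc hF hθ (bc _ (-dN p) + C (C uu)) (0 : ℝ × ℝ × ℝ)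
    obtain ⟨ε, hε, hball⟩ := Metric.eventually_nhds_iff.1 (n1.and n2)
    obtain ⟨t, s, ht, hs, c1, c2, ⟨j, hj, hJ⟩, huniq⟩ := hloc ε hε
    have hfd : FiniteDimensional ℂ (MA (pert f q1 q2 t s)) := (hD t s).fd
    obtain ⟨χ', hχ'⟩ := exists_char c1 c2
    have hχ1 : χ' (qm _ X) = p := by rw [hχ', evalEval_X]
    have hχ2 : χ' (qm _ (C X)) = (starRingEnd ℂ) p := by rw [hχ', evalEval_C]; simp
    have hu : ∀ᶠ u : ℝ in 𝓝[>] 0, (0 < u ∧ u < min ε (r ^ 2 - ρ)) ∧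
        ∀ χ : MA (pert f q1 q2 t s) →ₐ[ℂ] ℂ, χ (qm _ (dN p)) ≠ ((ρ + u : ℝ) : ℂ) := by
      refine Filter.Eventually.and (Ioo_mem_nhdsGT (lt_min hε (by linarith : 0 < r ^ 2 - ρ))) ?_
      rw [eventually_all]
      intro χ
      have hfin : {u : ℝ | χ (qm _ (dN p)) = ((ρ + u : ℝ) : ℂ)}.Subsingleton := by
        intro a ha b hb
        have ha' : χ (qm _ (dN p)) = ((ρ + a : ℝ) : ℂ) := ha
        have hb' : χ (qm _ (dN p)) = ((ρ + b : ℝ) : ℂ) := hb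
        rw [ha'] at hb'
        have : ρ + a = ρ + b := by exact_mod_cast hb'
        linarith
      have : ∀ᶠ u : ℝ in 𝓝[≠] 0, u ∉ {u : ℝ | χ (qm _ (dN p)) = ((ρ + u : ℝ) : ℂ)} := by
        have hh : ({u : ℝ | χ (qm _ (dN p)) = ((ρ + u : ℝ) : ℂ)} \ {0}).Finite :=
          hfin.finite.subset Set.diff_subset
        have h3 : ({u : ℝ | χ (qm _ (dN p)) = ((ρ + u : ℝ) : ℂ)} \ {0})ᶜ ∈ 𝓝 (0 : ℝ) :=
          hh.isClosed.isOpen_compl.mem_nhds (by simp)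
        filter_upwards [mem_nhdsWithin_of_mem_nhds h3, self_mem_nhdsWithin] with u hu1 hu2 hu3
        exact hu1 ⟨hu3, hu2⟩
      exact nhdsWithin_mono _ (fun y (hy : 0 < y) => hy.ne') this
    obtain ⟨u, ⟨hu0, hu1⟩, huχ⟩ := hu.exists
    have huε := lt_of_lt_of_le hu1 (min_le_left _ _)
    have hur := lt_of_lt_of_le hu1 (min_le_right _ _)
    have hb := hball (y := (t, s, u)) (by
      rw [dist_zero_right]
      simp only [Prod.norm_def, Real.norm_eq_abs]
      rw [abs_of_pos hu0]
      simp [ht, hs, huε])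
    -- transfer to concrete polynomials
    have trans : ∀ (f1 f2 : ℂ[X][X]) (h1 : Dat m f1 x) (h2 : Dat m f2 x) (g1 g2 : ℂ[X][X])
        [FiniteDimensional ℂ (MA f1)] [FiniteDimensional ℂ (MA f2)], f1 = f2 → g1 = g2 →
        (inF h1).nn (qm f1 g1) = (inF h2).nn (qm f2 g2) := by
      intro f1 f2 h1 h2 g1 g2 _ _ hf hg
      subst hf; subst hg; rfl
    have hF0 : spe (0 : ℝ × ℝ × ℝ) F = f := by rw [hFθ, pert]; simp
    have hFt : spe ((t, s, u) : ℝ × ℝ × ℝ) F = pert f q1 q2 t s := hFθ _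
    have uu0 : uu (0 : ℝ × ℝ × ℝ) = (ρ : ℂ) := by
      change (((ρ + 0 : ℝ)) : ℂ) = ρ
      simp
    have hW : ∀ θ : ℝ × ℝ × ℝ, spe θ (bc _ (-dN p) + C (C uu)) = -(dN p - C (C (uu θ))) := by
      intro θ; rw [map_add, spe_bc, speC]; ring
    obtain ⟨hb1, hb2⟩ := hb
    rw [trans _ f _ h _ 1 hF0 (map_one _), trans _ _ _ (hD t s) _ 1 hFt (map_one _), map_one, map_one] at hb1
    rw [trans _ f _ h _ _ hF0 (hW 0), trans _ _ _ (hD t s) _ _ hFt (hW _), uu0, map_neg, map_neg] at hb2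
    have uut : uu ((t, s, u) : ℝ × ℝ × ℝ) = ((ρ + u : ℝ) : ℂ) := rfl
    rw [uut] at hb2
    have k1 : (inF (hD t s)).nn 1 + 1 ≤ (inF (hD t s)).nn (qm _ (dN p - C (C ((ρ + u : ℝ) : ℂ)))) := by
      refine simple_case (hD t s) hχ1 hχ2 hj hJ (wt _ _ (hD t s)) ?_ ?_ ?_
      · intro χ
        rw [wv, sub_ne_zero]
        exact huχ χ
      · rw [wv, hpN _ χ' hχ1, zero_sub, Complex.neg_re, Complex.ofReal_re]; linarith
      · intro χ hχ hne
        rw [wv, wr _ (hD t s) χ hχ, Complex.sub_re, Complex.ofReal_re, Complex.ofReal_re]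
        rw [real_iff] at hχ
        have hz : χ (qm _ X) ≠ p := by
          intro hz
          apply hne
          apply char_ext
          · rw [hz, hχ1]
          · rw [hχ, hχ2, hz]
        have q1' : qm (pert f q1 q2 t s) (derivative (pert f q1 q2 t s)) = 0 := qm_eq_zero.2 ⟨1, 0, by ring⟩
        have q2' : qm (pert f q1 q2 t s) (dw (pert f q1 q2 t s)) = 0 := qm_eq_zero.2 ⟨0, 1, by ring⟩
        have hge : r ≤ ‖χ (qm _ X) - p‖ := by
          by_contra hlt
          push Not at hlt
          apply hz
          apply huniq _ _ _ hlt
          · rw [← hχ, ← char_eval, q1', map_zero]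
          · rw [← hχ, ← char_eval, q2', map_zero]
        have : r ^ 2 ≤ ‖χ (qm _ X) - p‖ ^ 2 := by gcongr
        linarith
    have k2 := (inF h).nn_compl (wt ρ f h) (isUnit_of_char hsu)
    have k3 := (inF (hD t s)).nn_compl_le (qm _ (dN p - C (C ((ρ + u : ℝ) : ℂ))))
    have d1 := finrank_MA h.good (by have := h.hm; omega)
    have d2 := finrank_MA (hD t s).good (by have := h.hm; omega)
    omega

end loc
end EC

namespace EC
open Module Polynomial
open Polynomial.Bivariate (swap)
set_option linter.unusedSectionVars false

section clear
open IsLocalization nonZeroDivisors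

lemma sqf_map {K : Type*} [Field K] {g : K[X][X]} (hg : Squarefree g) :
    Squarefree (g.map (algebraMap K[X] (FractionRing K[X]))) := by
  intro h hh
  have hg0 : g ≠ 0 := hg.ne_zero
  have hm0 : g.map (algebraMap K[X] (FractionRing K[X])) ≠ 0 := by
    rwa [Ne, Polynomial.map_eq_zero_iff (IsFractionRing.injective _ _)]
  have h0 : h ≠ 0 := by
    rintro rfl
    rw [zero_mul, zero_dvd_iff] at hh
    exact hm0 hh
  let : NormalizedGCDMonoid K[X] := Nonempty.some inferInstance
  apply isUnit_or_eq_zero_of_isUnit_integerNormalization_primPart (R := K[X]) h0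
  apply hg
  have hp := isPrimitive_primPart (integerNormalization K[X]⁰ h)
  apply (hp.mul hp).dvd_of_fraction_map_dvd_fraction_map (K := FractionRing K[X])
  obtain ⟨b, hb, hb2⟩ := integerNormalization_spec (R := K[X]) K[X]⁰ h
  have d1 : (integerNormalization K[X]⁰ h).primPart.map (algebraMap K[X] (FractionRing K[X])) ∣ h := by
    have e1 : (integerNormalization K[X]⁰ h).primPart.map (algebraMap K[X] (FractionRing K[X])) ∣
        b • h := by
      rw [← hb2]
      exact Polynomial.map_dvd _ (primPart_dvd _)
    have hbu : algebraMap K[X] (FractionRing K[X]) b ≠ 0 := by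
      simpa using nonZeroDivisors.ne_zero hb
    have e2 : h = C ((algebraMap K[X] (FractionRing K[X]) b)⁻¹) * (b • h) := by
      rw [← algebraMap_smul (FractionRing K[X]) b h, ← C_mul', ← mul_assoc, ← C_mul,
        inv_mul_cancel₀ hbu, C_1, one_mul]
    have e3 := e1.mul_left (C ((algebraMap K[X] (FractionRing K[X]) b)⁻¹))
    rwa [← e2] at e3
  rw [Polynomial.map_mul]
  exact (mul_dvd_mul d1 d1).trans hh

lemma clear {K : Type*} [Field K] [CharZero K] {g : K[X][X]} (hg : Squarefree g) :
    ∃ a b : K[X][X], ∃ d : K[X], d ≠ 0 ∧ a * g + b * derivative g = C d := by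
  have hs := PerfectField.separable_iff_squarefree.2 (sqf_map hg)
  obtain ⟨a, b, hab⟩ := hs
  obtain ⟨c1, hc1, e1⟩ := integerNormalization_spec (R := K[X]) K[X]⁰ a
  obtain ⟨c2, hc2, e2⟩ := integerNormalization_spec (R := K[X]) K[X]⁰ b
  refine ⟨C c2 * integerNormalization K[X]⁰ a, C c1 * integerNormalization K[X]⁰ b, c1 * c2,
    mul_ne_zero (nonZeroDivisors.ne_zero hc1) (nonZeroDivisors.ne_zero hc2), ?_⟩
  apply Polynomial.map_injective (algebraMap K[X] (FractionRing K[X])) (IsFractionRing.injective _ _)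
  rw [← algebraMap_smul (FractionRing K[X]), ← C_mul'] at e1 e2
  simp only [Polynomial.map_add, Polynomial.map_mul, Polynomial.map_C, e1, e2, ← derivative_map,
    map_mul]
  linear_combination (C ((algebraMap K[X] (FractionRing K[X])) c1) * C ((algebraMap K[X] (FractionRing K[X])) c2)) * hab
end clear

section sfd
variable {𝕜 : Type*} [RCLike 𝕜]

lemma evalEval_mm (i j : ℕ) (c x y : 𝕜) : (mm i j c).evalEval x y = c * x ^ j * y ^ i := by
  unfold mm
  simp [evalEval]

lemma derivative_mm (i j : ℕ) (c : 𝕜) : derivative (mm i j c) = mm (i - 1) j (c * i) := by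
  unfold mm
  rw [derivative_monomial]
  congr 1
  rw [← C_eq_natCast, mul_comm, C_mul_monomial, mul_comm]

lemma dw_mm (i j : ℕ) (c : 𝕜) : dw (mm i j c) = mm i (j - 1) (c * j) := by
  unfold dw
  rw [swap_mm, derivative_mm, swap_mm]

lemma sfd (f : 𝕜[X][X]) (a : 𝕜 × 𝕜) : HasStrictFDerivAt (fun q : 𝕜 × 𝕜 => f.evalEval q.1 q.2)
    ((dw f).evalEval a.1 a.2 • ContinuousLinearMap.fst 𝕜 𝕜 𝕜 +
      (derivative f).evalEval a.1 a.2 • ContinuousLinearMap.snd 𝕜 𝕜 𝕜) a := by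
  induction f using mm_induction with
  | hadd p q hp hq =>
    have e : (fun r : 𝕜 × 𝕜 => (p + q).evalEval r.1 r.2) = (fun r : 𝕜 × 𝕜 => p.evalEval r.1 r.2) + (fun r : 𝕜 × 𝕜 => q.evalEval r.1 r.2) := by
      funext r; simp
    rw [e]
    refine (hp.add hq).congr_fderiv ?_
    have : dw (p + q) = dw p + dw q := by simp [dw]
    rw [this, derivative_add, evalEval_add, evalEval_add]
    module
  | hmm i j c =>
    have h1 := (hasStrictDerivAt_pow j a.1).comp_hasStrictFDerivAt a (hasStrictFDerivAt_fst (𝕜 := 𝕜) (p := a))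
    have h2 := (hasStrictDerivAt_pow i a.2).comp_hasStrictFDerivAt a (hasStrictFDerivAt_snd (𝕜 := 𝕜) (p := a))
    have h3 := (h1.mul h2).const_mul c
    have e : (fun r : 𝕜 × 𝕜 => (mm i j c).evalEval r.1 r.2) = (fun y : 𝕜 × 𝕜 => c * (y.1 ^ j * y.2 ^ i)) := by
      funext q; simp [evalEval_mm, mul_assoc]
    rw [e]
    refine h3.congr_fderiv ?_
    rw [derivative_mm, dw_mm, evalEval_mm, evalEval_mm]
    simp only [Function.comp]
    module
end sfd

end EC

namespace EC
open Module Polynomial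
open Polynomial.Bivariate (swap)
set_option linter.unusedSectionVars false

section lemL
open Topology Filter

lemma cont2 (f : ℝ[X][X]) : Continuous (fun q : ℝ × ℝ => f.evalEval q.1 q.2) :=
  continuous_iff_continuousAt.2 fun a => (sfd f a).continuousAt

lemma impl (Q : ℝ[X][X]) (x0 y0 : ℝ) (h0 : Q.evalEval x0 y0 = 0)
    (h1 : (derivative Q).evalEval x0 y0 ≠ 0) :
    ∃ φ : ℝ → ℝ, ∃ φ' : ℝ, HasDerivAt φ φ' x0 ∧ φ x0 = y0 ∧ ∀ᶠ x in 𝓝 x0, Q.evalEval x (φ x) = 0 := by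
  have d := sfd Q (x0, y0)
  have hi : ((((dw Q).evalEval x0 y0 • ContinuousLinearMap.fst ℝ ℝ ℝ +
      (derivative Q).evalEval x0 y0 • ContinuousLinearMap.snd ℝ ℝ ℝ)) ∘L .inr ℝ ℝ ℝ).IsInvertible := by
    refine ⟨ContinuousLinearEquiv.unitsEquivAut ℝ (Units.mk0 _ h1), ?_⟩
    ext
    simp
  refine ⟨d.implicitFunctionOfProdDomain hi, _,
    (d.hasStrictFDerivAt_implicitFunctionOfProdDomain hi).hasFDerivAt.hasDerivAt, ?_, ?_⟩
  · exact (d.eventually_apply_eq_iff_implicitFunctionOfProdDomain hi).self_of_nhds.mp rfl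
  · have := d.eventually_apply_implicitFunctionOfProdDomain hi
    simpa [h0] using this

lemma isol (p : ℝ[X]) (hp : p ≠ 0) (a : ℝ) : ∃ η > 0, ∀ x, |x - a| ≤ η → x ≠ a → p.eval x ≠ 0 := by
  have h1 : ((p.roots.toFinset.erase a : Finset ℝ) : Set ℝ)ᶜ ∈ 𝓝 a := by
    apply IsOpen.mem_nhds
    · exact (Finset.finite_toSet _).isClosed.isOpen_compl
    · simp
  obtain ⟨η, hη, hs⟩ := Metric.mem_nhds_iff.1 h1
  refine ⟨η / 2, by positivity, fun x hx hxa h0 => ?_⟩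
  have : x ∈ Metric.ball a η := by
    rw [Metric.mem_ball, Real.dist_eq]; linarith
  have := hs this
  apply this
  simp [hxa, hp, h0]

/-- the move step -/
lemma move (f Q : ℝ[X][X]) (s x0 y0 : ℝ) (hs : s = 1 ∨ s = -1) (h0 : Q.evalEval x0 y0 = 0)
    (h1 : (derivative Q).evalEval x0 y0 ≠ 0) (hfy : (derivative f).evalEval x0 y0 = 0)
    (hfx : s * (dw f).evalEval x0 y0 < 0) :
    ∃ᶠ q : ℝ × ℝ in 𝓝 (x0, y0), Q.evalEval q.1 q.2 = 0 ∧ s * (q.1 - x0) < 0 ∧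
      f.evalEval x0 y0 < f.evalEval q.1 q.2 := by
  obtain ⟨φ, φ', hd, hφ, hev⟩ := impl Q x0 y0 h0 h1
  have hlin : HasDerivAt (fun t : ℝ => x0 - s * t) (-s) 0 := by
    simpa using ((hasDerivAt_id (0:ℝ)).const_mul s).const_sub x0
  have hx00 : x0 - s * 0 = x0 := by ring
  have hc : HasDerivAt (fun t : ℝ => φ (x0 - s * t)) (φ' * (-s)) 0 := by
    have hd' : HasDerivAt φ φ' (x0 - s * 0) := by rwa [hx00]
    exact HasDerivAt.comp (0:ℝ) hd' hlin
  have hpair : HasDerivAt (fun t : ℝ => (x0 - s * t, φ (x0 - s * t))) (-s, φ' * (-s)) 0 := hlin.prodMk hc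
  have e0 : (x0 - s * 0, φ (x0 - s * 0)) = (x0, y0) := by rw [hx00, hφ]
  have hF := (sfd f (x0, y0)).hasFDerivAt
  have hF' : HasFDerivAt (𝕜 := ℝ) (fun q : ℝ × ℝ => f.evalEval q.1 q.2) (((dw f).evalEval x0 y0 • ContinuousLinearMap.fst ℝ ℝ ℝ +
      (derivative f).evalEval x0 y0 • ContinuousLinearMap.snd ℝ ℝ ℝ)) (x0 - s * 0, φ (x0 - s * 0)) := by
    rw [e0]; exact hF
  have hG := HasFDerivAt.comp_hasDerivAt (0:ℝ) hF' hpair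
  have hsl := hasDerivAt_iff_tendsto_slope.1 hG
  have hpos : 0 < (((dw f).evalEval x0 y0 • ContinuousLinearMap.fst ℝ ℝ ℝ +
      (derivative f).evalEval x0 y0 • ContinuousLinearMap.snd ℝ ℝ ℝ)) (-s, φ' * (-s)) := by
    simp [hfy]; linarith
  have ev1 := hsl.eventually (lt_mem_nhds hpos)
  have ev2 : ∀ᶠ t in 𝓝[>] (0:ℝ), 0 < slope ((fun q : ℝ × ℝ => f.evalEval q.1 q.2) ∘ fun t => (x0 - s * t, φ (x0 - s * t))) 0 t :=
    ev1.filter_mono (nhdsWithin_mono _ (fun t ht => ne_of_gt ht))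
  have ev3 : ∀ᶠ t in 𝓝[>] (0:ℝ), Q.evalEval (x0 - s * t) (φ (x0 - s * t)) = 0 := by
    have ht : Tendsto (fun t : ℝ => x0 - s * t) (𝓝 0) (𝓝 x0) := by
      have := hlin.continuousAt.tendsto
      rwa [hx00] at this
    exact (ht.eventually hev).filter_mono nhdsWithin_le_nhds
  have htend : Tendsto (fun t : ℝ => (x0 - s * t, φ (x0 - s * t))) (𝓝[>] 0) (𝓝 (x0, y0)) := by
    have := hpair.continuousAt.tendsto
    rw [e0] at this
    exact this.mono_left nhdsWithin_le_nhds
  refine htend.frequently (Eventually.frequently ?_)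
  filter_upwards [ev2, ev3, self_mem_nhdsWithin] with t ht1 ht2 ht3
  have ht3 : 0 < t := ht3
  refine ⟨ht2, ?_, ?_⟩
  · rcases hs with rfl | rfl <;> simp <;> linarith
  · rw [slope_def_field, div_pos_iff_of_pos_right (by simpa using ht3)] at ht1
    simp only [Function.comp, hx00, hφ, sub_pos] at ht1
    exact ht1

/-- positivity and no critical points in a punctured box -/
def Box (f : ℝ[X][X]) (a b r : ℝ) : Prop :=
  ∀ x y, |x - a| ≤ r → |y - b| ≤ r → (x ≠ a ∨ y ≠ b) → 0 < f.evalEval x y ∧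
    ¬((dw f).evalEval x y = 0 ∧ (derivative f).evalEval x y = 0)

lemma core (f Q : ℝ[X][X]) (s a b r0 : ℝ) (hs : s = 1 ∨ s = -1) (hr0 : 0 < r0) (hbox : Box f a b r0)
    (hf0 : f.evalEval a b = 0) (hQ : Irreducible Q) (hQf : Q ∣ derivative f) :
    ∃ r > 0, ∀ x y, |x - a| < r → |y - b| < r → Q.evalEval x y = 0 → 0 < s * (x - a) →
      0 < s * (dw f).evalEval x y := by
  by_cases hQa : Q.map (evalRingHom a) = 0
  · have : C (X - C a) ∣ Q := by
      rw [C_dvd_iff_dvd_coeff]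
      intro i
      rw [dvd_iff_isRoot]
      have := congrArg (fun p => p.coeff i) hQa
      simpa using this
    obtain ⟨Q2, rfl⟩ := this
    have hu : IsUnit Q2 := by
      refine (hQ.isUnit_or_isUnit rfl).resolve_left ?_
      rw [isUnit_C]
      exact not_isUnit_X_sub_C a
    refine ⟨1, one_pos, fun x y _ _ h0 hx => ?_⟩
    exfalso
    rw [evalEval_mul] at h0
    have h2 : Q2.evalEval x y ≠ 0 := by
      have := hu.map (evalEvalRingHom x y)
      simpa using this.ne_zero
    rcases mul_eq_zero.1 h0 with h | h
    · rw [evalEval_C] at h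
      simp at h
      rw [h] at hx; simp at hx
    · exact h2 h
  obtain ⟨A, B, d, hd, hAB⟩ := clear hQ.squarefree
  obtain ⟨δ0, hδ0, hδ1⟩ := isol _ hQa b
  obtain ⟨η1, hη1, hη1'⟩ := isol d hd a
  have evQ : ∀ y, (Q.map (evalRingHom a)).eval y = Q.evalEval a y := by
    intro y
    rw [eval_map, eval₂_evalRingHom]
  obtain ⟨δ, hδ, hδr, hδ'⟩ : ∃ δ > 0, δ ≤ r0 ∧ ∀ y, |y - b| ≤ δ → y ≠ b → Q.evalEval a y ≠ 0 := by
    refine ⟨min δ0 r0, by positivity, min_le_right _ _, fun y hy hyb => ?_⟩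
    rw [← evQ]
    exact hδ1 y (hy.trans (min_le_left _ _)) hyb
  have hη : ∀ y, Q.evalEval a y ≠ 0 → ∀ᶠ x in 𝓝 a, Q.evalEval x y ≠ 0 := by
    intro y hy
    have hc : Continuous (fun x => Q.evalEval x y) := (cont2 Q).comp (Continuous.prodMk_left y)
    exact hc.continuousAt.eventually_ne hy
  have hb1 := hη (b + δ) (hδ' _ (by simp [abs_of_pos hδ]) (by linarith))
  have hb2 := hη (b - δ) (hδ' _ (by simp [abs_of_pos hδ]) (by linarith))
  obtain ⟨η2, hη2, hη2'⟩ := Metric.eventually_nhds_iff.1 (hb1.and hb2)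
  refine ⟨min (min δ η1) (min η2 r0), by positivity, fun x1 y1 hx1 hy1 hq1 hu1 => ?_⟩
  by_contra hneg
  push Not at hneg
  simp only [lt_min_iff] at hx1 hy1
  have habs : ∀ x, 0 ≤ s * (x - a) → s * (x - a) ≤ s * (x1 - a) → |x - a| ≤ |x1 - a| := by
    intro x h1 h2
    rcases hs with rfl | rfl
    · rw [abs_of_nonneg (by linarith), abs_of_nonneg (by linarith)]; linarith
    · rw [abs_of_nonpos (by linarith), abs_of_nonpos (by linarith)]; linarith
  let S : Set (ℝ × ℝ) := {q | 0 ≤ s * (q.1 - a) ∧ s * (q.1 - a) ≤ s * (x1 - a) ∧ |q.2 - b| ≤ δ ∧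
    Q.evalEval q.1 q.2 = 0 ∧ s * (dw f).evalEval q.1 q.2 ≤ 0}
  have hScl : IsClosed S := by
    refine IsClosed.inter (isClosed_le (f := fun q : ℝ × ℝ => (0:ℝ)) (g := fun q : ℝ × ℝ => s * (q.1 - a)) (by fun_prop) (by fun_prop)) ?_
    refine IsClosed.inter (isClosed_le (f := fun q : ℝ × ℝ => s * (q.1 - a)) (g := fun q : ℝ × ℝ => s * (x1 - a)) (by fun_prop) (by fun_prop)) ?_
    refine IsClosed.inter (isClosed_le (f := fun q : ℝ × ℝ => |q.2 - b|) (g := fun q : ℝ × ℝ => δ) (by fun_prop) (by fun_prop)) ?_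
    refine IsClosed.inter (isClosed_eq (cont2 Q) continuous_const) ?_
    exact isClosed_le (continuous_const.mul (cont2 (dw f))) continuous_const
  have hSc : IsCompact S := by
    refine ((isCompact_closedBall a |x1 - a|).prod (isCompact_closedBall b δ)).of_isClosed_subset hScl ?_
    rintro ⟨x, y⟩ ⟨h1, h2, h3, -⟩
    exact ⟨by simpa [Real.dist_eq] using habs x h1 h2, by simpa [Real.dist_eq] using h3⟩
  have hmem1 : (x1, y1) ∈ S := ⟨hu1.le, le_rfl, hy1.1.1.le, hq1, hneg⟩
  obtain ⟨⟨x, y⟩, ⟨hx1', hx2', hy', hq', hfx'⟩, hmax⟩ := hSc.exists_isMaxOn ⟨_, hmem1⟩ (cont2 f).continuousOn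
  simp only at hx1' hx2' hy' hq' hfx'
  have hx1a : x1 ≠ a := by rintro rfl; simp at hu1
  have hF1 : 0 < f.evalEval x1 y1 := (hbox x1 y1 hx1.2.2.le hy1.2.2.le (Or.inl hx1a)).1
  have hFm : f.evalEval x1 y1 ≤ f.evalEval x y := hmax hmem1
  have hxa : x ≠ a := by
    rintro rfl
    have : y = b := by
      by_contra hyb
      exact hδ' y hy' hyb hq'
    rw [this, hf0] at hFm
    linarith
  have hup : 0 < s * (x - a) := lt_of_le_of_ne hx1' (by
    intro h
    rcases mul_eq_zero.1 h.symm with h | h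
    · rcases hs with rfl | rfl <;> norm_num at h
    · exact hxa (sub_eq_zero.1 h))
  have hax := habs x hx1' hx2'
  have hyd : |y - b| < δ := by
    refine lt_of_le_of_ne hy' (fun h => ?_)
    have h2 := hη2' (y := x) (by rw [Real.dist_eq]; linarith [hx1.2.1])
    rcases abs_eq_abs.1 (h.trans (abs_of_pos hδ).symm) with h | h
    · exact h2.1 (by rw [← h]; simpa using hq')
    · exact h2.2 (by rw [show b - δ = y by linarith]; exact hq')
  have hdx : d.eval x ≠ 0 := hη1' x (by linarith [hx1.1.2]) hxa
  have hQy : (derivative Q).evalEval x y ≠ 0 := by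
    intro h
    have := congrArg (evalEval x y) hAB
    rw [evalEval_add, evalEval_mul, evalEval_mul, h, hq', evalEval_C] at this
    simp at this
    exact hdx this.symm
  have hfy : (derivative f).evalEval x y = 0 := by
    obtain ⟨R, hR⟩ := hQf
    rw [hR, evalEval_mul, hq', zero_mul]
  have hnc := (hbox x y (by linarith [hx1.2.2]) (by linarith) (Or.inl hxa)).2
  have hfx : s * (dw f).evalEval x y < 0 := by
    refine lt_of_le_of_ne hfx' (fun h => hnc ⟨?_, hfy⟩)
    rcases mul_eq_zero.1 h with h | h
    · rcases hs with rfl | rfl <;> norm_num at h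
    · exact h
  have hm := move f Q s x y hs hq' hQy hfy hfx
  have o1 : ∀ᶠ q : ℝ × ℝ in 𝓝 (x, y), 0 < s * (q.1 - a) := by
    have : Continuous (fun q : ℝ × ℝ => s * (q.1 - a)) := by fun_prop
    exact this.continuousAt.eventually (lt_mem_nhds hup)
  have o2 : ∀ᶠ q : ℝ × ℝ in 𝓝 (x, y), |q.2 - b| < δ := by
    have : Continuous (fun q : ℝ × ℝ => |q.2 - b|) := by fun_prop
    exact this.continuousAt.eventually (gt_mem_nhds hyd)
  have o3 : ∀ᶠ q : ℝ × ℝ in 𝓝 (x, y), s * (dw f).evalEval q.1 q.2 < 0 := by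
    have : Continuous (fun q : ℝ × ℝ => s * (dw f).evalEval q.1 q.2) := continuous_const.mul (cont2 (dw f))
    exact this.continuousAt.eventually (gt_mem_nhds hfx)
  obtain ⟨q, ⟨hq0, hq1', hq2⟩, hqa, hqb, hqc⟩ := (hm.and_eventually (o1.and (o2.and o3))).exists
  have hqS : q ∈ S := ⟨hqa.le, by nlinarith, hqb.le, hq0, hqc.le⟩
  have := hmax hqS
  simp only [Set.mem_setOf_eq] at this
  linarith

lemma lemL (f : ℝ[X][X]) (s a b r0 : ℝ) (hs : s = 1 ∨ s = -1) (hr0 : 0 < r0) (hbox : Box f a b r0)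
    (hf0 : f.evalEval a b = 0) :
    ∃ r > 0, ∀ x y, |x - a| < r → |y - b| < r → (derivative f).evalEval x y = 0 → 0 < s * (x - a) →
      0 < s * (dw f).evalEval x y := by
  have hne : derivative f ≠ 0 := by
    intro h
    have h1 := (hbox a (b + r0) (by simp [hr0.le]) (by simp [abs_of_pos hr0]) (Or.inr (by linarith))).1
    have h2 := natDegree_eq_zero_of_derivative_eq_zero h
    rw [eq_C_of_natDegree_eq_zero h2, evalEval_C] at h1 hf0
    linarith
  suffices H : ∀ g : ℝ[X][X], g ∣ derivative f → ∃ r > 0, ∀ x y, |x - a| < r → |y - b| < r →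
      g.evalEval x y = 0 → 0 < s * (x - a) → 0 < s * (dw f).evalEval x y from H _ dvd_rfl
  intro g
  induction g using WfDvdMonoid.induction_on_irreducible with
  | zero => intro h; exact absurd (zero_dvd_iff.1 h) hne
  | unit u hu =>
    intro _
    refine ⟨1, one_pos, fun x y _ _ h0 _ => ?_⟩
    have := hu.map (evalEvalRingHom x y)
    exact absurd h0 (by simpa using this.ne_zero)
  | mul g Q hg hQ ih =>
    intro hd
    obtain ⟨r1, hr1, h1⟩ := ih ((dvd_mul_left _ _).trans hd)
    obtain ⟨r2, hr2, h2⟩ := core f Q s a b r0 hs hr0 hbox hf0 hQ ((dvd_mul_right _ _).trans hd)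
    refine ⟨min r1 r2, by positivity, fun x y hx hy h0 hu => ?_⟩
    rw [lt_min_iff] at hx hy
    rw [evalEval_mul] at h0
    rcases mul_eq_zero.1 h0 with h | h
    · exact h2 x y hx.2 hy.2 h hu
    · exact h1 x y hx.1 hy.1 h hu

end lemL
end EC

namespace EC
open Module Polynomial
open Polynomial.Bivariate (swap)
set_option linter.unusedSectionVars false

section realloc
open Topology Filter

lemma dw_add {S : Type*} [CommRing S] (p q : S[X][X]) : dw (p + q) = dw p + dw q := by simp [dw]

lemma dw_derivative {S : Type*} [CommRing S] (p : S[X][X]) : dw (derivative p) = derivative (dw p) := by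
  apply cf_ext
  intro i j
  rw [cf_dw, cf_derivative, cf_derivative, cf_dw]
  ring

lemma evalEval_swap' {S : Type*} [CommRing S] (p : S[X][X]) (x y : S) : (swap p).evalEval x y = p.evalEval y x := by
  induction p using mm_induction with
  | hadd p q hp hq => rw [map_add, evalEval_add, evalEval_add, hp, hq]
  | hmm i j c =>
    rw [swap_mm]; simp [mm, evalEval]; ring

/-- `t (x-a)^2` -/
noncomputable def sx (a t : ℝ) : ℝ[X][X] := C (C t) * (C X - C (C a)) ^ 2
noncomputable def sy (b t : ℝ) : ℝ[X][X] := C (C t) * (X - C (C b)) ^ 2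

lemma swap_sx (a t : ℝ) : swap (sx a t) = sy a t := by
  unfold sx sy
  simp only [map_mul, map_pow, map_sub, Bivariate.swap_C, Polynomial.map_C, Polynomial.map_X]

lemma swap_sy (a t : ℝ) : swap (sy a t) = sx a t := by
  rw [← swap_sx, swap_swap']

lemma d_sx (a t : ℝ) : derivative (sx a t) = 0 := by
  unfold sx; simp [derivative_pow]

lemma d_sy (a t : ℝ) : derivative (sy a t) = C (C (2 * t)) * (X - C (C a)) := by
  unfold sy
  rw [derivative_C_mul, derivative_pow]
  have : (C (C (2 * t)) : ℝ[X][X]) = 2 * C (C t) := by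
    rw [C_mul, C_mul]; rfl
  rw [this]
  simp
  rw [show (C 2 : ℝ[X][X]) = 2 from rfl]
  ring

lemma dw_sx (a t : ℝ) : dw (sx a t) = C (C (2 * t)) * (C X - C (C a)) := by
  unfold dw
  rw [swap_sx, d_sy]
  simp only [map_mul, map_sub, Bivariate.swap_C, Polynomial.map_C, Bivariate.swap_Y]

lemma dw_sy (a t : ℝ) : dw (sy a t) = 0 := by
  unfold dw; rw [swap_sy, d_sx, map_zero]

lemma lemL' (f : ℝ[X][X]) (a b r0 : ℝ) (hr0 : 0 < r0) (hbox : Box f a b r0)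
    (hf0 : f.evalEval a b = 0) :
    ∃ r > 0, r ≤ r0 ∧ ∀ t ≥ 0, Box (f + sx a t) a b r := by
  obtain ⟨r1, hr1, h1⟩ := lemL f 1 a b r0 (Or.inl rfl) hr0 hbox hf0
  obtain ⟨r2, hr2, h2⟩ := lemL f (-1) a b r0 (Or.inr rfl) hr0 hbox hf0
  refine ⟨min (min (r1 / 2) (r2 / 2)) r0, by positivity, min_le_right _ _, fun t ht x y hx hy hne => ?_⟩
  simp only [le_min_iff] at hx hy
  have hb := hbox x y hx.2 hy.2 hne
  constructor
  · rw [evalEval_add]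
    have : 0 ≤ (sx a t).evalEval x y := by
      simp [sx, evalEval]; positivity
    linarith [hb.1]
  · rw [dw_add, derivative_add, d_sx, dw_sx, add_zero, evalEval_add]
    rintro ⟨e1, e2⟩
    have e3 : evalEval x y (C (C (2 * t)) * (C X - C (C a))) = 2 * t * (x - a) := by
      simp [evalEval]
    rw [e3] at e1
    rcases lt_trichotomy x a with h | h | h
    · have := h2 x y (by linarith [hx.1.2]) (by linarith [hy.1.2]) e2 (by linarith)
      nlinarith
    · subst h
      exact hb.2 ⟨by simpa using e1, e2⟩
    · have := h1 x y (by linarith [hx.1.1]) (by linarith [hy.1.1]) e2 (by linarith)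
      nlinarith

lemma Box.swap {f : ℝ[X][X]} {a b r : ℝ} (h : Box f a b r) : Box (swap f) b a r := by
  intro x y hx hy hne
  have := h y x hy hx hne.symm
  rw [evalEval_swap', dw_swap, evalEval_swap', ← swap_dw, evalEval_swap']
  exact ⟨this.1, fun h => this.2 ⟨h.2, h.1⟩⟩

lemma hess (f : ℝ[X][X]) (a b r0 : ℝ) (hr0 : 0 < r0) (hbox : Box f a b r0)
    (hf0 : f.evalEval a b = 0) : (dw f).evalEval a b = 0 ∧ (derivative f).evalEval a b = 0 ∧
    ∀ v1 v2 : ℝ, 0 ≤ v1 ^ 2 * (dw (dw f)).evalEval a b + 2 * v1 * v2 * (dw (derivative f)).evalEval a b +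
      v2 ^ 2 * (derivative (derivative f)).evalEval a b := by
  have hmin : IsLocalMin (fun q : ℝ × ℝ => f.evalEval q.1 q.2) (a, b) := by
    have : Metric.closedBall (a, b) r0 ∈ 𝓝 (a, b) := Metric.closedBall_mem_nhds _ hr0
    filter_upwards [this] with q hq
    simp only [hf0]
    rw [← closedBall_prod_same] at hq
    simp only [Set.mem_prod, Metric.mem_closedBall, Real.dist_eq] at hq
    by_cases h : q.1 = a ∧ q.2 = b
    · rw [h.1, h.2, hf0]
    · exact (hbox q.1 q.2 hq.1 hq.2 (by tauto)).1.le
  have hd := hmin.hasFDerivAt_eq_zero (sfd f (a, b)).hasFDerivAt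
  have hx : (dw f).evalEval a b = 0 := by simpa using congrArg (fun l => l (1, 0)) hd
  have hy : (derivative f).evalEval a b = 0 := by simpa using congrArg (fun l => l (0, 1)) hd
  refine ⟨hx, hy, fun v1 v2 => ?_⟩
  have gen : ∀ (g : ℝ[X][X]) (τ : ℝ), HasDerivAt (fun τ : ℝ => g.evalEval (a + τ * v1) (b + τ * v2))
      (v1 * (dw g).evalEval (a + τ * v1) (b + τ * v2) + v2 * (derivative g).evalEval (a + τ * v1) (b + τ * v2)) τ := by
    intro g τ
    have hl : HasDerivAt (fun τ : ℝ => (a + τ * v1, b + τ * v2)) (v1, v2) τ := by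
      refine HasDerivAt.prodMk ?_ ?_
      · simpa using ((hasDerivAt_id τ).mul_const v1).const_add a
      · simpa using ((hasDerivAt_id τ).mul_const v2).const_add b
    have := HasFDerivAt.comp_hasDerivAt τ (sfd g (a + τ * v1, b + τ * v2)).hasFDerivAt hl
    simp only [add_apply, smul_apply, ContinuousLinearMap.coe_fst', ContinuousLinearMap.coe_snd', smul_eq_mul] at this
    rw [mul_comm v1, mul_comm v2]
    exact this
  have dh : deriv (fun τ : ℝ => f.evalEval (a + τ * v1) (b + τ * v2)) = fun τ =>
      v1 * (dw f).evalEval (a + τ * v1) (b + τ * v2) + v2 * (derivative f).evalEval (a + τ * v1) (b + τ * v2) := by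
    funext τ; exact (gen f τ).deriv
  have ddh : deriv (deriv (fun τ : ℝ => f.evalEval (a + τ * v1) (b + τ * v2))) 0 =
      v1 ^ 2 * (dw (dw f)).evalEval a b + 2 * v1 * v2 * (dw (derivative f)).evalEval a b +
      v2 ^ 2 * (derivative (derivative f)).evalEval a b := by
    rw [dh]
    have := ((gen (dw f) 0).const_mul v1).add ((gen (derivative f) 0).const_mul v2)
    have := this.deriv
    simp only [zero_mul, add_zero] at this
    rw [dw_derivative] at this ⊢
    refine Eq.trans ?_ (this.trans ?_)
    · rfl
    · ring
  rw [← ddh]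
  by_contra hneg
  push Not at hneg
  have hmax := isLocalMax_of_deriv_deriv_neg hneg (by rw [dh]; simp [hx, hy]) (gen f 0).continuousAt
  have hmin' : IsLocalMin (fun τ : ℝ => f.evalEval (a + τ * v1) (b + τ * v2)) 0 := by
    have ht : Tendsto (fun τ : ℝ => (a + τ * v1, b + τ * v2)) (𝓝 0) (𝓝 (a, b)) := by
      have : Continuous (fun τ : ℝ => (a + τ * v1, b + τ * v2)) := by fun_prop
      have := this.tendsto 0
      simpa using this
    have := ht.eventually hmin
    filter_upwards [this] with τ hτ
    simpa using hτ
  have heq : (fun τ : ℝ => f.evalEval (a + τ * v1) (b + τ * v2)) =ᶠ[𝓝 0] fun _ => f.evalEval (a + 0 * v1) (b + 0 * v2) := by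
    filter_upwards [hmax, hmin'] with τ h1 h2 using le_antisymm h1 h2
  have h1 := heq.deriv.deriv_eq
  simp at h1
  linarith [h1, hneg]

lemma realLoc (f : ℝ[X][X]) (a b r0 : ℝ) (hr0 : 0 < r0) (hbox : Box f a b r0)
    (hf0 : f.evalEval a b = 0) : ∃ r > 0, ∀ ε > 0, ∃ t s : ℝ, |t| < ε ∧ |s| < ε ∧
      (dw (f + sx a t + sy b s)).evalEval a b = 0 ∧ (derivative (f + sx a t + sy b s)).evalEval a b = 0 ∧
      0 < (dw (dw (f + sx a t + sy b s))).evalEval a b * (derivative (derivative (f + sx a t + sy b s))).evalEval a b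
        - (dw (derivative (f + sx a t + sy b s))).evalEval a b ^ 2 ∧
      ∀ x y, |x - a| < r → |y - b| < r → (dw (f + sx a t + sy b s)).evalEval x y = 0 →
        (derivative (f + sx a t + sy b s)).evalEval x y = 0 → x = a ∧ y = b := by
  obtain ⟨r, hr, hrr, hB⟩ := lemL' f a b r0 hr0 hbox hf0
  refine ⟨r, hr, fun ε hε => ?_⟩
  set t := ε / 2 with ht
  have ht0 : 0 < t := by positivity
  have hBt := hB t ht0.le
  have hft0 : (f + sx a t).evalEval a b = 0 := by
    rw [evalEval_add, hf0]; simp [sx, evalEval]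
  obtain ⟨r2, hr2, hr2r, hB2⟩ := lemL' (swap (f + sx a t)) b a r hr hBt.swap (by rw [evalEval_swap']; exact hft0)
  have hB2' : ∀ s ≥ 0, Box (f + sx a t + sy b s) a b r2 := by
    intro s hs
    have := (hB2 s hs).swap
    rwa [map_add, swap_swap', swap_sx] at this
  obtain ⟨h1, h2, h3⟩ := hess f a b r0 hr0 hbox hf0
  let K : Set (ℝ × ℝ) := (Metric.closedBall a r ×ˢ Metric.closedBall b r) \ (Metric.ball a r2 ×ˢ Metric.ball b r2)
  have hK : IsCompact K := by
    refine ((isCompact_closedBall a r).prod (isCompact_closedBall b r)).diff ?_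
    exact Metric.isOpen_ball.prod Metric.isOpen_ball
  obtain ⟨c, hc, hcK⟩ : ∃ c > 0, ∀ q ∈ K, c ≤ |(dw (f + sx a t)).evalEval q.1 q.2| + |(derivative (f + sx a t)).evalEval q.1 q.2| := by
    by_cases hKe : K.Nonempty
    · obtain ⟨q, hq, hqm⟩ := hK.exists_isMinOn hKe (f := fun q : ℝ × ℝ => |(dw (f + sx a t)).evalEval q.1 q.2| + |(derivative (f + sx a t)).evalEval q.1 q.2|)
        (((cont2 _).abs.add (cont2 _).abs).continuousOn)
      refine ⟨_, ?_, fun q' hq' => hqm hq'⟩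
      have hq1 := hq.1
      have hq2 := hq.2
      simp only [Set.mem_prod, Metric.mem_closedBall, Metric.mem_ball, Real.dist_eq] at hq1 hq2
      have hn := (hBt q.1 q.2 hq1.1 hq1.2 (by
        by_contra hcon
        push Not at hcon
        apply hq2
        rw [hcon.1, hcon.2]; simpa using hr2)).2
      by_contra hle
      push Not at hle
      have ha1 := abs_nonneg ((dw (f + sx a t)).evalEval q.1 q.2)
      have ha2 := abs_nonneg ((derivative (f + sx a t)).evalEval q.1 q.2)
      exact hn ⟨abs_eq_zero.1 (by linarith), abs_eq_zero.1 (by linarith)⟩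
    · exact ⟨1, one_pos, fun q hq => absurd ⟨q, hq⟩ hKe⟩
  set s := min (ε / 2) (c / (4 * r)) with hs
  have hs0 : 0 < s := by positivity
  have hsε : s ≤ ε / 2 := min_le_left _ _
  have hsc : s * (4 * r) ≤ c := by
    rw [← le_div_iff₀ (by positivity)]; exact min_le_right _ _
  have edw : dw (f + sx a t + sy b s) = dw (f + sx a t) := by rw [dw_add, dw_sy, add_zero]
  have ed : derivative (f + sx a t + sy b s) = derivative (f + sx a t) + C (C (2 * s)) * (X - C (C b)) := by
    rw [derivative_add, d_sy]
  have edw2 : dw (f + sx a t) = dw f + C (C (2 * t)) * (C X - C (C a)) := by rw [dw_add, dw_sx]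
  have ed2 : derivative (f + sx a t) = derivative f := by rw [derivative_add, d_sx, add_zero]
  have eX : dw (C (C (2 * t)) * (C X - C (C a))) = C (C (2 * t)) := by
    unfold dw
    simp only [map_mul, map_sub, Bivariate.swap_C, Polynomial.map_C, Polynomial.map_X]
    rw [← C_mul, ← C_mul, derivative_C_mul]
    simp [Bivariate.swap_C]
  have eY : derivative (C (C (2 * s)) * (X - C (C b))) = C (C (2 * s)) := by
    simp
  have eYx : dw (C (C (2 * s)) * (X - C (C b))) = 0 := by
    unfold dw
    simp only [map_mul, map_sub, Bivariate.swap_C, Polynomial.map_C, Bivariate.swap_Y]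
    rw [← C_mul, ← C_mul, derivative_C_mul]
    simp
  refine ⟨t, s, by rw [abs_of_pos ht0]; linarith, by rw [abs_of_pos hs0]; linarith, ?_, ?_, ?_, ?_⟩
  · rw [edw, edw2, evalEval_add, h1]; simp [evalEval]
  · rw [ed, ed2, evalEval_add, h2]; simp [evalEval]
  · rw [ed, edw, edw2, ed2, dw_add, dw_add, derivative_add, eX, eY, eYx]
    have c1 : ∀ u : ℝ, evalEval a b (C (C u)) = u := by intro u; simp [evalEval]
    simp only [evalEval_add, c1, evalEval_zero]
    have p1 := h3 1 0
    have p2 := h3 0 1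
    have p3 : ∀ x : ℝ, 0 ≤ (derivative (derivative f)).evalEval a b * (x * x) + (2 * (dw (derivative f)).evalEval a b) * x + (dw (dw f)).evalEval a b := by
      intro x
      have := h3 1 x
      linarith
    have p4 := discrim_le_zero p3
    unfold discrim at p4
    simp only [one_pow, mul_zero, zero_mul, add_zero, one_mul, zero_add, ne_eq, OfNat.ofNat_ne_zero, not_false_eq_true, zero_pow, mul_one] at p1 p2
    have p5 := mul_nonneg p1 hs0.le
    have p6 := mul_nonneg p2 ht0.le
    have p7 := mul_pos ht0 hs0
    nlinarith
  · intro x y hx hy e1 e2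
    by_cases hin : |x - a| < r2 ∧ |y - b| < r2
    · by_contra hne
      exact (hB2' s hs0.le x y hin.1.le hin.2.le (by tauto)).2 ⟨e1, e2⟩
    · exfalso
      have := hcK (x, y) ⟨by simp only [Set.mem_prod, Metric.mem_closedBall, Real.dist_eq]; exact ⟨hx.le, hy.le⟩, by simpa only [Set.mem_prod, Metric.mem_ball, Real.dist_eq] using hin⟩
      rw [edw] at e1
      rw [ed, evalEval_add] at e2
      have e3 : evalEval x y (C (C (2 * s)) * (X - C (C b))) = 2 * s * (y - b) := by simp [evalEval]
      rw [e3] at e2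
      simp only [e1, abs_zero, zero_add] at this
      rw [show (derivative (f + sx a t)).evalEval x y = - (2 * s * (y - b)) by linarith, abs_neg, abs_mul, abs_of_pos (by positivity)] at this
      nlinarith

end realloc
end EC

namespace EC
open Module Polynomial
open Polynomial.Bivariate (swap)
set_option linter.unusedSectionVars false

section rel
open Topology Filter Complex

/-- `g` is `f` in real coordinates -/
def Rel (f : ℂ[X][X]) (g : ℝ[X][X]) : Prop :=
  ∀ x y : ℝ, f.evalEval (x - y * I) (x + y * I) = ((g.evalEval x y : ℝ) : ℂ)

lemma Rel.add {f f' : ℂ[X][X]} {g g' : ℝ[X][X]} (h : Rel f g) (h' : Rel f' g') : Rel (f + f') (g + g') := by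
  intro x y; rw [evalEval_add, evalEval_add, h, h']; push_cast; rfl

lemma relD {f : ℂ[X][X]} {g : ℝ[X][X]} (h : Rel f g) (x y v1 v2 : ℝ) :
    (dw f).evalEval (x - y * I) (x + y * I) * (v1 - v2 * I) + (derivative f).evalEval (x - y * I) (x + y * I) * (v1 + v2 * I)
     = (((dw g).evalEval x y * v1 + (derivative g).evalEval x y * v2 : ℝ) : ℂ) := by
  have hr : HasDerivAt (fun τ : ℝ => (x + τ * v1, y + τ * v2)) (v1, v2) 0 := by
    refine HasDerivAt.prodMk ?_ ?_
    · simpa using ((hasDerivAt_id (0:ℝ)).mul_const v1).const_add x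
    · simpa using ((hasDerivAt_id (0:ℝ)).mul_const v2).const_add y
  have e0 : (x + 0 * v1, y + 0 * v2) = (x, y) := by simp
  have hg : HasFDerivAt (𝕜 := ℝ) (fun q : ℝ × ℝ => g.evalEval q.1 q.2) ((dw g).evalEval x y • ContinuousLinearMap.fst ℝ ℝ ℝ +
      (derivative g).evalEval x y • ContinuousLinearMap.snd ℝ ℝ ℝ) (x + 0 * v1, y + 0 * v2) := by
    rw [e0]; exact (sfd g (x, y)).hasFDerivAt
  have h1 := (HasFDerivAt.comp_hasDerivAt (0:ℝ) hg hr).ofReal_comp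
  have hcx : HasDerivAt (fun τ : ℝ => (((x + τ * v1 : ℝ) : ℂ))) (v1 : ℂ) 0 := by
    have : HasDerivAt (fun τ : ℝ => x + τ * v1) v1 0 := by
      simpa using ((hasDerivAt_id (0:ℝ)).mul_const v1).const_add x
    exact this.ofReal_comp
  have hcy : HasDerivAt (fun τ : ℝ => (((y + τ * v2 : ℝ) : ℂ))) (v2 : ℂ) 0 := by
    have : HasDerivAt (fun τ : ℝ => y + τ * v2) v2 0 := by
      simpa using ((hasDerivAt_id (0:ℝ)).mul_const v2).const_add y
    exact this.ofReal_comp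
  have hc := (hcx.sub (hcy.mul_const I)).prodMk (hcx.add (hcy.mul_const I))
  have hf : HasFDerivAt (𝕜 := ℝ) (fun q : ℂ × ℂ => f.evalEval q.1 q.2)
      (((dw f).evalEval (x - y * I) (x + y * I) • ContinuousLinearMap.fst ℂ ℂ ℂ +
      (derivative f).evalEval (x - y * I) (x + y * I) • ContinuousLinearMap.snd ℂ ℂ ℂ).restrictScalars ℝ)
      (((x + 0 * v1 : ℝ) : ℂ) - ((y + 0 * v2 : ℝ) : ℂ) * I, ((x + 0 * v1 : ℝ) : ℂ) + ((y + 0 * v2 : ℝ) : ℂ) * I) := by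
    have : (((x + 0 * v1 : ℝ) : ℂ) - ((y + 0 * v2 : ℝ) : ℂ) * I, ((x + 0 * v1 : ℝ) : ℂ) + ((y + 0 * v2 : ℝ) : ℂ) * I) = ((x : ℂ) - y * I, (x : ℂ) + y * I) := by simp
    rw [this]
    exact ((sfd f ((x : ℂ) - y * I, (x : ℂ) + y * I)).hasFDerivAt).restrictScalars ℝ
  have h2 := HasFDerivAt.comp_hasDerivAt (0:ℝ) hf hc
  have heq : ((fun q : ℂ × ℂ => f.evalEval q.1 q.2) ∘ fun τ : ℝ => (((x + τ * v1 : ℝ) : ℂ) - ((y + τ * v2 : ℝ) : ℂ) * I, ((x + τ * v1 : ℝ) : ℂ) + ((y + τ * v2 : ℝ) : ℂ) * I))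
     = fun τ : ℝ => ((((fun q : ℝ × ℝ => g.evalEval q.1 q.2) ∘ fun τ : ℝ => (x + τ * v1, y + τ * v2)) τ : ℝ) : ℂ) := by
    funext τ
    exact h _ _
  have h3 := h2
  change HasDerivAt ((fun q : ℂ × ℂ => f.evalEval q.1 q.2) ∘ fun τ : ℝ => (((x + τ * v1 : ℝ) : ℂ) - ((y + τ * v2 : ℝ) : ℂ) * I, ((x + τ * v1 : ℝ) : ℂ) + ((y + τ * v2 : ℝ) : ℂ) * I)) _ _ at h3
  rw [heq] at h3
  have := h3.unique h1
  simpa using this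

lemma Rel.dx {f : ℂ[X][X]} {g : ℝ[X][X]} (h : Rel f g) : Rel (derivative f + dw f) (dw g) := by
  intro x y
  have := relD h x y 1 0
  rw [evalEval_add]
  simp at this
  rw [← this]; ring

lemma Rel.dy {f : ℂ[X][X]} {g : ℝ[X][X]} (h : Rel f g) :
    Rel (C (C I) * (derivative f - dw f)) (derivative g) := by
  intro x y
  have := relD h x y 0 1
  rw [evalEval_mul, evalEval_sub, evalEval_C, eval_C]
  simp at this
  rw [← this]; ring

lemma evalEval_st (p : ℂ[X][X]) (w z : ℂ) :
    (st p).evalEval w z = (starRingEnd ℂ) (p.evalEval ((starRingEnd ℂ) z) ((starRingEnd ℂ) w)) := by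
  induction p using mm_induction with
  | hadd p q hp hq => rw [map_add, evalEval_add, evalEval_add, hp, hq, map_add]
  | hmm i j c =>
    rw [mm_eq, map_mul, map_pow, st_X, C_mul, C_pow, map_mul, map_pow, st_CX, st_CC]
    simp [evalEval]

lemma exists_rel2 (f : ℂ[X][X]) : ∃ g h : ℝ[X][X], ∀ x y : ℝ,
    f.evalEval (x - y * I) (x + y * I) = ((g.evalEval x y : ℝ) : ℂ) + ((h.evalEval x y : ℝ) : ℂ) * I := by
  have hmul : ∀ f f' : ℂ[X][X], (∃ g h : ℝ[X][X], ∀ x y : ℝ,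
    f.evalEval (x - y * I) (x + y * I) = ((g.evalEval x y : ℝ) : ℂ) + ((h.evalEval x y : ℝ) : ℂ) * I) →
    (∃ g h : ℝ[X][X], ∀ x y : ℝ,
    f'.evalEval (x - y * I) (x + y * I) = ((g.evalEval x y : ℝ) : ℂ) + ((h.evalEval x y : ℝ) : ℂ) * I) →
    (∃ g h : ℝ[X][X], ∀ x y : ℝ,
    (f * f').evalEval (x - y * I) (x + y * I) = ((g.evalEval x y : ℝ) : ℂ) + ((h.evalEval x y : ℝ) : ℂ) * I) := by
    rintro f f' ⟨g, h, H⟩ ⟨g', h', H'⟩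
    refine ⟨g * g' - h * h', g * h' + h * g', fun x y => ?_⟩
    rw [evalEval_mul, H, H', evalEval_sub, evalEval_add, evalEval_mul, evalEval_mul, evalEval_mul, evalEval_mul]
    push_cast
    linear_combination (((h.evalEval x y : ℝ) : ℂ) * ((h'.evalEval x y : ℝ) : ℂ)) * I_sq
  have hpow : ∀ (f : ℂ[X][X]) (n : ℕ), (∃ g h : ℝ[X][X], ∀ x y : ℝ,
    f.evalEval (x - y * I) (x + y * I) = ((g.evalEval x y : ℝ) : ℂ) + ((h.evalEval x y : ℝ) : ℂ) * I) →
    (∃ g h : ℝ[X][X], ∀ x y : ℝ,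
    (f ^ n).evalEval (x - y * I) (x + y * I) = ((g.evalEval x y : ℝ) : ℂ) + ((h.evalEval x y : ℝ) : ℂ) * I) := by
    intro f n hf
    induction n with
    | zero => exact ⟨1, 0, fun x y => by simp⟩
    | succ n ih => rw [pow_succ]; exact hmul _ _ ih hf
  induction f using mm_induction with
  | hadd p q hp hq =>
    obtain ⟨g, h, H⟩ := hp
    obtain ⟨g', h', H'⟩ := hq
    refine ⟨g + g', h + h', fun x y => ?_⟩
    rw [evalEval_add, H, H', evalEval_add, evalEval_add]
    push_cast; ring
  | hmm i j c =>
    rw [mm_eq, C_mul, C_pow]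
    refine hmul _ _ (hmul _ _ ?_ (hpow _ _ ?_)) (hpow _ _ ?_)
    · refine ⟨C (C c.re), C (C c.im), fun x y => ?_⟩
      simp [evalEval]
    · refine ⟨C X, -X, fun x y => ?_⟩
      simp [evalEval]; ring
    · refine ⟨C X, X, fun x y => ?_⟩
      simp [evalEval]

lemma exists_rel {f : ℂ[X][X]} (hf : st f = f) : ∃ g, Rel f g := by
  obtain ⟨g, h, H⟩ := exists_rel2 f
  refine ⟨g, fun x y => ?_⟩
  have h1 := evalEval_st f (x - y * I) (x + y * I)
  have h2 : (starRingEnd ℂ) ((x:ℂ) + y * I) = x - y * I := by simp [sub_eq_add_neg]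
  have h3 : (starRingEnd ℂ) ((x:ℂ) - y * I) = x + y * I := by simp
  rw [hf, h2, h3, H] at h1
  have h4 : h.evalEval x y = 0 := by
    have := congrArg Complex.im h1
    simp at this
    linarith
  rw [H, h4]; simp

noncomputable def qq1 (a : ℝ) : ℂ[X][X] := (C (C (1 / 2)) * (X + C X) - C (C (a : ℂ))) ^ 2
noncomputable def qq2 (b : ℝ) : ℂ[X][X] := (C (C (- I / 2)) * (X - C X) - C (C (b : ℂ))) ^ 2

lemma st_qq1 (a : ℝ) : st (qq1 a) = qq1 a := by
  unfold qq1
  rw [map_pow, map_sub, map_mul, map_add, st_X, st_CX, st_CC, st_CC]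
  have : (starRingEnd ℂ) (1 / 2) = 1 / 2 := by rw [map_div₀, map_one, map_ofNat]
  rw [this, conj_ofReal, add_comm]

lemma st_qq2 (a : ℝ) : st (qq2 a) = qq2 a := by
  unfold qq2
  rw [map_pow, map_sub, map_mul, map_sub, st_X, st_CX, st_CC, st_CC]
  have : (starRingEnd ℂ) (-I / 2) = - (-I / 2) := by
    rw [map_div₀, map_ofNat, map_neg, conj_I]; ring
  rw [this, C_neg, C_neg, conj_ofReal]
  ring

lemma L_qq1 (a : ℝ) : qq1 a ∈ L ℂ 3 3 := by
  unfold qq1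
  have : C (C (1 / 2)) * (X + C X) - C (C (a : ℂ)) ∈ L ℂ 2 2 := by
    refine Submodule.sub_mem _ (L_CC _ (Submodule.add_mem _ ?_ ?_)) ?_
    · have : (X : ℂ[X][X]) = mm 1 0 1 := by rw [mm_eq]; simp
      rw [this]; exact L_mm _ (by norm_num) (by norm_num)
    · have : (C X : ℂ[X][X]) = mm 0 1 1 := by rw [mm_eq]; simp
      rw [this]; exact L_mm _ (by norm_num) (by norm_num)
    · have : (C (C (a:ℂ)) : ℂ[X][X]) = mm 0 0 (a:ℂ) := by rw [mm_eq]; simp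
      rw [this]; exact L_mm _ (by norm_num) (by norm_num)
  rw [pow_two]
  exact L_mul this this (by norm_num) (by norm_num)

lemma L_qq2 (a : ℝ) : qq2 a ∈ L ℂ 3 3 := by
  unfold qq2
  have : C (C (-I / 2)) * (X - C X) - C (C (a : ℂ)) ∈ L ℂ 2 2 := by
    refine Submodule.sub_mem _ (L_CC _ (Submodule.sub_mem _ ?_ ?_)) ?_
    · have : (X : ℂ[X][X]) = mm 1 0 1 := by rw [mm_eq]; simp
      rw [this]; exact L_mm _ (by norm_num) (by norm_num)
    · have : (C X : ℂ[X][X]) = mm 0 1 1 := by rw [mm_eq]; simp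
      rw [this]; exact L_mm _ (by norm_num) (by norm_num)
    · have : (C (C (a:ℂ)) : ℂ[X][X]) = mm 0 0 (a:ℂ) := by rw [mm_eq]; simp
      rw [this]; exact L_mm _ (by norm_num) (by norm_num)
  rw [pow_two]
  exact L_mul this this (by norm_num) (by norm_num)

lemma rel_qq1 (a t : ℝ) : Rel (C (C (t : ℂ)) * qq1 a) (sx a t) := by
  intro x y
  simp [qq1, sx, evalEval]
  left
  ring

lemma rel_qq2 (a t : ℝ) : Rel (C (C (t : ℂ)) * qq2 a) (sy a t) := by
  intro x y
  simp [qq2, sy, evalEval]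
  left
  have : -I / 2 * ((y:ℂ) * I + y * I) - a = y - a := by linear_combination (-y : ℂ) * I_sq
  rw [this]

lemma rel_crit {f : ℂ[X][X]} {g : ℝ[X][X]} (h : Rel f g) (z : ℂ) :
    ((derivative f).evalEval ((starRingEnd ℂ) z) z = 0 ∧ (dw f).evalEval ((starRingEnd ℂ) z) z = 0) ↔
    ((dw g).evalEval z.re z.im = 0 ∧ (derivative g).evalEval z.re z.im = 0) := by
  have hz : (z.re : ℂ) + z.im * I = z := Complex.re_add_im z
  have hz' : (z.re : ℂ) - z.im * I = (starRingEnd ℂ) z := by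
    apply Complex.ext <;> simp
  have h1 := h.dx z.re z.im
  have h2 := h.dy z.re z.im
  rw [hz, hz'] at h1 h2
  rw [evalEval_add] at h1
  rw [evalEval_mul, evalEval_sub, evalEval_C, eval_C] at h2
  constructor
  · rintro ⟨e1, e2⟩
    rw [e1, e2] at h1 h2
    constructor
    · exact_mod_cast (by simpa using h1.symm)
    · exact_mod_cast (by simpa using h2.symm)
  · rintro ⟨e1, e2⟩
    rw [e1] at h1
    rw [e2] at h2
    simp at h1 h2
    constructor
    · linear_combination (1/2) * h1 + (1/2) * h2
    · linear_combination (1/2) * h1 - (1/2) * h2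

lemma loc_of_box {f : ℂ[X][X]} {g : ℝ[X][X]} (h : Rel f g) {r0 : ℝ} {p : ℂ} (hr0 : 0 < r0)
    (hbox : Box g p.re p.im r0) (hg0 : g.evalEval p.re p.im = 0) : Loc f (qq1 p.re) (qq2 p.im) p := by
  obtain ⟨r, hr, H⟩ := realLoc g p.re p.im r0 hr0 hbox hg0
  refine ⟨r, hr, fun ε hε => ?_⟩
  obtain ⟨t, s, ht, hs, h1, h2, h3, h4⟩ := H ε hε
  have hrel : Rel (pert f (qq1 p.re) (qq2 p.im) t s) (g + sx p.re t + sy p.im s) := by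
    rw [add_assoc]
    exact h.add ((rel_qq1 _ _).add (rel_qq2 _ _))
  set F := pert f (qq1 p.re) (qq2 p.im) t s
  set G := g + sx p.re t + sy p.im s
  have hc := (rel_crit hrel p).2 ⟨h1, h2⟩
  refine ⟨t, s, ht, hs, hc.1, hc.2, ?_, ?_⟩
  · have hz : (p.re : ℂ) + p.im * I = p := Complex.re_add_im p
    have hz' : (p.re : ℂ) - p.im * I = (starRingEnd ℂ) p := by
      apply Complex.ext <;> simp
    have a1 := hrel.dx.dx p.re p.im
    have a2 := hrel.dy.dy p.re p.im
    have a3 := hrel.dy.dx p.re p.im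
    rw [hz, hz'] at a1 a2 a3
    have dwC : ∀ q : ℂ[X][X], dw (C (C I) * q) = C (C I) * dw q := by
      intro q
      apply cf_ext; intro i j
      rw [cf_dw]
      simp [cf, coeff_dw, coeff_derivative]
      ring
    have dwsub : ∀ q q' : ℂ[X][X], dw (q - q') = dw q - dw q' := by intro q q'; simp [dw]
    simp only [derivative_add, dw_add, derivative_C_mul, dwC, derivative_sub, dwsub, dw_derivative, evalEval_add, evalEval_mul, evalEval_sub, evalEval_C, eval_C] at a1 a2 a3
    refine ⟨-((dw (dw G)).evalEval p.re p.im * (derivative (derivative G)).evalEval p.re p.im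
        - (dw (derivative G)).evalEval p.re p.im ^ 2) / 4, by linarith, ?_⟩
    push_cast
    rw [dw_derivative, ← a1, ← a2, ← a3]
    simp only [Jac, evalEval_sub, evalEval_mul, dw_derivative]
    have hI := I_sq
    generalize evalEval ((starRingEnd ℂ) p) p (derivative (derivative F)) = A
    generalize evalEval ((starRingEnd ℂ) p) p (dw (dw F)) = B
    generalize evalEval ((starRingEnd ℂ) p) p (derivative (dw F)) = M
    linear_combination ((A + B + 2 * M) * (A + B - 2 * M) / 4 - (A - B) ^ 2 / 4) * hI
  · intro z e1 e2 hz
    have := (rel_crit hrel z).1 ⟨e1, e2⟩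
    have hzr : |z.re - p.re| < r := lt_of_le_of_lt (by simpa using Complex.abs_re_le_norm (z - p)) hz
    have hzi : |z.im - p.im| < r := lt_of_le_of_lt (by simpa using Complex.abs_im_le_norm (z - p)) hz
    have := h4 z.re z.im hzr hzi this.1 this.2
    exact Complex.ext this.1 this.2

end rel
end EC

namespace EC
open Module Polynomial
open Polynomial.Bivariate (swap)
set_option linter.unusedSectionVars false

section main
open Topology Filter Complex
variable {m : ℕ} {f : ℂ[X][X]} {x : ℕ → ℂ}

lemma tf_f_mm1 (h : Dat m f x) {i j : ℕ} (hi : i + 2 < m) (hj : j + 1 < m) (c : ℂ) :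
    tf ℂ m x (mm i j c * f) = 0 := by
  have hm := h.hm
  have hL : mm i j c * f ∈ L ℂ (2 * m - 2) (2 * m - 1) :=
    L_mul (L_mm (a := m - 2) (b := m - 1) c (by omega) (by omega)) h.good.inL (by omega) (by omega)
  have e1 : (swap (mm i j c * f)).coeff (2 * m - 2) =
      if j = m - 2 then c • (X ^ i * ((swap f).coeff m)) else 0 := by
    rw [map_mul, swap_mm, coeff_mm_mul, if_pos (by omega)]
    split_ifs with hjm
    · rw [show 2 * m - 2 - j = m by omega]
    · rw [coeff_eq_zero_of_L (L_swap h.good.inL) (by omega)]; simp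
  rw [tf_of_L hL, e1]
  split_ifs
  · rw [map_smul, h.bord.h1 i (by omega), smul_zero]
  · simp

lemma tf_f_mm (h : Dat m f x) {i j : ℕ} (hi : i + 1 < m) (hj : j + 1 < m) (hij : i + 2 < m ∨ j + 2 < m) (c : ℂ) :
    tf ℂ m x (mm i j c * f) = 0 := by
  rcases hij with hij | hij
  · exact tf_f_mm1 h hij hj c
  · have := tf_f_mm1 h hij hi ((starRingEnd ℂ) c)
    have e : mm j i ((starRingEnd ℂ) c) * f = st (mm i j c * f) := by
      rw [map_mul, h.star]
      congr 1
      apply cf_ext; intro i' j'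
      rw [cf_st, cf_mm, cf_mm]
      split_ifs with h1 h2 h2
      · rfl
      · tauto
      · tauto
      · simp
    rw [e, tf_st h.bord.real] at this
    simpa using this

lemma tf_f (h : Dat m f x) {p : ℂ[X][X]} (hp : p ∈ L ℂ (m - 1) (m - 1)) (h0 : cf p (m - 2) (m - 2) = 0) :
    tf ℂ m x (p * f) = 0 := by
  have hm := h.hm
  rw [L_sum hp, Finset.sum_mul, map_sum]
  apply Finset.sum_eq_zero
  rintro ⟨⟨i, hi⟩, ⟨j, hj⟩⟩ _
  by_cases hij : i = m - 2 ∧ j = m - 2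
  · obtain ⟨rfl, rfl⟩ := hij
    simp only [h0]
    simp [mm]
  · have h3 : i + 2 < m ∨ j + 2 < m := by omega
    exact tf_f_mm h (i := i) (j := j) (by omega) (by omega) h3 _

lemma nn_one_ge (h : Dat m f x) [FiniteDimensional ℂ (MA f)] : m * (m - 1) ≤ (inF h).nn 1 := by
  have hm := h.hm
  set T := (qm f).toLinearMap.domRestrict (L ℂ m (m - 1)) with hT
  have hinj : Function.Injective T := by
    rintro ⟨p, hp⟩ ⟨q, hq⟩ hpq
    have h0 : qm f (p - q) = 0 := by rw [map_sub]; exact sub_eq_zero.2 hpq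
    exact Subtype.ext (sub_eq_zero.1 (qm_inj_W h.good (by omega) (Submodule.sub_mem _ hp hq) h0))
  have h1 : finrank ℂ (LinearMap.range T) = m * (m - 1) := by
    rw [LinearMap.finrank_range_of_inj hinj, finrank_L]
  rw [← h1]
  refine isotropic_le ((inF h).form_herm (map_one _)) ((inF h).form_nondeg isUnit_one) ?_
  rintro _ ⟨⟨p, hp⟩, rfl⟩
  rw [InvF.form_apply, one_mul]
  have e : T ⟨p, hp⟩ * (inF h).σ (T ⟨p, hp⟩) = qm f (p * st p) := by
    rw [map_mul, ← sg_qm h.star p]; rfl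
  have hL : p * st p ∈ L ℂ (2 * m - 2) (2 * m - 2) := L_mul hp (L_st hp) (by omega) (by omega)
  rw [e]
  change (phi h _).re = 0
  rw [phi_qm h (L_mono (by omega) (by omega) hL), tf_box0 hL]; rfl

noncomputable def cfl (a b i j : ℕ) : L ℂ a b →ₗ[ℂ] ℂ where
  toFun p := cf (p : ℂ[X][X]) i j
  map_add' := by intro p q; simp [cf_add]
  map_smul' := by intro c p; simp [cf_smul]

lemma nn_f_le {k : ℕ} (hk : 2 ≤ k) (h : Dat (2 * k) f x) [FiniteDimensional ℂ (MA f)] (ε : ℂ) :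
    (inF h).nn (qm f (f - C (C ε))) + (k * k - 1) ≤ finrank ℂ (MA f) := by
  set T := (qm f).toLinearMap.domRestrict (L ℂ k k) with hT
  have hinj : Function.Injective T := by
    rintro ⟨p, hp⟩ ⟨q, hq⟩ hpq
    have h0 : qm f (p - q) = 0 := by rw [map_sub]; exact sub_eq_zero.2 hpq
    exact Subtype.ext (sub_eq_zero.1 (qm_inj_W h.good (by omega)
      (L_mono (by omega) (by omega) (Submodule.sub_mem _ hp hq)) h0))
  set K := LinearMap.ker (cfl k k (k-1) (k-1)) with hK
  have hfin : FiniteDimensional ℂ (L ℂ k k) := FiniteDimensional.of_injective T hinj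
  have hKd : k * k - 1 ≤ finrank ℂ K := by
    have := LinearMap.finrank_range_add_finrank_ker (K := ℂ) (V := L ℂ k k) (V₂ := ℂ) (cfl k k (k-1) (k-1))
    rw [finrank_L] at this
    have h2 : finrank ℂ (LinearMap.range (cfl k k (k-1) (k-1))) ≤ 1 := by
      have := Submodule.finrank_le (LinearMap.range (cfl k k (k-1) (k-1)))
      simpa using this
    have h5 := this.ge.trans (Nat.add_le_add_right h2 _)
    exact Nat.sub_le_iff_le_add'.2 h5
  have h1 : finrank ℂ (K.map T) = finrank ℂ K :=
    ((Submodule.equivMapOfInjective T hinj K).finrank_eq).symm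
  have h3 : NonnegOn ((inF h).form (qm f (f - C (C ε)))) (K.map T) := by
    rintro _ ⟨⟨p, hp⟩, hpK, rfl⟩
    have hp0 : cf p (k-1) (k-1) = 0 := hpK
    rw [InvF.form_apply]
    have e : qm f (f - C (C ε)) * (T ⟨p, hp⟩ * (inF h).σ (T ⟨p, hp⟩)) = qm f ((p * st p) * f - C (C ε) * (p * st p)) := by
      have e1 : qm f (p * st p) = T ⟨p, hp⟩ * (inF h).σ (T ⟨p, hp⟩) := by
        rw [map_mul, ← sg_qm h.star p]; rfl
      rw [← e1, ← map_mul]; congr 1; ring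
    have hL : p * st p ∈ L ℂ (2 * k - 1) (2 * k - 1) := L_mul hp (L_st hp) (by omega) (by omega)
    have hc : cf (p * st p) (2 * k - 2) (2 * k - 2) = 0 := by
      rw [cf_mul]
      apply Finset.sum_eq_zero
      rintro ⟨i, i'⟩ hi
      apply Finset.sum_eq_zero
      rintro ⟨j, j'⟩ hj
      rw [Finset.HasAntidiagonal.mem_antidiagonal] at hi hj
      simp only at hi hj ⊢
      rw [cf_st]
      by_cases h1 : i < k ∧ j < k ∧ i' < k ∧ j' < k
      · obtain ⟨rfl, rfl⟩ : i = k - 1 ∧ j = k - 1 := by omega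
        rw [hp0, zero_mul]
      · by_cases h2 : k ≤ i ∨ k ≤ j
        · rw [hp _ _ h2, zero_mul]
        · rw [hp j' i' (by omega)]; simp
    have h4 : (p * st p) * f ∈ L ℂ (2 * (2 * k) - 1) (2 * (2 * k) - 1) :=
      L_mul hL h.good.inL (by omega) (by omega)
    have h5 : C (C ε) * (p * st p) ∈ L ℂ (2 * (2 * k) - 2) (2 * (2 * k) - 2) :=
      L_CC ε (L_mono (by omega) (by omega) hL)
    rw [e]
    change 0 ≤ (phi h _).re
    rw [phi_qm h (Submodule.sub_mem _ h4 (L_mono (by omega) (by omega) h5)), map_sub, tf_box0 h5, tf_f h hL hc]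
    simp
  have := nind_add_nonneg h3
  unfold InvF.nn
  omega

lemma crit_of_min {g : ℝ[X][X]} (hg : ∀ x y, 0 ≤ g.evalEval x y) {a b : ℝ} (h0 : g.evalEval a b = 0) :
    (dw g).evalEval a b = 0 ∧ (derivative g).evalEval a b = 0 := by
  have h1 := (sfd g (a, b)).hasFDerivAt
  have h2 : IsLocalMin (fun q : ℝ × ℝ => g.evalEval q.1 q.2) (a, b) := by
    apply Eventually.of_forall
    rintro ⟨x, y⟩
    simp only [h0]; exact hg x y
  have h3 := h2.hasFDerivAt_eq_zero h1
  constructor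
  · have := congrArg (fun l => l ((1:ℝ), (0:ℝ))) h3
    simpa using this
  · have := congrArg (fun l => l ((0:ℝ), (1:ℝ))) h3
    simpa using this

theorem chart_bound {k : ℕ} (hk : 2 ≤ k) (hg : Good (2 * k) f) (hst : st f = f)
    (hnn : ∀ z : ℂ, 0 ≤ (f.evalEval ((starRingEnd ℂ) z) z).re) (Z : Finset ℂ)
    (hZi : ∀ z, f.evalEval ((starRingEnd ℂ) z) z = 0 ↔ z ∈ Z) : Z.card ≤ 3 * k ^ 2 - 2 * k + 2 := by
  classical
  have hZ : ∀ z ∈ Z, f.evalEval ((starRingEnd ℂ) z) z = 0 := fun z hz => (hZi z).2 hz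
  obtain ⟨x, hx⟩ := exists_bord (m := 2 * k) (by omega) hg.swap.monic hg.swap.natDegree hg.cop'
  have h : Dat (2 * k) f x := ⟨by omega, hg, hst, hx⟩
  haveI := h.fd
  obtain ⟨g, hrel⟩ := exists_rel hst
  have hFg : ∀ z : ℂ, f.evalEval ((starRingEnd ℂ) z) z = (g.evalEval z.re z.im : ℝ) := by
    intro z
    have := hrel z.re z.im
    have e1 : (z.re : ℂ) + z.im * I = z := Complex.re_add_im z
    have e2 : (z.re : ℂ) - z.im * I = (starRingEnd ℂ) z := by apply Complex.ext <;> simp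
    rwa [e1, e2] at this
  have hg0 : ∀ a b, 0 ≤ g.evalEval a b := by
    intro a b
    have := hnn ⟨a, b⟩
    rw [hFg] at this
    simpa using this
  -- characters at critical points
  have hchar : ∀ z : ℂ, ((dw g).evalEval z.re z.im = 0 ∧ (derivative g).evalEval z.re z.im = 0) →
      ∃ χ : MA f →ₐ[ℂ] ℂ, χ (qm f X) = z ∧ χ (qm f (C X)) = (starRingEnd ℂ) z := by
    intro z hz
    obtain ⟨h1, h2⟩ := (rel_crit hrel z).2 hz
    obtain ⟨χ, hχ⟩ := exists_char h1 h2
    exact ⟨χ, by rw [hχ, evalEval_X], by rw [hχ, evalEval_C, eval_X]⟩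
  have hcf : {z : ℂ | (dw g).evalEval z.re z.im = 0 ∧ (derivative g).evalEval z.re z.im = 0}.Finite := by
    apply (Set.finite_range (fun χ : MA f →ₐ[ℂ] ℂ => χ (qm f X))).subset
    intro z hz
    obtain ⟨χ, h1, -⟩ := hchar z hz
    exact ⟨χ, h1⟩
  have hzc : ∀ z : ℂ, g.evalEval z.re z.im = 0 →
      ((dw g).evalEval z.re z.im = 0 ∧ (derivative g).evalEval z.re z.im = 0) :=
    fun z hz => crit_of_min hg0 hz
  have hbox : ∀ z : ℂ, ∃ r > 0, Box g z.re z.im r := by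
    intro z
    have h1 : ∀ᶠ w in 𝓝 z, w ∉ {z : ℂ | (dw g).evalEval z.re z.im = 0 ∧ (derivative g).evalEval z.re z.im = 0} \ {z} :=
      (hcf.subset Set.diff_subset).isClosed.isOpen_compl.mem_nhds (by simp)
    obtain ⟨r, hr, hr'⟩ := Metric.eventually_nhds_iff.1 h1
    refine ⟨r / 3, by positivity, fun a b ha hb hab => ?_⟩
    have hne : (⟨a, b⟩ : ℂ) ≠ z := by
      rintro rfl; simp at hab
    have hd : dist (⟨a, b⟩ : ℂ) z < r := by
      rw [Complex.dist_eq]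
      have := Complex.norm_le_abs_re_add_abs_im ((⟨a, b⟩ : ℂ) - z)
      simp only [sub_re, sub_im] at this
      linarith
    have h3 := hr' hd
    have h4 : ¬((dw g).evalEval a b = 0 ∧ (derivative g).evalEval a b = 0) := fun h => h3 ⟨h, hne⟩
    refine ⟨lt_of_le_of_ne (hg0 a b) fun h5 => h4 (hzc ⟨a, b⟩ h5.symm), h4⟩
  -- choose characters
  have hZ' : ∀ z ∈ Z, g.evalEval z.re z.im = 0 := by
    intro z hz
    have := hZ z hz
    rw [hFg] at this
    exact_mod_cast this
  have hch : ∀ z : ℂ, ∃ χ : MA f →ₐ[ℂ] ℂ, z ∈ Z → χ (qm f X) = z ∧ χ (qm f (C X)) = (starRingEnd ℂ) z := by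
    intro z
    by_cases hz : z ∈ Z
    · obtain ⟨χ, hχ⟩ := hchar z (hzc z (hZ' z hz))
      exact ⟨χ, fun _ => hχ⟩
    · obtain ⟨χ⟩ : Nonempty (MA f →ₐ[ℂ] ℂ) := by
        by_contra hne
        rw [not_nonempty_iff] at hne
        have h1 := nn_one_ge h
        have h2 : IsUnit (0 : MA f) := isUnit_of_char (fun χ => (hne.false χ).elim)
        have h3 : Subsingleton (MA f) := by
          rw [isUnit_zero_iff] at h2
          exact subsingleton_of_zero_eq_one h2
        have h4 := (inF h).nn_compl_le 1
        rw [finrank_zero_of_subsingleton] at h4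
        have : 0 < 2 * k * (2 * k - 1) := Nat.mul_pos (by omega) (by omega)
        omega
      exact ⟨χ, fun h => absurd h hz⟩
  choose ch hch using hch
  set T := Z.image ch with hT
  have hcard : T.card = Z.card := by
    apply Finset.card_image_of_injOn
    intro a ha b hb hab
    rw [← (hch a ha).1, ← (hch b hb).1]
    rw [hab]
  have hχf : ∀ χ : MA f →ₐ[ℂ] ℂ, (inF h).IsRealC χ →
      χ (qm f f) = (g.evalEval (χ (qm f X)).re (χ (qm f X)).im : ℝ) := by
    intro χ hχ
    rw [char_eval, (real_iff h χ).1 hχ, hFg]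
  have hε : ∀ᶠ ε : ℝ in 𝓝[>] 0, 0 < ε ∧ ∀ χ : MA f →ₐ[ℂ] ℂ, χ (qm f f) ≠ 0 → ε < ‖χ (qm f f)‖ := by
    refine Filter.Eventually.and self_mem_nhdsWithin ?_
    rw [eventually_all]
    intro χ
    by_cases h0 : χ (qm f f) = 0
    · exact Eventually.of_forall (fun _ h => absurd h0 h)
    · filter_upwards [Ioo_mem_nhdsGT (norm_pos_iff.2 h0)] with ρ hρ _ using hρ.2
  obtain ⟨ε, hε0, hε⟩ := hε.exists
  have hev : ∀ χ : MA f →ₐ[ℂ] ℂ, χ (qm f (f - C (C (ε:ℂ)))) = χ (qm f f) - ε := by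
    intro χ
    rw [map_sub, map_sub, char_eval χ (C (C (ε:ℂ)))]; simp
  have key := (inF h).nn_global T (g := qm f (f - C (C (ε:ℂ)))) ?_ ?_ ?_ ?_ ?_ ?_
  · have h1 := nn_one_ge h
    have h2 := nn_f_le hk h (ε : ℂ)
    have h3 := finrank_MA h.good (by omega)
    rw [hcard] at key
    obtain ⟨j, rfl⟩ : ∃ j, k = j + 2 := ⟨k - 2, by omega⟩
    have e1 : 2 * (j + 2) - 1 = 2 * j + 3 := by omega
    have e2 : 2 * (2 * (j + 2)) - 1 = 4 * j + 7 := by omega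
    have e3 : (j + 2) * (j + 2) - 1 = j * j + 4 * j + 3 := by
      rw [Nat.sub_eq_iff_eq_add (by nlinarith)]; ring
    have e4 : 3 * (j + 2) ^ 2 - 2 * (j + 2) = 3 * j * j + 10 * j + 8 := by
      rw [Nat.sub_eq_iff_eq_add (by nlinarith)]; ring
    rw [e1] at h1; rw [e3] at h2; rw [e1, e2] at h3; rw [e4]
    nlinarith
  · intro χ hχ
    obtain ⟨z, hz, rfl⟩ := Finset.mem_image.1 hχ
    rw [real_iff, (hch z hz).1, (hch z hz).2]
  · intro χ hχ
    obtain ⟨z, hz, rfl⟩ := Finset.mem_image.1 hχ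
    obtain ⟨r, hr, hb⟩ := hbox z
    exact local_claim h (L_mono (by omega) (by omega) (L_qq1 z.re)) (L_mono (by omega) (by omega) (L_qq2 z.im))
      (st_qq1 _) (st_qq2 _) (hch z hz).1 (hch z hz).2 (loc_of_box hrel hr hb (hZ' z hz))
  · change sg h.star _ = _
    rw [sg_qm, map_sub, hst, st_CC, Complex.conj_ofReal]
  · intro χ
    rw [hev]
    intro h0
    have h1 : χ (qm f f) = ε := by linear_combination h0
    have h2 := hε χ (by rw [h1]; exact_mod_cast hε0.ne')
    rw [h1] at h2
    simp [abs_of_pos hε0] at h2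
  · intro χ hχ
    obtain ⟨z, hz, rfl⟩ := Finset.mem_image.1 hχ
    rw [hev, char_eval, (hch z hz).1, (hch z hz).2, hZ z hz]
    simpa using hε0
  · intro χ hχ hχT
    have h1 := hχf χ hχ
    rw [hev, h1]
    by_cases h3 : g.evalEval (χ (qm f X)).re (χ (qm f X)).im = 0
    · exfalso
      apply hχT
      have hz : χ (qm f X) ∈ Z := by rw [← hZi, hFg, h3]; simp
      refine Finset.mem_image.2 ⟨_, hz, ?_⟩
      exact char_ext (hch _ hz).1 (by rw [(hch _ hz).2, (real_iff h χ).1 hχ])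
    · have h4 := hε χ (by rw [h1]; exact_mod_cast h3)
      rw [h1, Complex.norm_real, Real.norm_of_nonneg (hg0 _ _)] at h4
      simp; exact h4

end main
end EC

namespace EC
open Module Polynomial
open Polynomial.Bivariate (swap)
set_option linter.unusedSectionVars false

section lift
variable {R : Type*} [CommRing R] [Algebra ℂ R] {a b c e : R}

/-- lift of the monomial `z^i w^j` in degree `d` -/
def tt (a b c e : R) (i j d : ℕ) : R :=
  if j ≤ i then a ^ (i - j) * e ^ j * c ^ (d - i) else b ^ (j - i) * e ^ i * c ^ (d - j)

lemma tt_mul (hab : a * b = c * e) {i j d i' j' d' : ℕ} (hi : i ≤ d) (hj : j ≤ d)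
    (hi' : i' ≤ d') (hj' : j' ≤ d') :
    tt a b c e i j d * tt a b c e i' j' d' = tt a b c e (i + i') (j + j') (d + d') := by
  have key : ∀ (n : ℕ), a ^ n * b ^ n = c ^ n * e ^ n := by
    intro n; rw [← mul_pow, hab, mul_pow]
  unfold tt
  by_cases h1 : j ≤ i <;> by_cases h2 : j' ≤ i'
  · rw [if_pos h1, if_pos h2, if_pos (by omega)]
    obtain ⟨p, rfl⟩ := Nat.exists_eq_add_of_le h1
    obtain ⟨q, rfl⟩ := Nat.exists_eq_add_of_le h2
    obtain ⟨u, rfl⟩ := Nat.exists_eq_add_of_le hi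
    obtain ⟨v, rfl⟩ := Nat.exists_eq_add_of_le hi'
    rw [show j + p - j = p by omega, show j' + q - j' = q by omega, show j + p + u - (j + p) = u by omega,
      show j' + q + v - (j' + q) = v by omega, show j + p + (j' + q) - (j + j') = p + q by omega,
      show j + p + u + (j' + q + v) - (j + p + (j' + q)) = u + v by omega]
    ring
  · rw [if_pos h1, if_neg h2]
    push Not at h2
    obtain ⟨p, rfl⟩ := Nat.exists_eq_add_of_le h1
    obtain ⟨q, rfl⟩ := Nat.exists_eq_add_of_le h2.le
    obtain ⟨u, rfl⟩ := Nat.exists_eq_add_of_le hi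
    obtain ⟨v, rfl⟩ := Nat.exists_eq_add_of_le hj'
    split_ifs with h3
    · obtain ⟨r, rfl⟩ := Nat.exists_eq_add_of_le (show q ≤ p by omega)
      rw [show j + (q + r) - j = q + r by omega, show i' + q - i' = q by omega,
        show j + (q + r) + u - (j + (q + r)) = u by omega, show i' + q + v - (i' + q) = v by omega,
        show j + (q + r) + i' - (j + (i' + q)) = r by omega,
        show j + (q + r) + u + (i' + q + v) - (j + (q + r) + i') = q + u + v by omega]
      linear_combination (a ^ r * e ^ j * c ^ u * e ^ i' * c ^ v) * key q
    · obtain ⟨r, rfl⟩ := Nat.exists_eq_add_of_le (show p ≤ q by omega)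
      rw [show j + p - j = p by omega, show i' + (p + r) - i' = p + r by omega,
        show j + p + u - (j + p) = u by omega, show i' + (p + r) + v - (i' + (p + r)) = v by omega,
        show j + (i' + (p + r)) - (j + p + i') = r by omega,
        show j + p + u + (i' + (p + r) + v) - (j + (i' + (p + r))) = p + u + v by omega]
      linear_combination (b ^ r * e ^ j * c ^ u * e ^ i' * c ^ v) * key p
  · rw [if_neg h1, if_pos h2]
    push Not at h1
    obtain ⟨p, rfl⟩ := Nat.exists_eq_add_of_le h2
    obtain ⟨q, rfl⟩ := Nat.exists_eq_add_of_le h1.le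
    obtain ⟨u, rfl⟩ := Nat.exists_eq_add_of_le hi'
    obtain ⟨v, rfl⟩ := Nat.exists_eq_add_of_le hj
    split_ifs with h3
    · obtain ⟨r, rfl⟩ := Nat.exists_eq_add_of_le (show q ≤ p by omega)
      rw [show j' + (q + r) - j' = q + r by omega, show i + q - i = q by omega,
        show j' + (q + r) + u - (j' + (q + r)) = u by omega, show i + q + v - (i + q) = v by omega,
        show i + (j' + (q + r)) - (i + q + j') = r by omega,
        show i + q + v + (j' + (q + r) + u) - (i + (j' + (q + r))) = q + u + v by omega]
      linear_combination (a ^ r * e ^ j' * c ^ u * e ^ i * c ^ v) * key q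
    · obtain ⟨r, rfl⟩ := Nat.exists_eq_add_of_le (show p ≤ q by omega)
      rw [show j' + p - j' = p by omega, show i + (p + r) - i = p + r by omega,
        show j' + p + u - (j' + p) = u by omega, show i + (p + r) + v - (i + (p + r)) = v by omega,
        show i + (p + r) + j' - (i + (j' + p)) = r by omega,
        show i + (p + r) + v + (j' + p + u) - (i + (p + r) + j') = p + u + v by omega]
      linear_combination (b ^ r * e ^ j' * c ^ u * e ^ i * c ^ v) * key p
  · rw [if_neg h1, if_neg h2, if_neg (by omega)]
    push Not at h1 h2
    obtain ⟨p, rfl⟩ := Nat.exists_eq_add_of_le h1.le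
    obtain ⟨q, rfl⟩ := Nat.exists_eq_add_of_le h2.le
    obtain ⟨u, rfl⟩ := Nat.exists_eq_add_of_le hj
    obtain ⟨v, rfl⟩ := Nat.exists_eq_add_of_le hj'
    rw [show i + p - i = p by omega, show i' + q - i' = q by omega, show i + p + u - (i + p) = u by omega,
      show i' + q + v - (i' + q) = v by omega, show i + p + (i' + q) - (i + i') = p + q by omega,
      show i + p + u + (i' + q + v) - (i + p + (i' + q)) = u + v by omega]
    ring

lemma tt_shift {i j d d' : ℕ} (hi : i ≤ d) (hj : j ≤ d) (hd : d ≤ d') :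
    tt a b c e i j d' = c ^ (d' - d) * tt a b c e i j d := by
  obtain ⟨r, rfl⟩ := Nat.exists_eq_add_of_le hd
  unfold tt
  rw [show d + r - d = r by omega, show d + r - i = (d - i) + r by omega, show d + r - j = (d - j) + r by omega]
  split_ifs <;> ring

/-- the homogeneous lift -/
noncomputable def Lam (a b c e : R) (d : ℕ) : ℂ[X][X] →ₗ[ℂ] R where
  toFun p := ∑ i ∈ Finset.range (d + 1), ∑ j ∈ Finset.range (d + 1), cf p i j • tt a b c e i j d
  map_add' := by intro p q; simp only [cf_add, add_smul, Finset.sum_add_distrib]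
  map_smul' := by intro r p; simp only [cf_smul, mul_smul, Finset.smul_sum, RingHom.id_apply]

lemma Lam_mm {i j d : ℕ} (hi : i ≤ d) (hj : j ≤ d) (r : ℂ) :
    Lam a b c e d (mm i j r) = r • tt a b c e i j d := by
  change ∑ i' ∈ Finset.range (d + 1), ∑ j' ∈ Finset.range (d + 1), cf (mm i j r) i' j' • tt a b c e i' j' d = _
  rw [Finset.sum_eq_single i, Finset.sum_eq_single j]
  · rw [cf_mm, if_pos ⟨rfl, rfl⟩]
  · intro j' _ h; rw [cf_mm, if_neg (by tauto), zero_smul]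
  · intro h; exact absurd (Finset.mem_range.2 (by omega)) h
  · intro i' _ h
    apply Finset.sum_eq_zero
    intro j' _
    rw [cf_mm, if_neg (by tauto), zero_smul]
  · intro h; exact absurd (Finset.mem_range.2 (by omega)) h

lemma L_ind {A B : ℕ} (P : ℂ[X][X] → Prop) (h0 : P 0) (hadd : ∀ p q, P p → P q → P (p + q))
    (hmm : ∀ i j r, i < A → j < B → P (mm i j r)) {p : ℂ[X][X]} (hp : p ∈ L ℂ A B) : P p := by
  rw [L_sum hp]
  exact Finset.sum_induction _ P hadd h0 (fun y _ => hmm _ _ _ y.1.2 y.2.2)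

lemma Lam_mul (hab : a * b = c * e) {d d' : ℕ} {p q : ℂ[X][X]} (hp : p ∈ L ℂ (d + 1) (d + 1))
    (hq : q ∈ L ℂ (d' + 1) (d' + 1)) :
    Lam a b c e (d + d') (p * q) = Lam a b c e d p * Lam a b c e d' q := by
  refine L_ind (fun p => Lam a b c e (d + d') (p * q) = Lam a b c e d p * Lam a b c e d' q) (by simp)
    (fun p p' h h' => by simp only [add_mul, map_add, h, h']) ?_ hp
  intro i j r hi hj
  refine L_ind (fun q => Lam a b c e (d + d') (mm i j r * q) = Lam a b c e d (mm i j r) * Lam a b c e d' q) (by simp)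
    (fun p p' h h' => by simp only [mul_add, map_add, h, h']) ?_ hq
  intro i' j' r' hi' hj'
  rw [mm_mul, Lam_mm (by omega) (by omega), Lam_mm (by omega) (by omega), Lam_mm (by omega) (by omega),
    ← tt_mul hab (by omega) (by omega) (by omega) (by omega), smul_mul_smul_comm]

lemma Lam_shift {d d' : ℕ} (hd : d ≤ d') {p : ℂ[X][X]} (hp : p ∈ L ℂ (d + 1) (d + 1)) :
    Lam a b c e d' p = c ^ (d' - d) * Lam a b c e d p := by
  refine L_ind (fun p => Lam a b c e d' p = c ^ (d' - d) * Lam a b c e d p) (by simp)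
    (fun p p' h h' => by simp only [map_add, h, h', mul_add]) ?_ hp
  intro i j r hi hj
  rw [Lam_mm (by omega) (by omega), Lam_mm (by omega) (by omega), tt_shift (by omega) (by omega) hd, mul_smul_comm]

lemma Lam_char {d : ℕ} {p : ℂ[X][X]} (hp : p ∈ L ℂ (d + 1) (d + 1)) (χ : R →ₐ[ℂ] ℂ) {z w : ℂ}
    (ha : χ a = z) (hb : χ b = w) (hc : χ c = 1) (he : χ e = z * w) :
    χ (Lam a b c e d p) = p.evalEval w z := by
  refine L_ind (fun p => χ (Lam a b c e d p) = p.evalEval w z) (by simp)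
    (fun p p' h h' => by simp only [map_add, h, h', evalEval_add]) ?_ hp
  intro i j r hi hj
  rw [Lam_mm (by omega) (by omega), map_smul, evalEval_mm]
  unfold tt
  split_ifs with h
  · obtain ⟨n, rfl⟩ := Nat.exists_eq_add_of_le h
    simp [ha, hb, hc, he]; ring
  · push Not at h
    obtain ⟨n, rfl⟩ := Nat.exists_eq_add_of_le h.le
    simp [ha, hb, hc, he]; ring

end lift

section chart
open Complex

/-- the chart of the quadric -/
noncomputable def xx : Fin 4 → ℂ[X][X] :=
  ![mm 1 0 (1/2) + mm 0 1 (1/2), mm 1 0 (-I/2) + mm 0 1 (I/2), mm 1 1 (1/2) + mm 0 0 (-1/2), mm 1 1 (1/2) + mm 0 0 (1/2)]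

noncomputable def ff (H : MvPolynomial (Fin 4) ℂ) : ℂ[X][X] := MvPolynomial.aeval xx H

abbrev RQ := MvPolynomial (Fin 4) ℂ ⧸ Ideal.span {Qc}

noncomputable def mkq : MvPolynomial (Fin 4) ℂ →ₐ[ℂ] RQ := Ideal.Quotient.mkₐ ℂ _

noncomputable def ya : RQ := mkq (MvPolynomial.X 0 + MvPolynomial.C I * MvPolynomial.X 1)
noncomputable def yb : RQ := mkq (MvPolynomial.X 0 - MvPolynomial.C I * MvPolynomial.X 1)
noncomputable def yc : RQ := mkq (MvPolynomial.X 3 - MvPolynomial.X 2)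
noncomputable def ye : RQ := mkq (MvPolynomial.X 3 + MvPolynomial.X 2)

lemma mkq_Q : mkq Qc = 0 := Ideal.Quotient.eq_zero_iff_mem.2 (Ideal.subset_span rfl)

lemma yab : ya * yb = yc * ye := by
  unfold ya yb yc ye
  rw [← map_mul, ← map_mul, ← sub_eq_zero, ← map_sub, ← mkq_Q]
  congr 1
  unfold Qc
  have : (MvPolynomial.C I : MvPolynomial (Fin 4) ℂ) ^ 2 = -1 := by
    rw [← MvPolynomial.C_pow, I_sq]; simp
  linear_combination (-(MvPolynomial.X 1) ^ 2) * this

noncomputable abbrev Lq (d : ℕ) : ℂ[X][X] →ₗ[ℂ] RQ := Lam ya yb yc ye d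

lemma xx_L (i : Fin 4) : xx i ∈ L ℂ 2 2 := by
  fin_cases i <;> exact Submodule.add_mem _ (L_mm _ (by omega) (by omega)) (L_mm _ (by omega) (by omega))

lemma Lq_xx (i : Fin 4) : Lq 1 (xx i) = mkq (MvPolynomial.X i) := by
  have h : ∀ (r : ℂ) (H : MvPolynomial (Fin 4) ℂ), r • mkq H = mkq (MvPolynomial.C r * H) := by
    intro r H; rw [← map_smul, MvPolynomial.smul_eq_C_mul]
  have hI : (MvPolynomial.C I : MvPolynomial (Fin 4) ℂ) ^ 2 = -1 := by
    rw [← MvPolynomial.C_pow, I_sq]; simp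
  have h2 : (MvPolynomial.C (1/2) : MvPolynomial (Fin 4) ℂ) + MvPolynomial.C (1/2) = 1 := by
    rw [← MvPolynomial.C_add]; norm_num
  have h3 : (MvPolynomial.C (-1/2) : MvPolynomial (Fin 4) ℂ) = - MvPolynomial.C (1/2) := by
    rw [← MvPolynomial.C_neg]; norm_num
  have h4 : (MvPolynomial.C (I/2) : MvPolynomial (Fin 4) ℂ) = MvPolynomial.C I * MvPolynomial.C (1/2) := by
    rw [← MvPolynomial.C_mul]; congr 1; ring
  have h5 : (MvPolynomial.C (-I/2) : MvPolynomial (Fin 4) ℂ) = - (MvPolynomial.C I * MvPolynomial.C (1/2)) := by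
    rw [← MvPolynomial.C_mul, ← MvPolynomial.C_neg]; congr 1; ring
  have t10 : tt ya yb yc ye 1 0 1 = ya := by simp [tt]
  have t01 : tt ya yb yc ye 0 1 1 = yb := by simp [tt]
  have t11 : tt ya yb yc ye 1 1 1 = ye := by simp [tt]
  have t00 : tt ya yb yc ye 0 0 1 = yc := by simp [tt]
  fin_cases i
  · change Lam ya yb yc ye 1 (mm 1 0 (1/2) + mm 0 1 (1/2)) = _
    rw [map_add, Lam_mm (by omega) (by omega), Lam_mm (by omega) (by omega)]
    rw [t10, t01]; unfold ya yb
    rw [h, h, ← map_add]; congr 1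
    change _ = MvPolynomial.X 0
    linear_combination (MvPolynomial.X 0) * h2
  · change Lam ya yb yc ye 1 (mm 1 0 (-I/2) + mm 0 1 (I/2)) = _
    rw [map_add, Lam_mm (by omega) (by omega), Lam_mm (by omega) (by omega)]
    rw [t10, t01]; unfold ya yb
    rw [h, h, ← map_add]; congr 1
    change _ = MvPolynomial.X 1
    rw [h4, h5]
    linear_combination (MvPolynomial.X 1) * h2 - 2 * MvPolynomial.C (1/2) * MvPolynomial.X 1 * hI
  · change Lam ya yb yc ye 1 (mm 1 1 (1/2) + mm 0 0 (-1/2)) = _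
    rw [map_add, Lam_mm (by omega) (by omega), Lam_mm (by omega) (by omega)]
    rw [t11, t00]; unfold yc ye
    rw [h, h, ← map_add]; congr 1
    change _ = MvPolynomial.X 2
    rw [h3]
    linear_combination (MvPolynomial.X 2) * h2
  · change Lam ya yb yc ye 1 (mm 1 1 (1/2) + mm 0 0 (1/2)) = _
    rw [map_add, Lam_mm (by omega) (by omega), Lam_mm (by omega) (by omega)]
    rw [t11, t00]; unfold yc ye
    rw [h, h, ← map_add]; congr 1
    change _ = MvPolynomial.X 3
    linear_combination (MvPolynomial.X 3) * h2

lemma one_L : (1 : ℂ[X][X]) ∈ L ℂ 1 1 := by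
  have e2 : (1 : ℂ[X][X]) = mm 0 0 1 := by rw [mm_eq]; simp
  rw [e2]; exact L_mm _ (by omega) (by omega)

lemma Lq_one : Lq 0 1 = 1 := by
  have e2 : (1 : ℂ[X][X]) = mm 0 0 1 := by rw [mm_eq]; simp
  rw [e2, Lam_mm le_rfl le_rfl]; simp [tt]

lemma ff_monomial (s : Fin 4 →₀ ℕ) : ff (MvPolynomial.monomial s 1) ∈ L ℂ (s.degree + 1) (s.degree + 1) ∧
    Lq s.degree (ff (MvPolynomial.monomial s 1)) = mkq (MvPolynomial.monomial s 1) := by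
  induction s using Finsupp.induction_linear with
  | zero =>
    have : (MvPolynomial.monomial (0 : Fin 4 →₀ ℕ) (1:ℂ)) = 1 := rfl
    rw [this]
    simp only [ff, map_one, map_zero]
    exact ⟨one_L, Lq_one⟩
  | add s t hs ht =>
    have e : MvPolynomial.monomial (s + t) (1:ℂ) = MvPolynomial.monomial s 1 * MvPolynomial.monomial t 1 := by
      rw [MvPolynomial.monomial_mul, one_mul]
    have e' : ff (MvPolynomial.monomial (s + t) (1:ℂ)) = ff (MvPolynomial.monomial s 1) * ff (MvPolynomial.monomial t 1) := by
      rw [e]; exact map_mul _ _ _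
    have hd : (s + t).degree = s.degree + t.degree := map_add _ _ _
    rw [e', hd]
    refine ⟨L_mul hs.1 ht.1 (by omega) (by omega), ?_⟩
    rw [Lq, Lam_mul yab hs.1 ht.1, hs.2, ht.2, e, map_mul]
  | single i n =>
    rw [Finsupp.degree_single]
    induction n with
    | zero =>
      have : (MvPolynomial.monomial (Finsupp.single i 0 : Fin 4 →₀ ℕ) (1:ℂ)) = 1 := by simp
      rw [this]
      simp only [ff, map_one]
      exact ⟨one_L, Lq_one⟩
    | succ n ih =>
      have e : MvPolynomial.monomial (Finsupp.single i (n + 1)) (1:ℂ) = MvPolynomial.monomial (Finsupp.single i n) 1 * MvPolynomial.X i := by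
        rw [MvPolynomial.X, MvPolynomial.monomial_mul, one_mul, Finsupp.single_add]
      have e' : ff (MvPolynomial.monomial (Finsupp.single i (n + 1)) (1:ℂ)) = ff (MvPolynomial.monomial (Finsupp.single i n) 1) * xx i := by
        rw [e]; unfold ff; rw [map_mul, MvPolynomial.aeval_X]
      rw [e']
      refine ⟨L_mul ih.1 (xx_L i) (by omega) (by omega), ?_⟩
      rw [Lq, Lam_mul yab ih.1 (xx_L i), ih.2, Lq_xx, e, map_mul]

lemma ff_hom {H : MvPolynomial (Fin 4) ℂ} {d : ℕ} (hH : H.IsHomogeneous d) :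
    ff H ∈ L ℂ (d + 1) (d + 1) ∧ Lq d (ff H) = mkq H := by
  have e : H = ∑ s ∈ H.support, H.coeff s • MvPolynomial.monomial s (1:ℂ) := by
    conv_lhs => rw [H.as_sum]
    apply Finset.sum_congr rfl
    intro s _
    rw [MvPolynomial.smul_monomial, smul_eq_mul, mul_one]
  have hd : ∀ s ∈ H.support, s.degree = d := by
    intro s hs
    have := hH (MvPolynomial.mem_support_iff.1 hs)
    rw [← this, Finsupp.degree_eq_weight_one]; rfl
  have e' : ff H = ∑ s ∈ H.support, H.coeff s • ff (MvPolynomial.monomial s (1:ℂ)) := by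
    conv_lhs => rw [e]
    unfold ff
    rw [map_sum]
    simp only [map_smul]
  constructor
  · rw [e']
    refine Submodule.sum_mem _ fun s hs => Submodule.smul_mem _ _ ?_
    have := (ff_monomial s).1
    rwa [hd s hs] at this
  · rw [e']
    conv_rhs => rw [e]
    rw [map_sum, map_sum]
    apply Finset.sum_congr rfl
    intro s hs
    rw [map_smul, map_smul]
    have := (ff_monomial s).2
    rw [hd s hs] at this
    rw [this]

lemma ff_eval (H : MvPolynomial (Fin 4) ℂ) (z w : ℂ) :
    (ff H).evalEval w z = MvPolynomial.eval (fun i => (xx i).evalEval w z) H := by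
  induction H using MvPolynomial.induction_on with
  | C r => simp [ff, evalEval_C]
  | add p q hp hq => rw [map_add, ← hp, ← hq, ← evalEval_add]; congr 1; exact map_add _ _ _
  | mul_X p i hp =>
    rw [map_mul, ← hp, MvPolynomial.eval_X, ← evalEval_mul]; congr 1
    unfold ff; rw [map_mul, MvPolynomial.aeval_X]

end chart
end EC

namespace EC
open Module Polynomial
open Polynomial.Bivariate (swap)
set_option linter.unusedSectionVars false

section sqf
open Complex

/-- evaluation at a point of the quadric -/
noncomputable def evq (v : Fin 4 → ℂ) (hv : v 0 ^ 2 + v 1 ^ 2 + v 2 ^ 2 - v 3 ^ 2 = 0) : RQ →ₐ[ℂ] ℂ :=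
  Ideal.Quotient.liftₐ _ (MvPolynomial.aeval v) (by
    intro p hp
    obtain ⟨q, rfl⟩ := Ideal.mem_span_singleton.1 hp
    rw [map_mul]
    have : MvPolynomial.aeval v Qc = 0 := by simp [Qc, hv]
    rw [this, zero_mul])

lemma evq_mkq (v : Fin 4 → ℂ) (hv) (H : MvPolynomial (Fin 4) ℂ) : evq v hv (mkq H) = MvPolynomial.eval v H := by
  change MvPolynomial.aeval v H = _
  rw [MvPolynomial.aeval_eq_eval]

lemma exists_charq (w z : ℂ) : ∃ χ : RQ →ₐ[ℂ] ℂ, χ ya = z ∧ χ yb = w ∧ χ yc = 1 ∧ χ ye = z * w := by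
  have hv : (![(z + w) / 2, (-I * z + I * w) / 2, (z * w - 1) / 2, (z * w + 1) / 2] : Fin 4 → ℂ) 0 ^ 2
    + (![(z + w) / 2, (-I * z + I * w) / 2, (z * w - 1) / 2, (z * w + 1) / 2] : Fin 4 → ℂ) 1 ^ 2
    + (![(z + w) / 2, (-I * z + I * w) / 2, (z * w - 1) / 2, (z * w + 1) / 2] : Fin 4 → ℂ) 2 ^ 2
    - (![(z + w) / 2, (-I * z + I * w) / 2, (z * w - 1) / 2, (z * w + 1) / 2] : Fin 4 → ℂ) 3 ^ 2 = 0 := by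
    change ((z + w) / 2) ^ 2 + ((-I * z + I * w) / 2) ^ 2 + ((z * w - 1) / 2) ^ 2 - ((z * w + 1) / 2) ^ 2 = 0
    linear_combination ((z - w) ^ 2 / 4) * I_sq
  refine ⟨evq _ hv, ?_, ?_, ?_, ?_⟩
  · rw [ya, evq_mkq, map_add, map_mul, MvPolynomial.eval_X, MvPolynomial.eval_X, MvPolynomial.eval_C]
    change (z + w) / 2 + I * ((-I * z + I * w) / 2) = z
    linear_combination ((w - z) / 2) * I_sq
  · rw [yb, evq_mkq, map_sub, map_mul, MvPolynomial.eval_X, MvPolynomial.eval_X, MvPolynomial.eval_C]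
    change (z + w) / 2 - I * ((-I * z + I * w) / 2) = w
    linear_combination (-(w - z) / 2) * I_sq
  · rw [yc, evq_mkq, map_sub, MvPolynomial.eval_X, MvPolynomial.eval_X]
    change (z * w + 1) / 2 - (z * w - 1) / 2 = 1
    ring
  · rw [ye, evq_mkq, map_add, MvPolynomial.eval_X, MvPolynomial.eval_X]
    change (z * w + 1) / 2 + (z * w - 1) / 2 = z * w
    ring

lemma exists_root_biv {q : ℂ[X][X]} (hq : ¬ IsUnit q) (hq0 : q ≠ 0) : ∃ w z : ℂ, q.evalEval w z = 0 := by
  by_cases hd : q.natDegree = 0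
  · obtain ⟨p, rfl⟩ := natDegree_eq_zero.1 hd
    have hp : p.degree ≠ 0 := by
      intro h
      apply hq
      have := isUnit_iff_degree_eq_zero.2 h
      exact this.map C
    obtain ⟨w, hw⟩ := IsAlgClosed.exists_root p hp
    exact ⟨w, 0, by rw [evalEval_C]; exact hw⟩
  · obtain ⟨w, hw⟩ : ∃ w, q.leadingCoeff.eval w ≠ 0 := by
      by_contra h
      push Not at h
      exact hq0 (leadingCoeff_eq_zero.1 (Polynomial.funext (by simpa using h)))
    have h1 : (q.map (evalRingHom w)).natDegree = q.natDegree := natDegree_map_of_leadingCoeff_ne_zero _ hw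
    obtain ⟨z, hz⟩ := IsAlgClosed.exists_root (q.map (evalRingHom w)) (fun h => hd (by
      rw [← h1]; exact natDegree_eq_of_degree_eq_some h))
    refine ⟨w, z, ?_⟩
    rw [← map_evalRingHom_eval]
    exact hz

lemma L_of_natDegree {p : ℂ[X][X]} {d d' : ℕ} (h : p.natDegree ≤ d) (h' : (swap p).natDegree ≤ d') :
    p ∈ L ℂ (d + 1) (d' + 1) := by
  rintro i j (hij | hij)
  · rw [cf, show p.coeff i = 0 from coeff_eq_zero_of_natDegree_lt (by omega), coeff_zero]
  · rw [← cf_swap, cf, show (swap p).coeff j = 0 from coeff_eq_zero_of_natDegree_lt (by omega), coeff_zero]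

lemma natDegree_st (p : ℂ[X][X]) : (st p).natDegree = (swap p).natDegree := by
  rw [st_apply]
  exact natDegree_map_eq_of_injective (map_injective _ (starRingEnd ℂ).injective) _

lemma natDegree_swap_st (p : ℂ[X][X]) : (swap (st p)).natDegree = p.natDegree := by
  rw [← natDegree_st, st_st]

lemma not_sq_dvd {H : MvPolynomial (Fin 4) ℂ} {m : ℕ} (hH : H.IsHomogeneous m) (hsf : Squarefree (mkq H))
    (h0 : ff H ≠ 0) {Γ r : ℂ[X][X]} (e : Γ * Γ * r = ff H) (hd : Γ.natDegree = (swap Γ).natDegree) {w z : ℂ}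
    (hz : Γ.evalEval w z = 0) : False := by
  set d := Γ.natDegree with hdd
  have hΓ0 : Γ ≠ 0 := by rintro rfl; simp at e; exact h0 e.symm
  have hr0 : r ≠ 0 := by rintro rfl; simp at e; exact h0 e.symm
  have hsw : ∀ p : ℂ[X][X], p ≠ 0 → swap p ≠ 0 := by
    intro p hp h; apply hp; rw [← swap_swap' p, h, map_zero]
  have hL := (ff_hom hH).1
  have h1 : d + d + r.natDegree ≤ m := by
    have := L_natDegree hL
    rwa [← e, natDegree_mul (mul_ne_zero hΓ0 hΓ0) hr0, natDegree_mul hΓ0 hΓ0] at this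
  have h2 : d + d + (swap r).natDegree ≤ m := by
    have := L_natDegree (L_swap hL)
    rwa [← e, map_mul, map_mul, natDegree_mul (mul_ne_zero (hsw _ hΓ0) (hsw _ hΓ0)) (hsw _ hr0),
      natDegree_mul (hsw _ hΓ0) (hsw _ hΓ0), ← hd] at this
  have hΓL : Γ ∈ L ℂ (d + 1) (d + 1) := L_of_natDegree le_rfl hd.symm.le
  have hrL : r ∈ L ℂ (m - (d + d) + 1) (m - (d + d) + 1) := L_of_natDegree (by omega) (by omega)
  have hΓΓ : Γ * Γ ∈ L ℂ (d + d + 1) (d + d + 1) := L_mul hΓL hΓL (by omega) (by omega)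
  have h3 : mkq H = Lq d Γ * Lq d Γ * Lq (m - (d + d)) r := by
    rw [← (ff_hom hH).2, ← e]
    have := Lam_mul yab hΓΓ hrL
    rw [show d + d + (m - (d + d)) = m by omega] at this
    rw [Lq, this, Lam_mul yab hΓL hΓL]
  have hu := hsf (Lq d Γ) ⟨_, h3⟩
  obtain ⟨χ, ha, hb, hc, he⟩ := exists_charq w z
  have h4 := hu.map χ
  have h5 : χ (Lq d Γ) = Γ.evalEval w z := Lam_char hΓL χ ha hb hc he
  rw [h5, hz] at h4
  exact not_isUnit_zero h4

lemma ff_ne_zero {H : MvPolynomial (Fin 4) ℂ} {m : ℕ} (hH : H.IsHomogeneous m) (hsf : Squarefree (mkq H)) :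
    ff H ≠ 0 := by
  intro h
  have h1 := (ff_hom hH).2
  rw [h, map_zero] at h1
  have := hsf 0 ⟨0, by rw [← h1]; simp⟩
  have := this.map (evq 0 (by simp))
  simp at this

theorem sqf_ff {H : MvPolynomial (Fin 4) ℂ} {m : ℕ} (hH : H.IsHomogeneous m) (hsf : Squarefree (mkq H))
    (hst : st (ff H) = ff H) : Squarefree (ff H) := by
  have h0 := ff_ne_zero hH hsf
  rw [squarefree_iff_irreducible_sq_not_dvd_of_ne_zero h0]
  intro q hq hdvd
  obtain ⟨w, z, hz⟩ := exists_root_biv hq.not_isUnit hq.ne_zero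
  let E : ℂ[X][X] ≃+* ℂ[X][X] := RingEquiv.ofRingHom st st (RingHom.ext st_st) (RingHom.ext st_st)
  have hq' : Irreducible (st q) := (MulEquiv.irreducible_iff E.toMulEquiv).2 hq
  by_cases hass : st q ∣ q
  · have h1 : Associated (st q) q := hq'.associated_of_dvd hq hass
    have h2 : q.natDegree = (swap q).natDegree := by
      rw [← natDegree_st]
      exact le_antisymm (natDegree_le_of_dvd h1.symm.dvd hq'.ne_zero) (natDegree_le_of_dvd h1.dvd hq.ne_zero)
    obtain ⟨r, hr⟩ := hdvd
    exact not_sq_dvd hH hsf h0 hr.symm h2 hz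
  · obtain ⟨r, hr⟩ := hdvd
    have h1 : st q ^ 2 ∣ q * q * r := by
      rw [← hr, ← hst, hr, map_mul, map_mul, sq]
      exact dvd_mul_right _ _
    have hp : Prime (st q) := hq'.prime
    have h2 : st q ^ 2 ∣ r := hp.pow_dvd_of_dvd_mul_left 2 (fun h => by
      rcases hp.dvd_or_dvd h with h | h <;> exact hass h) h1
    obtain ⟨s, hs⟩ := h2
    have hsw : ∀ p : ℂ[X][X], p ≠ 0 → swap p ≠ 0 := by
      intro p hp h; apply hp; rw [← swap_swap' p, h, map_zero]
    refine not_sq_dvd hH hsf h0 (Γ := q * st q) (r := s) (by rw [hr, hs]; ring) ?_ (w := w) (z := z) (by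
      rw [evalEval_mul, hz, zero_mul])
    rw [map_mul, natDegree_mul hq.ne_zero hq'.ne_zero, natDegree_mul (hsw _ hq.ne_zero) (hsw _ hq'.ne_zero),
      natDegree_swap_st, natDegree_st, add_comm]

theorem deg_ff {H : MvPolynomial (Fin 4) ℂ} {m : ℕ} (hH : H.IsHomogeneous m) (hsf : Squarefree (mkq H))
    (hst : st (ff H) = ff H) : m ≤ (ff H).natDegree + 1 := by
  by_contra hlt
  push Not at hlt
  have hL : ff H ∈ L ℂ ((ff H).natDegree + 1) ((ff H).natDegree + 1) :=
    L_of_natDegree le_rfl (by rw [← natDegree_st, hst])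
  have h1 := (ff_hom hH).2
  rw [Lq, Lam_shift (by omega : (ff H).natDegree ≤ m) hL] at h1
  have h2 : yc * yc ∣ mkq H := by
    rw [← h1, ← sq]
    exact Dvd.dvd.mul_right (pow_dvd_pow _ (by omega)) _
  have := (hsf _ h2).map (evq ![0, 0, 1, 1] (by simp))
  rw [yc, evq_mkq] at this
  simp at this

end sqf
end EC

namespace EC
open Module Polynomial
open Polynomial.Bivariate (swap)
set_option linter.unusedSectionVars false

section mob
open Complex

/-- Moebius basis polynomial -/
noncomputable def bz (z0 : ℂ) (m i : ℕ) : ℂ[X] := X ^ (m - i) * (C z0 * X + 1) ^ i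

lemma bz_natDegree (z0 : ℂ) {m i : ℕ} (hi : i ≤ m) : (bz z0 m i).natDegree ≤ m := by
  unfold bz
  have h1 : (C z0 * X + 1 : ℂ[X]).natDegree ≤ 1 := by compute_degree
  have h2 : ((C z0 * X + 1 : ℂ[X]) ^ i).natDegree ≤ i := by
    simpa using natDegree_pow_le_of_le i h1
  calc _ ≤ (m - i) + i := natDegree_mul_le_of_le (natDegree_X_pow_le _) h2
    _ = m := by omega

lemma bz_coeff_top (z0 : ℂ) {m i : ℕ} (hi : i ≤ m) : (bz z0 m i).coeff m = z0 ^ i := by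
  unfold bz
  have h1 : (C z0 * X + 1 : ℂ[X]).natDegree ≤ 1 := by compute_degree
  conv_lhs => rw [show m = i + (m - i) by omega]
  rw [show i + (m - i) - i = m - i by omega, coeff_X_pow_mul]
  have := coeff_pow_of_natDegree_le h1 (m := i)
  rw [mul_one] at this
  rw [this]
  simp [coeff_one]

lemma bz_coeff_zero (z0 : ℂ) {m i : ℕ} (hi : i ≤ m) : (bz z0 m i).coeff 0 = if i = m then 1 else 0 := by
  rw [coeff_zero_eq_eval_zero]
  unfold bz
  split_ifs with h
  · simp [h]
  · simp; omega

lemma bz_eval (z0 : ℂ) {m i : ℕ} (hi : i ≤ m) {z : ℂ} (hz : z ≠ 0) :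
    (bz z0 m i).eval z = z ^ m * (z0 + z⁻¹) ^ i := by
  unfold bz
  have : z0 * z + 1 = z * (z0 + z⁻¹) := by field_simp
  simp only [eval_mul, eval_pow, eval_X, eval_add, eval_C, eval_one]
  rw [this, mul_pow, ← mul_assoc, ← pow_add]
  congr 2; omega

lemma bz_conj (z0 : ℂ) (m i : ℕ) : (bz z0 m i).map (starRingEnd ℂ) = bz (starRingEnd ℂ z0) m i := by
  simp [bz, Polynomial.map_mul, Polynomial.map_pow]

noncomputable def mb (z0 : ℂ) (m : ℕ) (P : ℂ[X]) : ℂ[X] := ∑ i ∈ Finset.range (m + 1), C (P.coeff i) * bz z0 m i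

lemma mb_eval (z0 : ℂ) {m : ℕ} {P : ℂ[X]} (hP : P.natDegree ≤ m) {z : ℂ} (hz : z ≠ 0) :
    (mb z0 m P).eval z = z ^ m * P.eval (z0 + z⁻¹) := by
  rw [mb, eval_finset_sum, eval_eq_sum_range' (Nat.lt_succ_of_le hP), Finset.mul_sum]
  apply Finset.sum_congr rfl
  intro i hi
  rw [eval_mul, eval_C, bz_eval z0 (by simpa [Nat.lt_succ_iff] using hi) hz]
  ring

lemma mb_eval_zero (z0 : ℂ) {m : ℕ} {P : ℂ[X]} : (mb z0 m P).eval 0 = P.coeff m := by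
  rw [mb, eval_finset_sum, Finset.sum_eq_single m]
  · rw [eval_mul, eval_C, ← coeff_zero_eq_eval_zero, bz_coeff_zero _ le_rfl, if_pos rfl, mul_one]
  · intro i hi h
    rw [eval_mul, ← coeff_zero_eq_eval_zero (bz _ _ _), bz_coeff_zero z0 (by simpa [Nat.lt_succ_iff] using hi), if_neg h, mul_zero]
  · simp

lemma mb_coprime (z0 : ℂ) {n : ℕ} {P : ℂ[X]} (hP : P.natDegree ≤ n + 1) (hc : IsCoprime P (derivative P))
    (h : P.coeff (n + 1) ≠ 0 ∨ P.coeff n ≠ 0) :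
    IsCoprime (mb z0 (n + 1) P) (derivative (mb z0 (n + 1) P)) := by
  rw [isCoprime_iff_aeval_ne_zero_of_isAlgClosed ℂ ℂ]
  intro z
  simp only [coe_aeval_eq_eval]
  by_contra hcon
  push Not at hcon
  obtain ⟨h1, h2⟩ := hcon
  by_cases hz : z = 0
  · subst hz
    rw [mb_eval_zero] at h1
    have h3 : mb z0 (n + 1) P = X * mb z0 n P := by
      rw [mb, Finset.sum_range_succ, h1, C_0, zero_mul, add_zero, mb, Finset.mul_sum]
      apply Finset.sum_congr rfl
      intro i hi
      have hi : i ≤ n := by simpa [Nat.lt_succ_iff] using hi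
      unfold bz
      rw [show n + 1 - i = (n - i) + 1 by omega]
      ring
    rw [h3] at h2
    simp [mb_eval_zero] at h2
    tauto
  · have h4 : HasDerivAt (fun x : ℂ => x ^ (n + 1) * P.eval (z0 + x⁻¹))
        ((((n + 1 : ℕ) : ℂ) * z ^ n) * P.eval (z0 + z⁻¹) + z ^ (n + 1) * ((derivative P).eval (z0 + z⁻¹) * (-(z ^ 2)⁻¹))) z := by
      have e1 := hasDerivAt_pow (n + 1) z
      have e2 : HasDerivAt (fun x : ℂ => z0 + x⁻¹) (-(z ^ 2)⁻¹) z := (hasDerivAt_inv hz).const_add z0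
      have e3 := (P.hasDerivAt (z0 + z⁻¹)).comp z e2
      exact e1.mul e3
    have h5 : HasDerivAt (fun x : ℂ => x ^ (n + 1) * P.eval (z0 + x⁻¹)) ((derivative (mb z0 (n + 1) P)).eval z) z := by
      refine ((mb z0 (n + 1) P).hasDerivAt z).congr_of_eventuallyEq ?_
      filter_upwards [isOpen_ne.mem_nhds hz] with x hx
      rw [mb_eval z0 hP hx]
    have h6 := h4.unique h5
    rw [mb_eval z0 hP hz] at h1
    have h7 : P.eval (z0 + z⁻¹) = 0 := by simpa [hz] using h1
    rw [h7, h2] at h6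
    have h8 : (derivative P).eval (z0 + z⁻¹) = 0 := by simpa [hz] using h6
    rw [isCoprime_iff_aeval_ne_zero_of_isAlgClosed ℂ ℂ] at hc
    rcases hc (z0 + z⁻¹) with h | h
    · exact h (by simpa using h7)
    · exact h (by simpa using h8)

/-- the Moebius transform of a bivariate polynomial -/
noncomputable def mob (z0 : ℂ) (m : ℕ) (f : ℂ[X][X]) : ℂ[X][X] :=
  ∑ i ∈ Finset.range (m + 1), ∑ j ∈ Finset.range (m + 1),
    C (C (cf f i j)) * ((bz z0 m i).map C * C (bz (starRingEnd ℂ z0) m j))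

lemma cf_mapC_mul_C (c : ℂ) (p q : ℂ[X]) (i j : ℕ) : cf (C (C c) * (p.map C * C q)) i j = c * (p.coeff i * q.coeff j) := by
  simp only [cf, coeff_C_mul, coeff_mul_C, coeff_map]

lemma cf_finsum {ι : Type*} (s : Finset ι) (F : ι → ℂ[X][X]) (i j : ℕ) : cf (∑ x ∈ s, F x) i j = ∑ x ∈ s, cf (F x) i j := by
  simp only [cf, finset_sum_coeff]

lemma cf_mob (z0 : ℂ) (m : ℕ) (f : ℂ[X][X]) (a b : ℕ) : cf (mob z0 m f) a b =
    ∑ i ∈ Finset.range (m + 1), ∑ j ∈ Finset.range (m + 1),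
      cf f i j * ((bz z0 m i).coeff a * (bz (starRingEnd ℂ z0) m j).coeff b) := by
  simp only [mob, cf_finsum, cf_mapC_mul_C]

lemma mob_L (z0 : ℂ) (m : ℕ) (f : ℂ[X][X]) : mob z0 m f ∈ L ℂ (m + 1) (m + 1) := by
  intro a b h
  rw [cf_mob]
  refine Finset.sum_eq_zero fun i hi => Finset.sum_eq_zero fun j hj => ?_
  have hi : i ≤ m := by simpa [Nat.lt_succ_iff] using hi
  have hj : j ≤ m := by simpa [Nat.lt_succ_iff] using hj
  rcases h with h | h
  · rw [coeff_eq_zero_of_natDegree_lt (lt_of_le_of_lt (bz_natDegree z0 hi) h)]; ring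
  · rw [coeff_eq_zero_of_natDegree_lt (lt_of_le_of_lt (bz_natDegree _ hj) h)]; ring

lemma bz_coeff_conj (z0 : ℂ) (m i a : ℕ) : starRingEnd ℂ ((bz z0 m i).coeff a) = (bz (starRingEnd ℂ z0) m i).coeff a := by
  rw [← bz_conj, coeff_map]

lemma mob_st (z0 : ℂ) (m : ℕ) {f : ℂ[X][X]} (hf : st f = f) : st (mob z0 m f) = mob z0 m f := by
  apply cf_ext
  intro a b
  rw [cf_st, cf_mob, cf_mob]
  simp only [map_sum]
  rw [Finset.sum_comm]
  refine Finset.sum_congr rfl fun i hi => Finset.sum_congr rfl fun j hj => ?_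
  have h1 : starRingEnd ℂ (cf f j i) = cf f i j := by rw [← cf_st, hf]
  rw [map_mul, map_mul, h1, bz_coeff_conj, bz_coeff_conj, Complex.conj_conj]
  ring

lemma biv_eval {m : ℕ} {f : ℂ[X][X]} (hf : f ∈ L ℂ (m + 1) (m + 1)) (w z : ℂ) : f.evalEval w z =
    ∑ i ∈ Finset.range (m + 1), ∑ j ∈ Finset.range (m + 1), cf f i j * w ^ j * z ^ i := by
  conv_lhs => rw [L_sum hf]
  rw [evalEval_finsetSum, Fintype.sum_prod_type, Finset.sum_range]
  refine Finset.sum_congr rfl fun i _ => ?_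
  rw [Finset.sum_range]
  refine Finset.sum_congr rfl fun j _ => ?_
  rw [evalEval_mm]

lemma mob_eval (z0 : ℂ) {m : ℕ} {f : ℂ[X][X]} (hf : f ∈ L ℂ (m + 1) (m + 1)) {w z : ℂ} (hw : w ≠ 0) (hz : z ≠ 0) :
    (mob z0 m f).evalEval w z = z ^ m * w ^ m * f.evalEval (starRingEnd ℂ z0 + w⁻¹) (z0 + z⁻¹) := by
  rw [biv_eval hf, mob]
  simp only [evalEval_finsetSum, Finset.mul_sum]
  refine Finset.sum_congr rfl fun i hi => Finset.sum_congr rfl fun j hj => ?_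
  have hi : i ≤ m := by simpa [Nat.lt_succ_iff] using hi
  have hj : j ≤ m := by simpa [Nat.lt_succ_iff] using hj
  rw [evalEval_mul, evalEval_mul, evalEval_map_C, evalEval_C, evalEval_C, eval_C, bz_eval _ hi hz, bz_eval _ hj hw]
  ring

lemma mob_zero (z0 : ℂ) (m : ℕ) (f : ℂ[X][X]) : (mob z0 m f).evalEval 0 0 = cf f m m := by
  have : (mob z0 m f).evalEval 0 0 = cf (mob z0 m f) 0 0 := by
    rw [cf, coeff_zero_eq_eval_zero, coeff_zero_eq_eval_zero, evalEval, C_0]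
  rw [this, cf_mob, Finset.sum_eq_single m, Finset.sum_eq_single m]
  · simp [bz_coeff_zero]
  · intro j hj h
    have hj : j ≤ m := by simpa [Nat.lt_succ_iff] using hj
    simp [bz_coeff_zero _ hj, h]
  · simp
  · intro i hi h
    have hi : i ≤ m := by simpa [Nat.lt_succ_iff] using hi
    simp [bz_coeff_zero _ hi, h]
  · simp

lemma mob_corner (z0 : ℂ) {m : ℕ} {f : ℂ[X][X]} (hf : f ∈ L ℂ (m + 1) (m + 1)) :
    cf (mob z0 m f) m m = f.evalEval (starRingEnd ℂ z0) z0 := by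
  rw [biv_eval hf, cf_mob]
  refine Finset.sum_congr rfl fun i hi => Finset.sum_congr rfl fun j hj => ?_
  have hi : i ≤ m := by simpa [Nat.lt_succ_iff] using hi
  have hj : j ≤ m := by simpa [Nat.lt_succ_iff] using hj
  rw [bz_coeff_top _ hi, bz_coeff_top _ hj]; ring

lemma mob_top (z0 : ℂ) {m : ℕ} {f : ℂ[X][X]} (hf : f ∈ L ℂ (m + 1) (m + 1)) :
    (swap (mob z0 m f)).coeff m = mb z0 m (f.map (evalRingHom (starRingEnd ℂ z0))) := by
  ext a
  have : ((swap (mob z0 m f)).coeff m).coeff a = cf (mob z0 m f) a m := by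
    rw [← cf_swap]; rfl
  rw [this, cf_mob, mb, finset_sum_coeff]
  refine Finset.sum_congr rfl fun i hi => ?_
  rw [coeff_C_mul, coeff_map, coe_evalRingHom, eval_eq_sum_range' (n := m + 1), Finset.sum_mul]
  · refine Finset.sum_congr rfl fun j hj => ?_
    have hj : j ≤ m := by simpa [Nat.lt_succ_iff] using hj
    rw [bz_coeff_top _ hj, cf]; ring
  · rw [Nat.lt_succ_iff, natDegree_le_iff_coeff_eq_zero]
    intro N hN
    exact hf i N (Or.inr hN)

lemma mob_top' (z0 : ℂ) {m : ℕ} {f : ℂ[X][X]} (hst : st f = f) :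
    (mob z0 m f).coeff m = ((swap (mob z0 m f)).coeff m).map (starRingEnd ℂ) := by
  conv_lhs => rw [← mob_st z0 m hst, st_apply]
  rw [coeff_map]; rfl

end mob
end EC

namespace EC
open Module Polynomial
open Polynomial.Bivariate (swap)
set_option linter.unusedSectionVars false

section glob
open Complex

/-- values on the real locus -/
noncomputable def Fz (f : ℂ[X][X]) (z : ℂ) : ℂ := f.evalEval (starRingEnd ℂ z) z

lemma Fz_conj {f : ℂ[X][X]} (hf : st f = f) (z : ℂ) : starRingEnd ℂ (Fz f z) = Fz f z := by
  have := evalEval_st f (starRingEnd ℂ z) z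
  rw [hf, Complex.conj_conj] at this
  exact this.symm

lemma Fz_re {f : ℂ[X][X]} (hf : st f = f) (z : ℂ) : (((Fz f z).re : ℝ) : ℂ) = Fz f z :=
  Complex.conj_eq_iff_re.1 (Fz_conj hf z)

lemma Fz_cont (f : ℂ[X][X]) : Continuous (Fz f) := by
  obtain ⟨n, hn⟩ := L_exists f
  have h1 : f ∈ L ℂ (n + 1) (n + 1) := L_mono (by omega) (by omega) hn
  have : Fz f = fun z => ∑ i ∈ Finset.range (n + 1), ∑ j ∈ Finset.range (n + 1), cf f i j * (starRingEnd ℂ z) ^ j * z ^ i := by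
    funext z; exact biv_eval h1 _ _
  rw [this]
  have : Continuous (fun z : ℂ => starRingEnd ℂ z) := Complex.continuous_conj
  fun_prop

lemma const_sign {F : ℂ → ℝ} (hF : Continuous F) (hfin : {z | F z = 0}.Finite) {z0 : ℂ} (h0 : F z0 ≠ 0) (z : ℂ) :
    0 ≤ F z / F z0 := by
  by_contra hneg
  push Not at hneg
  have hz : F z ≠ 0 := by rintro h; rw [h, zero_div] at hneg; exact lt_irrefl _ hneg
  have hc : IsPreconnected ({z | F z = 0}ᶜ) :=
    (hfin.countable.isPathConnected_compl_of_one_lt_rank (by simp)).isConnected.isPreconnected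
  have h1 := hc.intermediate_value (f := fun x => F x / F z0) (a := z) (b := z0) hz h0 (by fun_prop)
  obtain ⟨x, hx, hx0⟩ := h1 ⟨hneg.le, by rw [div_self h0]; exact zero_le_one⟩
  apply hx
  simpa [h0] using hx0

lemma coprime_C_mul {c : ℂ} (hc : c ≠ 0) {p : ℂ[X]} (h : IsCoprime p (derivative p)) :
    IsCoprime (C c * p) (derivative (C c * p)) := by
  rw [derivative_C_mul]
  exact (isCoprime_mul_unit_left (isUnit_C.2 (isUnit_iff_ne_zero.2 hc)) _ _).2 h

lemma exists_good {m : ℕ} (hm : 1 ≤ m) {f : ℂ[X][X]} (hL : f ∈ L ℂ (m + 1) (m + 1)) (hst : st f = f)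
    (hsf : Squarefree f) (hd : m ≤ f.natDegree + 1) (hfin : {z | Fz f z = 0}.Finite) :
    ∃ z0, Fz f z0 ≠ 0 ∧ Good m (C (C (Fz f z0)⁻¹) * mob z0 m f) := by
  obtain ⟨a, b, d, hd0, hab⟩ := clear hsf
  have hf0 : f.leadingCoeff ≠ 0 := leadingCoeff_ne_zero.2 hsf.ne_zero
  have hb : ({z | Fz f z = 0} ∪ (starRingEnd ℂ) '' {w | (d * f.leadingCoeff).IsRoot w}).Finite :=
    hfin.union ((finite_setOf_isRoot (mul_ne_zero hd0 hf0)).image _)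
  obtain ⟨z0, hz0⟩ := hb.exists_notMem
  have h1 : Fz f z0 ≠ 0 := fun h => hz0 (Or.inl h)
  have h2 : ¬ (d * f.leadingCoeff).IsRoot (starRingEnd ℂ z0) := fun h => hz0 (Or.inr ⟨_, h, by simp⟩)
  rw [IsRoot.def, eval_mul, mul_eq_zero, not_or] at h2
  obtain ⟨h2, h3⟩ := h2
  obtain ⟨n, rfl⟩ : ∃ n, m = n + 1 := ⟨m - 1, by omega⟩
  set P := f.map (evalRingHom (starRingEnd ℂ z0)) with hP
  have hPn : P.natDegree ≤ n + 1 := natDegree_map_le.trans (L_natDegree hL)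
  have hcopP : IsCoprime P (derivative P) := by
    have := congrArg (Polynomial.map (evalRingHom (starRingEnd ℂ z0))) hab
    rw [Polynomial.map_add, Polynomial.map_mul, Polynomial.map_mul, map_C, coe_evalRingHom, ← derivative_map] at this
    refine ⟨C (d.eval (starRingEnd ℂ z0))⁻¹ * a.map (evalRingHom (starRingEnd ℂ z0)),
      C (d.eval (starRingEnd ℂ z0))⁻¹ * b.map (evalRingHom (starRingEnd ℂ z0)), ?_⟩
    rw [mul_assoc, mul_assoc, ← mul_add, this, ← C_mul, inv_mul_cancel₀ h2, C_1]
  have hPc : P.coeff f.natDegree ≠ 0 := by rw [hP, coeff_map]; exact h3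
  have hdn := L_natDegree hL
  have hor : P.coeff (n + 1) ≠ 0 ∨ P.coeff n ≠ 0 := by
    rcases (show f.natDegree = n + 1 ∨ f.natDegree = n by omega) with h | h
    · left; rwa [h] at hPc
    · right; rwa [h] at hPc
  have hB : IsCoprime ((swap (mob z0 (n + 1) f)).coeff (n + 1)) (derivative ((swap (mob z0 (n + 1) f)).coeff (n + 1))) := by
    rw [mob_top z0 hL]
    exact mb_coprime z0 hPn hcopP hor
  have hB' : IsCoprime ((mob z0 (n + 1) f).coeff (n + 1)) (derivative ((mob z0 (n + 1) f).coeff (n + 1))) := by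
    rw [mob_top' z0 hst, derivative_map]
    exact hB.map (mapRingHom (starRingEnd ℂ))
  refine ⟨z0, h1, ⟨L_CC _ (mob_L _ _ _), ?_, ?_, ?_⟩⟩
  · have : cf (C (C (Fz f z0)⁻¹) * mob z0 (n + 1) f) (n + 1) (n + 1) = (Fz f z0)⁻¹ * cf (mob z0 (n + 1) f) (n + 1) (n + 1) := by
      simp only [cf, coeff_C_mul]
    rw [this, mob_corner z0 hL]
    exact inv_mul_cancel₀ h1
  · rw [coeff_C_mul]
    exact coprime_C_mul (inv_ne_zero h1) hB'
  · rw [map_mul, Bivariate.swap_C_C, coeff_C_mul]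
    exact coprime_C_mul (inv_ne_zero h1) hB

lemma Fz_mob (z0 : ℂ) {m : ℕ} {f : ℂ[X][X]} (hL : f ∈ L ℂ (m + 1) (m + 1)) {z : ℂ} (hz : z ≠ 0) :
    Fz (mob z0 m f) z = ((normSq z ^ m : ℝ) : ℂ) * Fz f (z0 + z⁻¹) := by
  have h : starRingEnd ℂ z ≠ 0 := by simpa using hz
  rw [Fz, mob_eval z0 hL h hz, Fz, map_add, map_inv₀, ← mul_pow, mul_conj]
  push_cast
  rfl

lemma Fz_mob_zero (z0 : ℂ) (m : ℕ) (f : ℂ[X][X]) : Fz (mob z0 m f) 0 = cf f m m := by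
  rw [Fz, map_zero, mob_zero]

lemma Fz_CC (c : ℂ) (f : ℂ[X][X]) (z : ℂ) : Fz (C (C c) * f) z = c * Fz f z := by
  rw [Fz, evalEval_mul, evalEval_C, eval_C, Fz]

lemma mob_sign {m : ℕ} {f : ℂ[X][X]} (hL : f ∈ L ℂ (m + 1) (m + 1)) (hst : st f = f)
    (hfin : {z | Fz f z = 0}.Finite) {z1 : ℂ} (h1 : Fz f z1 ≠ 0) (z0 z : ℂ) :
    0 ≤ (Fz (C (C (Fz f z1)⁻¹) * mob z0 m f) z).re := by
  have hs : ∀ x, Fz f x = 0 ↔ (Fz f x).re = 0 := fun x => by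
    rw [← Fz_re hst x]; simp
  have hfin' : {z | (Fz f z).re = 0}.Finite := by
    convert hfin using 2
    ext x; exact (hs x).symm
  have key : ∀ z : ℂ, z ≠ 0 → 0 ≤ (Fz (C (C (Fz f z1)⁻¹) * mob z0 m f) z).re := by
    intro z hz
    rw [Fz_CC, Fz_mob z0 hL hz]
    have h2 := const_sign (F := fun x => (Fz f x).re) (Complex.continuous_re.comp (Fz_cont f)) hfin' (z0 := z1)
      (fun h => h1 ((hs _).2 h)) (z0 + z⁻¹)
    rw [← Fz_re hst z1, ← Fz_re hst (z0 + z⁻¹), ← ofReal_inv, ← ofReal_mul, ← ofReal_mul, ofReal_re]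
    have h3 : 0 ≤ normSq z ^ m := pow_nonneg (normSq_nonneg z) m
    calc 0 ≤ normSq z ^ m * ((Fz f (z0 + z⁻¹)).re / (Fz f z1).re) := mul_nonneg h3 h2
      _ = _ := by ring
  have hcl : IsClosed {z | 0 ≤ (Fz (C (C (Fz f z1)⁻¹) * mob z0 m f) z).re} :=
    isClosed_le continuous_const (Complex.continuous_re.comp (Fz_cont _))
  have hd : Dense ({0}ᶜ : Set ℂ) := dense_compl_singleton 0
  have := closure_minimal (s := ({0}ᶜ : Set ℂ)) (fun x hx => key x hx) hcl
  rw [hd.closure_eq] at this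
  exact this (Set.mem_univ z)

lemma st_norm {m : ℕ} {f : ℂ[X][X]} (hst : st f = f) (z0 z1 : ℂ) :
    st (C (C (Fz f z1)⁻¹) * mob z0 m f) = C (C (Fz f z1)⁻¹) * mob z0 m f := by
  rw [map_mul, st_CC, mob_st z0 m hst, map_inv₀, Fz_conj hst]

/-- number of real points, the point at infinity included -/
theorem count_bound {k : ℕ} (hk : 2 ≤ k) {f : ℂ[X][X]} (hL : f ∈ L ℂ (2 * k + 1) (2 * k + 1)) (hst : st f = f)
    (hsf : Squarefree f) (hd : 2 * k ≤ f.natDegree + 1) (Z : Finset ℂ) (hZ : ∀ z, Fz f z = 0 ↔ z ∈ Z) :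
    Z.card + (if cf f (2 * k) (2 * k) = 0 then 1 else 0) ≤ 3 * k ^ 2 - 2 * k + 2 := by
  classical
  have hfin : {z | Fz f z = 0}.Finite := by
    convert Z.finite_toSet using 1
    ext z; simp [hZ]
  obtain ⟨z0, h0, hg⟩ := exists_good (by omega) hL hst hsf hd hfin
  let Z1 : Finset ℂ := Z.image (fun ζ => (ζ - z0)⁻¹) ∪ (if cf f (2 * k) (2 * k) = 0 then {0} else ∅)
  have hne : ∀ ζ ∈ Z, ζ - z0 ≠ 0 := by
    intro ζ hζ h
    rw [sub_eq_zero] at h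
    subst h
    exact h0 ((hZ _).2 hζ)
  have hb := chart_bound hk hg (st_norm hst z0 z0) (mob_sign hL hst hfin h0 z0) Z1 (by
    intro z
    change Fz _ z = 0 ↔ _
    rw [Fz_CC, mul_eq_zero, or_iff_right (inv_ne_zero h0)]
    by_cases hz : z = 0
    · subst hz
      rw [Fz_mob_zero, Finset.mem_union]
      constructor
      · intro h; right; rw [if_pos h]; simp
      · rintro (h | h)
        · obtain ⟨ζ, hζ, he⟩ := Finset.mem_image.1 h
          exact absurd he (inv_ne_zero (hne ζ hζ))
        · by_contra hc
          rw [if_neg hc] at h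
          simp at h
    · rw [Fz_mob z0 hL hz, mul_eq_zero, or_iff_right
        (ofReal_ne_zero.2 (pow_ne_zero _ (fun h => hz (normSq_eq_zero.1 h)))), hZ, Finset.mem_union]
      constructor
      · intro h
        left
        exact Finset.mem_image.2 ⟨_, h, by simp⟩
      · rintro (h | h)
        · obtain ⟨ζ, hζ, he⟩ := Finset.mem_image.1 h
          rw [← he, inv_inv]
          simpa using hζ
        · exfalso
          split_ifs at h
          · exact hz (by simpa using h)
          · simp at h)
  refine le_trans (le_of_eq ?_) hb
  rw [Finset.card_union_of_disjoint, Finset.card_image_of_injOn]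
  · split_ifs <;> simp
  · intro x hx y hy h
    simpa using h
  · split_ifs
    · rw [Finset.disjoint_singleton_right]
      intro h
      obtain ⟨ζ, hζ, he⟩ := Finset.mem_image.1 h
      exact absurd he (inv_ne_zero (hne ζ hζ))
    · exact Finset.disjoint_empty_right _

end glob
end EC

namespace EC
open Module Polynomial
open Polynomial.Bivariate (swap)
set_option linter.unusedSectionVars false

section one
open Complex

lemma cubic_zero {c0 c1 c2 c3 : ℝ} (h : ∀ t : ℝ, 0 ≤ c0 + c1 * t + c2 * t ^ 2 + c3 * t ^ 3) (h0 : c0 = 0)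
    (h1 : c0 + c1 + c2 + c3 = 0) (t : ℝ) : c0 + c1 * t + c2 * t ^ 2 + c3 * t ^ 3 = 0 := by
  subst h0
  have e : c2 = -c1 - c3 := by linarith
  subst e
  -- `h t = t (t - 1) (c3 t - c1)`
  have hA : c3 * (1 / 2) - c1 ≤ 0 := by have := h (1 / 2); nlinarith
  have key : c3 = 0 := by
    by_contra hc
    rcases lt_or_gt_of_ne hc with hc | hc
    · have h2 := h (2 + |c1 / c3|)
      have h3 : c1 / c3 ≤ |c1 / c3| := le_abs_self _
      have h4 : 0 ≤ |c1 / c3| := abs_nonneg _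
      have h5 : c1 = c3 * (c1 / c3) := by field_simp
      set a := |c1 / c3|
      set b := c1 / c3
      rw [h5] at h2
      have h6 : 0 ≤ c3 * ((2 + a) * (1 + a) * (2 + a - b)) := by nlinarith [h2]
      have h7 : 0 < (2 + a) * (1 + a) * (2 + a - b) := by
        apply mul_pos (mul_pos (by linarith) (by linarith)) (by linarith)
      nlinarith
    · have h2 := h (-(2 + |c1 / c3|))
      have h3 : -(c1 / c3) ≤ |c1 / c3| := neg_le_abs _
      have h4 : 0 ≤ |c1 / c3| := abs_nonneg _
      have h5 : c1 = c3 * (c1 / c3) := by field_simp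
      set a := |c1 / c3|
      set b := c1 / c3
      rw [h5] at h2
      have h6 : 0 ≤ -(c3 * ((2 + a) * (3 + a) * (2 + a + b))) := by nlinarith [h2]
      have h7 : 0 < (2 + a) * (3 + a) * (2 + a + b) := by
        apply mul_pos (mul_pos (by linarith) (by linarith)) (by linarith)
      nlinarith
  subst key
  have h2 := h 2
  have h3 : c1 = 0 := by linarith
  subst h3
  ring

lemma re_cubic (C0 C1 C2 C3 : ℂ) (t : ℝ) : (C0 + C1 * t + C2 * t ^ 2 + C3 * t ^ 3).re =
    C0.re + C1.re * t + C2.re * t ^ 2 + C3.re * t ^ 3 := by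
  have h : ∀ (c : ℂ) (r : ℝ), (c * r).re = c.re * r := by
    intro c r; simp
  rw [add_re, add_re, add_re, ← ofReal_pow, ← ofReal_pow, h, h, h]

lemma line_cubic {f : ℂ[X][X]} (hL : f ∈ L ℂ (2 + 1) (2 + 1)) (hc : cf f 2 2 = 0) (u δ : ℂ) :
    ∃ c0 c1 c2 c3 : ℝ, ∀ t : ℝ, (Fz f (u + t * δ)).re = c0 + c1 * t + c2 * t ^ 2 + c3 * t ^ 3 := by
  have key : ∃ C0 C1 C2 C3 : ℂ, ∀ t : ℝ, Fz f (u + t * δ) = C0 + C1 * t + C2 * t ^ 2 + C3 * t ^ 3 := by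
    obtain ⟨v, hv⟩ : ∃ v, v = starRingEnd ℂ u := ⟨_, rfl⟩
    obtain ⟨ε, hε⟩ : ∃ ε, ε = starRingEnd ℂ δ := ⟨_, rfl⟩
    refine ⟨cf f 0 0 + cf f 0 1 * v + cf f 0 2 * v ^ 2 + cf f 1 0 * u + cf f 1 1 * v * u + cf f 1 2 * v ^ 2 * u
        + cf f 2 0 * u ^ 2 + cf f 2 1 * v * u ^ 2,
      cf f 0 1 * ε + cf f 0 2 * (2 * v * ε) + cf f 1 0 * δ + cf f 1 1 * (v * δ + ε * u)
        + cf f 1 2 * (v ^ 2 * δ + 2 * v * ε * u) + cf f 2 0 * (2 * u * δ) + cf f 2 1 * (v * (2 * u * δ) + ε * u ^ 2),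
      cf f 0 2 * ε ^ 2 + cf f 1 1 * (ε * δ) + cf f 1 2 * (2 * v * ε * δ + ε ^ 2 * u) + cf f 2 0 * δ ^ 2
        + cf f 2 1 * (v * δ ^ 2 + ε * (2 * u * δ)),
      cf f 1 2 * (ε ^ 2 * δ) + cf f 2 1 * (ε * δ ^ 2), ?_⟩
    intro t
    rw [Fz, biv_eval hL, map_add, map_mul, conj_ofReal, ← hv, ← hε]
    simp only [Finset.sum_range_succ, Finset.sum_range_zero, hc]
    ring
  obtain ⟨C0, C1, C2, C3, h⟩ := key
  exact ⟨C0.re, C1.re, C2.re, C3.re, fun t => by rw [h, re_cubic]⟩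

theorem count_one {f : ℂ[X][X]} (hL : f ∈ L ℂ (2 + 1) (2 + 1)) (hst : st f = f)
    (Z : Finset ℂ) (hZ : ∀ z, Fz f z = 0 ↔ z ∈ Z) : Z.card ≤ 2 := by
  classical
  by_contra hcard
  push Not at hcard
  have hfin : {z | Fz f z = 0}.Finite := by
    convert Z.finite_toSet using 1
    ext z; simp [hZ]
  obtain ⟨p0, hp0, p1, hp1, p2, hp2, h01, h02, h12⟩ := Finset.two_lt_card.1 hcard
  obtain ⟨z1, hz1⟩ := hfin.exists_notMem
  have hz1 : Fz f z1 ≠ 0 := hz1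
  set g := C (C (Fz f z1)⁻¹) * mob p0 2 f with hg
  have hgL : g ∈ L ℂ (2 + 1) (2 + 1) := L_CC _ (mob_L _ _ _)
  have hgst : st g = g := st_norm hst p0 z1
  have hgc : cf g 2 2 = 0 := by
    have : cf g 2 2 = (Fz f z1)⁻¹ * cf (mob p0 2 f) 2 2 := by
      simp only [hg, cf, coeff_C_mul]
    rw [this, mob_corner p0 hL]
    have := (hZ p0).2 hp0
    rw [Fz] at this
    rw [this, mul_zero]
  have hgz : ∀ z, z ≠ 0 → (Fz g z = 0 ↔ p0 + z⁻¹ ∈ Z) := by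
    intro z hz
    rw [hg, Fz_CC, mul_eq_zero, or_iff_right (inv_ne_zero hz1), Fz_mob p0 hL hz, mul_eq_zero, or_iff_right
        (ofReal_ne_zero.2 (pow_ne_zero _ (fun h => hz (normSq_eq_zero.1 h)))), hZ]
  have hr : ∀ z, Fz g z = 0 ↔ (Fz g z).re = 0 := fun x => by
    rw [← Fz_re hgst x]; simp
  have hpos := mob_sign hL hst hfin hz1 p0
  rw [← hg] at hpos
  have hu0 : p1 - p0 ≠ 0 := sub_ne_zero.2 h01.symm
  have hv0 : p2 - p0 ≠ 0 := sub_ne_zero.2 h02.symm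
  set u := (p1 - p0)⁻¹ with hu
  set v := (p2 - p0)⁻¹ with hv
  have hgu : Fz g u = 0 := (hgz u (inv_ne_zero hu0)).2 (by rw [hu, inv_inv]; simpa using hp1)
  have hgv : Fz g v = 0 := (hgz v (inv_ne_zero hv0)).2 (by rw [hv, inv_inv]; simpa using hp2)
  have huv : v - u ≠ 0 := by
    intro h
    rw [sub_eq_zero] at h
    have := inv_injective h
    apply h12
    linear_combination -this
  obtain ⟨c0, c1, c2, c3, hc⟩ := line_cubic hgL hgc u (v - u)
  have e0 : c0 = 0 := by
    have := hc 0
    simp only [ofReal_zero, zero_mul, add_zero, hgu] at this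
    simpa using this.symm
  have e1 : c0 + c1 + c2 + c3 = 0 := by
    have := hc 1
    simp only [ofReal_one, one_mul, add_sub_cancel, hgv] at this
    simpa using this.symm
  have hall : ∀ t : ℝ, Fz g (u + t * (v - u)) = 0 := by
    intro t
    rw [hr, hc, cubic_zero (fun t => by rw [← hc]; exact hpos _) e0 e1]
  have hinj : Function.Injective (fun t : ℝ => u + t * (v - u)) := by
    intro s t h
    have h : u + s * (v - u) = u + t * (v - u) := h
    have := mul_right_cancel₀ huv (add_left_cancel h)
    exact_mod_cast this
  have hinf := Set.infinite_range_of_injective hinj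
  apply hinf
  refine ((Z.image (fun ζ => (ζ - p0)⁻¹) ∪ {0}).finite_toSet).subset ?_
  rintro _ ⟨t, rfl⟩
  by_cases hz : u + t * (v - u) = 0
  · simp [hz]
  · have := (hgz _ hz).1 (hall t)
    simp only [Finset.coe_union, Finset.coe_image, Set.mem_union]
    left
    exact ⟨_, this, by simp⟩

end one
end EC

namespace EC
open Module Polynomial
open Polynomial.Bivariate (swap)
set_option linter.unusedSectionVars false

section fin
open Complex

lemma st_mm (i j : ℕ) (c : ℂ) : st (mm i j c) = mm j i (starRingEnd ℂ c) := by
  apply cf_ext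
  intro a b
  rw [cf_st, cf_mm, cf_mm]
  by_cases h : a = j ∧ b = i
  · obtain ⟨rfl, rfl⟩ := h
    simp
  · rw [if_neg (by tauto), if_neg (by tauto), map_zero]

lemma st_xx (i : Fin 4) : st (xx i) = xx i := by
  have h2 : starRingEnd ℂ 2 = 2 := Complex.conj_ofNat 2
  fin_cases i
  · simp [xx, st_mm, add_comm, h2]
  · simp [xx, st_mm, add_comm, h2]
  · simp [xx, st_mm, h2]
  · simp [xx, st_mm, h2]

lemma st_ff (G : MvPolynomial (Fin 4) ℝ) : st (ff (MvPolynomial.map (algebraMap ℝ ℂ) G)) = ff (MvPolynomial.map (algebraMap ℝ ℂ) G) := by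
  unfold ff
  induction G using MvPolynomial.induction_on with
  | C a =>
    rw [MvPolynomial.map_C, MvPolynomial.aeval_C]
    change st (C (C ((a : ℝ) : ℂ))) = C (C ((a : ℝ) : ℂ))
    rw [st_CC, conj_ofReal]
  | add p q hp hq => rw [map_add, map_add, map_add, hp, hq]
  | mul_X p i hp => rw [map_mul, map_mul, map_mul, hp, MvPolynomial.map_X, MvPolynomial.aeval_X, st_xx]

/-- inverse stereographic projection -/
noncomputable def pt (z : ℂ) : Fin 4 → ℝ := ![z.re, z.im, (normSq z - 1) / 2, (normSq z + 1) / 2]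

lemma xx_pt (z : ℂ) (i : Fin 4) : (xx i).evalEval (starRingEnd ℂ z) z = ((pt z i : ℝ) : ℂ) := by
  have h1 : z * starRingEnd ℂ z = normSq z := mul_conj z
  fin_cases i
  · change evalEval _ _ (mm 1 0 (1/2) + mm 0 1 (1/2)) = ((z.re : ℝ) : ℂ)
    rw [evalEval_add, evalEval_mm, evalEval_mm, re_eq_add_conj]; ring
  · change evalEval _ _ (mm 1 0 (-I/2) + mm 0 1 (I/2)) = ((z.im : ℝ) : ℂ)
    rw [evalEval_add, evalEval_mm, evalEval_mm, im_eq_sub_conj]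
    field_simp
    linear_combination (starRingEnd ℂ z - z) * I_sq
  · change evalEval _ _ (mm 1 1 (1/2) + mm 0 0 (-1/2)) = (((normSq z - 1) / 2 : ℝ) : ℂ)
    rw [evalEval_add, evalEval_mm, evalEval_mm]
    push_cast
    linear_combination (1 / 2) * h1
  · change evalEval _ _ (mm 1 1 (1/2) + mm 0 0 (1/2)) = (((normSq z + 1) / 2 : ℝ) : ℂ)
    rw [evalEval_add, evalEval_mm, evalEval_mm]
    push_cast
    linear_combination (1 / 2) * h1

lemma eval_cast (G : MvPolynomial (Fin 4) ℝ) (v : Fin 4 → ℝ) :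
    MvPolynomial.eval (fun i => ((v i : ℝ) : ℂ)) (MvPolynomial.map (algebraMap ℝ ℂ) G) = ((MvPolynomial.eval v G : ℝ) : ℂ) := by
  induction G using MvPolynomial.induction_on with
  | C a => simp
  | add p q hp hq => simp only [map_add, hp, hq, ofReal_add]
  | mul_X p i hp => simp only [map_mul, hp, MvPolynomial.map_X, MvPolynomial.eval_X, ofReal_mul]

lemma Fz_ff (G : MvPolynomial (Fin 4) ℝ) (z : ℂ) :
    Fz (ff (MvPolynomial.map (algebraMap ℝ ℂ) G)) z = ((MvPolynomial.eval (pt z) G : ℝ) : ℂ) := by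
  rw [Fz, ff_eval, ← eval_cast]
  congr 2
  funext i
  exact xx_pt z i

lemma Lam_north {R : Type*} [CommRing R] [Algebra ℂ R] {a b c e : R} {d : ℕ} {p : ℂ[X][X]} (hp : p ∈ L ℂ (d + 1) (d + 1)) (χ : R →ₐ[ℂ] ℂ)
    (ha : χ a = 0) (hb : χ b = 0) (hc : χ c = 0) (he : χ e = 2) :
    χ (Lam a b c e d p) = 2 ^ d * cf p d d := by
  refine L_ind (fun p => χ (Lam a b c e d p) = 2 ^ d * cf p d d) (by simp [cf_zero])
    (fun p p' h h' => by simp only [map_add, h, h', cf_add, mul_add]) ?_ hp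
  intro i j r hi hj
  rw [Lam_mm (by omega) (by omega), map_smul, cf_mm]
  unfold tt
  by_cases h : i = d ∧ j = d
  · obtain ⟨rfl, rfl⟩ := h
    simp [he]; ring
  · by_cases h2 : j ≤ i
    · rw [if_pos h2, if_neg (by omega)]
      by_cases h3 : i = d
      · simp [ha, show i - j ≠ 0 by omega]
      · simp [hc, show d - i ≠ 0 by omega]
    · rw [if_neg h2, if_neg (by omega)]
      simp [hb, show j - i ≠ 0 by omega]

lemma exists_charn : ∃ χ : RQ →ₐ[ℂ] ℂ, (χ ya = 0 ∧ χ yb = 0 ∧ χ yc = 0 ∧ χ ye = 2) ∧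
    ∀ H, χ (mkq H) = MvPolynomial.eval (![0, 0, 1, 1] : Fin 4 → ℂ) H := by
  have hv : (![0, 0, 1, 1] : Fin 4 → ℂ) 0 ^ 2 + (![0, 0, 1, 1] : Fin 4 → ℂ) 1 ^ 2
      + (![0, 0, 1, 1] : Fin 4 → ℂ) 2 ^ 2 - (![0, 0, 1, 1] : Fin 4 → ℂ) 3 ^ 2 = 0 := by
    change (0 : ℂ) ^ 2 + 0 ^ 2 + 1 ^ 2 - 1 ^ 2 = 0
    norm_num
  refine ⟨evq _ hv, ⟨?_, ?_, ?_, ?_⟩, evq_mkq _ hv⟩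
  · rw [ya, evq_mkq, map_add, map_mul, MvPolynomial.eval_X, MvPolynomial.eval_X, MvPolynomial.eval_C]
    change (0 : ℂ) + I * 0 = 0
    ring
  · rw [yb, evq_mkq, map_sub, map_mul, MvPolynomial.eval_X, MvPolynomial.eval_X, MvPolynomial.eval_C]
    change (0 : ℂ) - I * 0 = 0
    ring
  · rw [yc, evq_mkq, map_sub, MvPolynomial.eval_X, MvPolynomial.eval_X]
    change (1 : ℂ) - 1 = 0
    ring
  · rw [ye, evq_mkq, map_add, MvPolynomial.eval_X, MvPolynomial.eval_X]
    change (1 : ℂ) + 1 = 2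
    norm_num

noncomputable def north : Fin 4 → ℝ := ![0, 0, 1, 1]

lemma cf_north {G : MvPolynomial (Fin 4) ℝ} {m : ℕ} (hG : G.IsHomogeneous m) (h : MvPolynomial.eval north G = 0) :
    cf (ff (MvPolynomial.map (algebraMap ℝ ℂ) G)) m m = 0 := by
  have hH : (MvPolynomial.map (algebraMap ℝ ℂ) G).IsHomogeneous m := hG.map _
  obtain ⟨χ, ⟨ha, hb, hc, he⟩, hχ⟩ := exists_charn
  have h1 : χ (Lq m (ff (MvPolynomial.map (algebraMap ℝ ℂ) G))) = _ := Lam_north (ff_hom hH).1 χ ha hb hc he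
  have h3 : (![0, 0, 1, 1] : Fin 4 → ℂ) = fun i => ((north i : ℝ) : ℂ) := by
    funext i
    fin_cases i <;> simp [north]
  rw [(ff_hom hH).2, hχ, h3, eval_cast, h] at h1
  simpa using h1.symm

lemma eval_smul_hom {G : MvPolynomial (Fin 4) ℝ} {m : ℕ} (hG : G.IsHomogeneous m) (c : ℝ) (v : Fin 4 → ℝ) :
    MvPolynomial.eval (c • v) G = c ^ m * MvPolynomial.eval v G := by
  rw [MvPolynomial.eval_eq', MvPolynomial.eval_eq', Finset.mul_sum]
  refine Finset.sum_congr rfl fun d hd => ?_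
  have h1 : d.degree = m := by
    rw [Finsupp.degree_eq_weight_one]
    exact hG (MvPolynomial.mem_support_iff.1 hd)
  have h2 : ∑ i, d i = m := by rw [← h1, Finsupp.degree_eq_sum]
  simp only [Pi.smul_apply, smul_eq_mul, mul_pow]
  rw [Finset.prod_mul_distrib, Finset.prod_pow_eq_pow_sum, h2]
  ring

lemma pt_ne (z : ℂ) : pt z ≠ 0 := by
  intro h
  have h2 := congrFun h 2
  have h3 := congrFun h 3
  simp only [pt] at h2 h3
  change (normSq z - 1) / 2 = 0 at h2
  change (normSq z + 1) / 2 = 0 at h3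
  linarith

lemma north_ne : north ≠ 0 := by
  intro h
  have h2 := congrFun h 2
  change (1 : ℝ) = 0 at h2
  exact one_ne_zero h2

noncomputable def pp (z : ℂ) : Projectivization ℝ (Fin 4 → ℝ) := Projectivization.mk ℝ (pt z) (pt_ne z)

lemma pp_inj : Function.Injective pp := by
  intro z w h
  obtain ⟨a, ha⟩ := (Projectivization.mk_eq_mk_iff' ℝ _ _ _ _).1 h
  have h0 : a * w.re = z.re := congrFun ha 0
  have h1 : a * w.im = z.im := congrFun ha 1
  have h2 : a * ((normSq w - 1) / 2) = (normSq z - 1) / 2 := congrFun ha 2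
  have h3 : a * ((normSq w + 1) / 2) = (normSq z + 1) / 2 := congrFun ha 3
  have h4 : a = 1 := by linarith
  subst h4
  apply Complex.ext <;> linarith

lemma pp_mem {G : MvPolynomial (Fin 4) ℝ} {m : ℕ} (hG : G.IsHomogeneous m) {z : ℂ} (hz : MvPolynomial.eval (pt z) G = 0) :
    pp z ∈ sphereRZ G := by
  obtain ⟨a, ha⟩ := Projectivization.exists_smul_eq_mk_rep ℝ (pt z) (pt_ne z)
  have ha : (pp z).rep = (a : ℝ) • pt z := ha.symm
  constructor
  · rw [ha]
    change ((a : ℝ) * z.re) ^ 2 + ((a : ℝ) * z.im) ^ 2 + ((a : ℝ) * ((normSq z - 1) / 2)) ^ 2 = ((a : ℝ) * ((normSq z + 1) / 2)) ^ 2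
    rw [normSq_apply]; ring
  · rw [ha, eval_smul_hom hG, hz, mul_zero]

lemma mem_cases {G : MvPolynomial (Fin 4) ℝ} {m : ℕ} (hG : G.IsHomogeneous m) {x : Projectivization ℝ (Fin 4 → ℝ)}
    (hx : x ∈ sphereRZ G) : (∃ z, MvPolynomial.eval (pt z) G = 0 ∧ x = pp z) ∨
      (MvPolynomial.eval north G = 0 ∧ x = Projectivization.mk ℝ north north_ne) := by
  obtain ⟨h1, h2⟩ := hx
  have hx0 := x.rep_nonzero
  have hxr := x.mk_rep
  set v := x.rep with hv
  by_cases hs : v 3 - v 2 = 0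
  · right
    have h3 : v 3 = v 2 := by linarith
    have h4 : v 0 = 0 := by rw [h3] at h1; nlinarith [sq_nonneg (v 0), sq_nonneg (v 1)]
    have h5 : v 1 = 0 := by rw [h3] at h1; nlinarith [sq_nonneg (v 0), sq_nonneg (v 1)]
    have hvn : v = (v 2) • north := by
      funext i
      fin_cases i
      · simp [north, h4]
      · simp [north, h5]
      · simp [north]
      · simp [north, h3]
    have h6 : v 2 ≠ 0 := by
      intro h; apply hx0; rw [hvn, h, zero_smul]
    constructor
    · rw [hvn, eval_smul_hom hG] at h2
      exact (mul_eq_zero.1 h2).resolve_left (pow_ne_zero _ h6)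
    · rw [← hxr, Projectivization.mk_eq_mk_iff']
      exact ⟨v 2, hvn.symm⟩
  · left
    set s := v 3 - v 2 with hsd
    set z : ℂ := ⟨v 0 / s, v 1 / s⟩ with hz
    have hn : normSq z = (v 3 + v 2) / s := by
      rw [normSq_apply]
      change v 0 / s * (v 0 / s) + v 1 / s * (v 1 / s) = _
      field_simp
      rw [hsd]; linarith
    have hvp : v = s • pt z := by
      funext i
      fin_cases i
      · change v 0 = s * (v 0 / s); field_simp
      · change v 1 = s * (v 1 / s); field_simp
      · change v 2 = s * ((normSq z - 1) / 2)
        rw [hn]; field_simp; rw [hsd]; ring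
      · change v 3 = s * ((normSq z + 1) / 2)
        rw [hn]; field_simp; rw [hsd]; ring
    refine ⟨z, ?_, ?_⟩
    · rw [hvp, eval_smul_hom hG] at h2
      exact (mul_eq_zero.1 h2).resolve_left (pow_ne_zero _ hs)
    · rw [← hxr, pp, Projectivization.mk_eq_mk_iff']
      exact ⟨s, hvp.symm⟩

theorem final_bound (k : ℕ) (hk : 1 ≤ k) (G : MvPolynomial (Fin 4) ℝ)
    (hhom : G.IsHomogeneous (2 * k)) (hsf : SquarefreeOnEllipsoid G) (hfin : (sphereRZ G).Finite) :
    (sphereRZ G).ncard ≤ 3 * k ^ 2 - 2 * k + 2 := by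
  classical
  set H := MvPolynomial.map (algebraMap ℝ ℂ) G with hH
  have hHh : H.IsHomogeneous (2 * k) := hhom.map _
  have hsf' : Squarefree (mkq H) := hsf
  have hst : st (ff H) = ff H := st_ff G
  have hL := (ff_hom hHh).1
  have hFz : ∀ z, Fz (ff H) z = 0 ↔ MvPolynomial.eval (pt z) G = 0 := by
    intro z; rw [hH, Fz_ff, ofReal_eq_zero]
  have hZfin : {z | Fz (ff H) z = 0}.Finite :=
    Set.Finite.of_finite_image (f := pp) (hfin.subset (by
      rintro _ ⟨z, hz, rfl⟩
      exact pp_mem hhom ((hFz z).1 hz))) pp_inj.injOn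
  set Z := hZfin.toFinset with hZ
  have hZm : ∀ z, Fz (ff H) z = 0 ↔ z ∈ Z := by intro z; simp [hZ]
  have hcard : (sphereRZ G).ncard ≤ Z.card + (if cf (ff H) (2 * k) (2 * k) = 0 then 1 else 0) := by
    have hsub : sphereRZ G ⊆ ↑(Z.image pp ∪ (if cf (ff H) (2 * k) (2 * k) = 0 then
        {Projectivization.mk ℝ north north_ne} else ∅)) := by
      intro x hx
      rw [Finset.mem_coe, Finset.mem_union]
      rcases mem_cases hhom hx with ⟨z, hz, rfl⟩ | ⟨h, rfl⟩
      · left; exact Finset.mem_image_of_mem _ ((hZm z).1 ((hFz z).2 hz))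
      · right; rw [if_pos (cf_north hhom h)]; simp
    refine (Set.ncard_le_ncard hsub (Finset.finite_toSet _)).trans ?_
    rw [Set.ncard_coe_finset]
    refine (Finset.card_union_le _ _).trans (Nat.add_le_add Finset.card_image_le ?_)
    split_ifs <;> simp
  refine hcard.trans ?_
  rcases Nat.lt_or_ge k 2 with h | h
  · obtain rfl : k = 1 := by omega
    have := count_one hL hst Z hZm
    have h2 : (if cf (ff H) (2 * 1) (2 * 1) = 0 then 1 else 0) ≤ 1 := by split_ifs <;> simp
    omega
  · exact count_bound h hL hst (sqf_ff hHh hsf' hst) (deg_ff hHh hsf' hst) Z hZm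

end fin
end EC

theorem stmt_9 (k : ℕ) (hk : 1 ≤ k) (G : MvPolynomial (Fin 4) ℝ) (hG : G ≠ 0)
    (hhom : G.IsHomogeneous (2 * k))
    (hsf : SquarefreeOnEllipsoid G)
    (hfin : (sphereRZ G).Finite) :
    (sphereRZ G).ncard ≤ 3 * k ^ 2 - 2 * k + 2 := by
  exact EC.final_bound k hk G hhom hsf hfin
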